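/- arXiv:1409.6701 — 5 statements merged into one kernel-verified Lean document; each statement's English description precedes it below -/
import Mathlib

section
/- The lattice tetrahedron T = conv{(0,0,0), (1,0,0), (0,1,0), (a,b,q)} with q ≥ 1 contains no points of ℤ³ other than its four vertices if and only if at least one of the following holds: (i) a ≡ 1 (mod q) and gcd(b,q) = 1; (ii) b ≡ 1 (mod q) and gcd(a,q) = 1; (iii) a + b ≡ 0 (mod q) and gcd(a,q) = 1. -/
/-- The inclusion of lattice points of ℤ³ into ℝ³. -/
def toR (p : Fin 3 → ℤ) : Fin 3 → ℝ := fun i => (p i : ℝ)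

/-- Key combinatorial lemma, ordered version. -/
lemma key_ordered (q A B C : ℤ) (hC : 2 ≤ C) (hCB : C ≤ B) (hBA : B ≤ A)
    (hs : A + B + C = q + 1)
    (h : ∀ t : ℤ, 1 ≤ t → t ≤ q - 1 → (t * A) / q + (t * B) / q + (t * C) / q = t - 1) :
    False := by
  have hq : 0 < q := by linarith
  have ceil_ex : ∀ X : ℤ, 2 ≤ X → ∃ m : ℤ, (m - 1) * X < q ∧ q ≤ m * X := by
    intro X hX
    have hX0 : 0 < X := by linarith
    refine ⟨(q - 1) / X + 1, ?_, ?_⟩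
    · have := Int.ediv_mul_le (q - 1) hX0.ne'
      ring_nf at this ⊢
      linarith
    · have := Int.lt_ediv_add_one_mul_self (q - 1) hX0
      linarith
  have le_fl : ∀ n y : ℤ, n * q ≤ y → n ≤ y / q := fun n y hh => (Int.le_ediv_iff_mul_le hq).2 hh
  have fl_lt : ∀ n y : ℤ, y < n * q → y / q < n := fun n y hh => (Int.ediv_lt_iff_lt_mul hq).2 hh
  have of_le : ∀ n y : ℤ, n ≤ y / q → n * q ≤ y := fun n y hh => (Int.le_ediv_iff_mul_le hq).1 hh
  have of_lt : ∀ n y : ℤ, y / q < n → y < n * q := fun n y hh => (Int.ediv_lt_iff_lt_mul hq).1 hh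
  obtain ⟨m, hm1, hm2⟩ := ceil_ex B (by linarith)
  obtain ⟨c, hc1, hc2⟩ := ceil_ex C hC
  have h2 := h 2 (by norm_num) (by linarith)
  have h2C : 0 ≤ 2 * C / q := le_fl _ _ (by linarith)
  have hB2 : 2 * B < q := by
    by_contra hcon
    have e1 : 1 ≤ 2 * B / q := le_fl _ _ (by linarith)
    have e2 : 1 ≤ 2 * A / q := le_fl _ _ (by linarith)
    linarith
  have hm3 : 3 ≤ m := by
    by_contra hcon
    have : m ≤ 2 := by linarith
    nlinarith
  have hcm : m ≤ c := by
    by_contra hcon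
    have h1 : c ≤ m - 1 := by linarith
    have h3 : c * C ≤ (m - 1) * C := mul_le_mul_of_nonneg_right h1 (by linarith)
    have h4 : (m - 1) * C ≤ (m - 1) * B := mul_le_mul_of_nonneg_left hCB (by linarith)
    linarith
  have hc2q : 2 * c ≤ q + 1 := by
    have : (c - 1) * 2 ≤ (c - 1) * C := mul_le_mul_of_nonneg_left hC (by linarith)
    linarith
  -- A at time m-1
  have hAm : (m - 2) * q ≤ (m - 1) * A := by
    have e := h (m - 1) (by linarith) (by linarith)
    have e1 := fl_lt 1 ((m - 1) * B) (by linarith)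
    have e2 := fl_lt 1 ((m - 1) * C)
      (by nlinarith [mul_le_mul_of_nonneg_left hCB (show 0 ≤ m - 1 by linarith)])
    exact of_le _ _ (by linarith)
  have hmono : ∀ X s t : ℤ, 0 ≤ X → s ≤ t → s * X / q ≤ t * X / q := fun X s t hX hst =>
    Int.ediv_le_ediv hq (mul_le_mul_of_nonneg_right hst hX)
  have ec := h c (by linarith) (by linarith)
  have ec1 := h (c - 1) (by linarith) (by linarith)
  have c1 := le_fl 1 (c * C) (by linarith)
  have c2 := fl_lt 1 ((c - 1) * C) (by linarith)
  have bm := hmono B (c - 1) c (by linarith) (by linarith)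
  have am := hmono A (c - 1) c (by linarith) (by linarith)
  have hf : c * A / q = (c - 1) * A / q := by linarith
  have f1 := of_le ((c - 1) * A / q) ((c - 1) * A) le_rfl
  have f2 := of_lt (c * A / q + 1) (c * A) (by linarith)
  set f := (c - 1) * A / q with hfdef
  rw [hf] at f2
  have g1 := le_fl (f + m - 2) ((c + m - 2) * A) (by linarith)
  have g2 := fl_lt (f - m + 3) ((c - m + 1) * A) (by linarith)
  have eu := h (c + m - 2) (by linarith) (by linarith)
  have el := h (c - m + 1) (by linarith) (by linarith)
  have k1 := hmono C c (c + m - 2) (by linarith) (by linarith)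
  have k2 := hmono C (c - m + 1) (c - 1) (by linarith) (by linarith)
  have b0 := of_le ((c - m + 1) * B / q) ((c - m + 1) * B) le_rfl
  have b1 := le_fl ((c - m + 1) * B / q + 1) ((c + m - 2) * B) (by nlinarith)
  linarith

lemma key (q A B C : ℤ) (hA : 1 ≤ A) (hB : 1 ≤ B) (hC : 1 ≤ C)
    (hs : A + B + C = q + 1)
    (h : ∀ t : ℤ, 1 ≤ t → t ≤ q - 1 → (t * A) / q + (t * B) / q + (t * C) / q = t - 1) :
    A = 1 ∨ B = 1 ∨ C = 1 := by
  by_contra hcon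
  push Not at hcon
  obtain ⟨h1, h2, h3⟩ := hcon
  have hA : 2 ≤ A := by omega
  have hB : 2 ≤ B := by omega
  have hC : 2 ≤ C := by omega
  rcases le_total A B with hab | hab <;> rcases le_total B C with hbc | hbc <;>
    rcases le_total A C with hac | hac
  · exact key_ordered q C B A hA hab hbc (by linarith) fun t u v => by linarith [h t u v]
  · exact key_ordered q C B A hA hab hbc (by linarith) fun t u v => by linarith [h t u v]
  · exact key_ordered q B C A hA hac hbc (by linarith) fun t u v => by linarith [h t u v]
  · exact key_ordered q B A C hC hac hab (by linarith) fun t u v => by linarith [h t u v]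
  · exact key_ordered q C A B hB hab hac (by linarith) fun t u v => by linarith [h t u v]
  · exact key_ordered q A C B hB hbc hac (by linarith) fun t u v => by linarith [h t u v]
  · exact key_ordered q A B C hC hbc hab (by linarith) fun t u v => by linarith [h t u v]
  · exact key_ordered q A B C hC hbc hab (by linarith) fun t u v => by linarith [h t u v]

/-- Integer form of emptiness. -/
def EmptyInt (a b q : ℤ) : Prop :=
  ∀ t x y : ℤ, 1 ≤ t → t ≤ q - 1 → t * a ≤ q * x → t * b ≤ q * y →
    t * (a + b - 1) < q * (x + y - 1)

lemma EmptyInt.symm {a b q : ℤ} (h : EmptyInt a b q) : EmptyInt b a q := by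
  intro t x y h1 h2 h3 h4
  have := h t y x h1 h2 h4 h3
  linarith

lemma not_dvd_of_gcd {a q t : ℤ} (hg : Int.gcd a q = 1) (h1 : 1 ≤ t) (h2 : t ≤ q - 1) :
    ¬ q ∣ t * a := by
  intro hd
  have hc : IsCoprime q a := (Int.isCoprime_iff_gcd_eq_one.2 hg).symm
  have := Int.le_of_dvd (by linarith) (hc.dvd_of_dvd_mul_right hd)
  linarith

lemma gcd_of_not_dvd {a q : ℤ} (hq : 1 ≤ q)
    (h : ∀ t : ℤ, 1 ≤ t → t ≤ q - 1 → ¬ q ∣ t * a) : Int.gcd a q = 1 := by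
  by_contra hne
  obtain ⟨u, hu⟩ := Int.gcd_dvd_left a q
  obtain ⟨v, hv⟩ := Int.gcd_dvd_right a q
  have hpos : 0 < Int.gcd a q := Int.gcd_pos_of_ne_zero_right _ (by linarith)
  have hg : (2 : ℤ) ≤ (Int.gcd a q : ℤ) := by omega
  generalize (Int.gcd a q : ℤ) = g at *
  have hv0 : 1 ≤ v := by
    by_contra hcon
    nlinarith
  refine h v hv0 (by nlinarith) ⟨u, ?_⟩
  rw [hu, hv]; ring

lemma EmptyInt.not_dvd {A B q : ℤ} (h : EmptyInt A B q) (t : ℤ) (h1 : 1 ≤ t) (h2 : t ≤ q - 1) :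
    ¬ q ∣ t * A := by
  rintro ⟨k, hk⟩
  have hq : 0 < q := by linarith
  have e1 := Int.mul_ediv_self_le (x := t * B) hq.ne'
  have e2 := Int.lt_mul_ediv_self_add (x := t * B) hq
  set g := t * B / q
  have u1 := h t k (g + 1) h1 h2 hk.le (by linarith)
  have u2 := h (q - t) (A - k) (B - g) (by linarith) (by linarith) (by linarith) (by linarith)
  nlinarith

lemma EmptyInt.cond {a b q : ℤ} (hq : 1 ≤ q) (h : EmptyInt a b q) :
    ((a ≡ 1 [ZMOD q] ∧ Int.gcd b q = 1) ∨
       (b ≡ 1 [ZMOD q] ∧ Int.gcd a q = 1) ∨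
       (a + b ≡ 0 [ZMOD q] ∧ Int.gcd a q = 1)) := by
  have hga := gcd_of_not_dvd hq h.not_dvd
  have hgb := gcd_of_not_dvd hq h.symm.not_dvd
  rcases eq_or_lt_of_le hq with h1 | h1
  · left
    subst h1
    exact ⟨Int.modEq_one, hgb⟩
  have hq0 : 0 < q := by linarith
  have da := Int.emod_add_mul_ediv a q
  have db := Int.emod_add_mul_ediv b q
  have a0 := Int.emod_nonneg a hq0.ne'
  have b0 := Int.emod_nonneg b hq0.ne'
  have a1 := Int.emod_lt_of_pos a hq0
  have b1 := Int.emod_lt_of_pos b hq0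
  set A := a % q with hA
  set B := b % q with hB
  set α := a / q
  set β := b / q
  have hE : EmptyInt A B q := by
    intro t x y h1 h2 h3 h4
    have := h t (x + t * α) (y + t * β) h1 h2 (by rw [← da]; linarith) (by rw [← db]; linarith)
    rw [← da, ← db] at this
    linarith
  have hA1 : 1 ≤ A := by
    by_contra hcon
    have : A = 0 := by omega
    exact hE.not_dvd 1 le_rfl (by linarith) (by simp [this])
  have hB1 : 1 ≤ B := by
    by_contra hcon
    have : B = 0 := by omega
    exact hE.symm.not_dvd 1 le_rfl (by linarith) (by simp [this])
  have hAB := hE 1 1 1 le_rfl (by linarith) (by linarith) (by linarith)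
  have hk := key q A B (q + 1 - A - B) hA1 hB1 (by linarith) (by ring) (by
    intro t h1 h2
    have e1 := Int.mul_ediv_self_le (x := t * A) hq0.ne'
    have e2 := Int.lt_mul_ediv_self_add (x := t * A) hq0
    have e3 := Int.mul_ediv_self_le (x := t * B) hq0.ne'
    have e4 := Int.lt_mul_ediv_self_add (x := t * B) hq0
    set f := t * A / q
    set g := t * B / q
    have u1 := hE t (f + 1) (g + 1) h1 h2 (by linarith) (by linarith)
    have u2 := hE (q - t) (A - f) (B - g) (by linarith) (by linarith) (by linarith) (by linarith)
    have v1 : t - f - g - 1 ≤ t * (q + 1 - A - B) / q :=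
      (Int.le_ediv_iff_mul_le hq0).2 (by linarith)
    have v2 : t * (q + 1 - A - B) / q < t - f - g :=
      (Int.ediv_lt_iff_lt_mul hq0).2 (by linarith)
    linarith)
  rcases hk with hk | hk | hk
  · left
    refine ⟨?_, hgb⟩
    exact (Int.modEq_iff_dvd.2 ⟨-α, by linarith⟩)
  · right; left
    exact ⟨Int.modEq_iff_dvd.2 ⟨-β, by linarith⟩, hga⟩
  · right; right
    exact ⟨Int.modEq_iff_dvd.2 ⟨-α - β - 1, by linarith⟩, hga⟩

lemma emptyInt_one {a b q : ℤ} (ha : a ≡ 1 [ZMOD q]) (hb : Int.gcd b q = 1) :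
    EmptyInt a b q := by
  intro t x y h1 h2 h3 h4
  have hq : 0 < q := by linarith
  obtain ⟨k, hk⟩ := Int.modEq_iff_dvd.1 ha
  have hlt : t * b < q * y := lt_of_le_of_ne h4 fun he => not_dvd_of_gcd hb h1 h2 ⟨y, he⟩
  have ha' : a = 1 - q * k := by linarith
  subst ha'
  have hx : 0 < x + t * k := by
    by_contra hcon
    nlinarith
  nlinarith

lemma emptyInt_of_cond {a b q : ℤ} (h : ((a ≡ 1 [ZMOD q] ∧ Int.gcd b q = 1) ∨
       (b ≡ 1 [ZMOD q] ∧ Int.gcd a q = 1) ∨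
       (a + b ≡ 0 [ZMOD q] ∧ Int.gcd a q = 1))) : EmptyInt a b q := by
  rcases h with ⟨h, hg⟩ | ⟨h, hg⟩ | ⟨h, hg⟩
  · exact emptyInt_one h hg
  · exact (emptyInt_one h hg).symm
  · intro t x y h1 h2 h3 h4
    have hq : 0 < q := by linarith
    obtain ⟨k, hk⟩ := Int.modEq_iff_dvd.1 h
    have hlt : t * a < q * x := lt_of_le_of_ne h3 fun he => not_dvd_of_gcd hg h1 h2 ⟨x, he⟩
    have hb : b = - q * k - a := by linarith
    subst hb
    have hx : 0 < x + y + t * k := by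
      by_contra hcon
      nlinarith
    nlinarith

lemma mem_hull_iff (a b q : ℤ) (hq : 1 ≤ q) (z : Fin 3 → ℤ) :
    toR z ∈ convexHull ℝ
        (toR '' ({![0,0,0], ![1,0,0], ![0,1,0], ![a,b,q]} : Set (Fin 3 → ℤ))) ↔
    (0 ≤ z 2 ∧ z 2 * a ≤ q * z 0 ∧ z 2 * b ≤ q * z 1 ∧
      q * (z 0 + z 1 - 1) ≤ z 2 * (a + b - 1)) := by
  constructor
  · intro hz
    let S : Set (Fin 3 → ℝ) := {p | 0 ≤ p 2 ∧ p 2 * a ≤ q * p 0 ∧ p 2 * b ≤ q * p 1 ∧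
      q * (p 0 + p 1 - 1) ≤ p 2 * ((a : ℝ) + b - 1)}
    have hS : Convex ℝ S := by
      rintro x ⟨x1, x2, x3, x4⟩ y ⟨y1, y2, y3, y4⟩ u v hu hv huv
      have hv' : v = 1 - u := by linarith
      refine ⟨?_, ?_, ?_, ?_⟩ <;> simp only [Pi.add_apply, Pi.smul_apply, smul_eq_mul]
      · positivity
      · nlinarith [mul_le_mul_of_nonneg_left x2 hu, mul_le_mul_of_nonneg_left y2 hv]
      · nlinarith [mul_le_mul_of_nonneg_left x3 hu, mul_le_mul_of_nonneg_left y3 hv]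
      · have e1 := mul_le_mul_of_nonneg_left x4 hu
        have e2 := mul_le_mul_of_nonneg_left y4 hv
        subst hv'
        linarith
    have hq' : (0 : ℝ) ≤ q := by exact_mod_cast (by linarith : (0 : ℤ) ≤ q)
    have hsub : (toR '' ({![0,0,0], ![1,0,0], ![0,1,0], ![a,b,q]} : Set (Fin 3 → ℤ))) ⊆ S := by
      rintro _ ⟨p, hp, rfl⟩
      rcases hp with rfl | rfl | rfl | rfl <;>
        refine ⟨?_, ?_, ?_, ?_⟩ <;> simp [toR, hq'] <;> linarith
    obtain ⟨h1, h2, h3, h4⟩ := convexHull_min hsub hS hz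
    simp only [toR] at h1 h2 h3 h4
    exact ⟨by exact_mod_cast h1, by exact_mod_cast h2, by exact_mod_cast h3, by exact_mod_cast h4⟩
  · rintro ⟨h1, h2, h3, h4⟩
    have hq' : (0 : ℝ) < q := by exact_mod_cast (by linarith : (0 : ℤ) < q)
    have r1 : (0 : ℝ) ≤ z 2 := by exact_mod_cast h1
    have r2 : (z 2 : ℝ) * a ≤ q * z 0 := by exact_mod_cast h2
    have r3 : (z 2 : ℝ) * b ≤ q * z 1 := by exact_mod_cast h3
    have r4 : (q : ℝ) * (z 0 + z 1 - 1) ≤ z 2 * (a + b - 1) := by exact_mod_cast h4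
    let w : Fin 4 → ℝ := ![(z 2 * (a + b - 1) - q * (z 0 + z 1 - 1)) / q,
      (q * z 0 - z 2 * a) / q, (q * z 1 - z 2 * b) / q, z 2 / q]
    let P : Fin 4 → (Fin 3 → ℤ) := ![![0,0,0], ![1,0,0], ![0,1,0], ![a,b,q]]
    have hsum : toR z = ∑ i, w i • toR (P i) := by
      ext j
      fin_cases j <;> simp [Fin.sum_univ_four, w, P, toR] <;> field_simp <;> ring
    rw [hsum]
    refine (convex_convexHull ℝ _).sum_mem ?_ ?_ ?_
    · intro i _
      fin_cases i <;> simp [w] <;> apply div_nonneg <;> linarith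
    · simp [Fin.sum_univ_four, w]
      field_simp
      ring
    · intro i _
      apply subset_convexHull
      refine ⟨P i, ?_, rfl⟩
      fin_cases i <;> simp [P]

lemma empty_iff (a b q : ℤ) (hq : 1 ≤ q) :
    (∀ z : Fin 3 → ℤ,
      toR z ∈ convexHull ℝ
        (toR '' ({![0,0,0], ![1,0,0], ![0,1,0], ![a,b,q]} : Set (Fin 3 → ℤ))) →
      z ∈ ({![0,0,0], ![1,0,0], ![0,1,0], ![a,b,q]} : Set (Fin 3 → ℤ))) ↔ EmptyInt a b q := by
  have hv : ∀ z : Fin 3 → ℤ, ∀ u v w : ℤ, z = ![u, v, w] ↔ z 0 = u ∧ z 1 = v ∧ z 2 = w := by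
    intro z u v w
    constructor
    · rintro rfl; simp
    · rintro ⟨rfl, rfl, rfl⟩
      ext j; fin_cases j <;> rfl
  simp only [mem_hull_iff a b q hq, Set.mem_insert_iff, Set.mem_singleton_iff, hv]
  constructor
  · intro h t x y h1 h2 h3 h4
    by_contra hcon
    have := h ![x, y, t] ⟨by simp; linarith, by simpa using h3, by simpa using h4,
      by simpa using hcon⟩
    simp at this
    omega
  · rintro h z ⟨h1, h2, h3, h4⟩
    generalize z 0 = x at *
    generalize z 1 = y at *
    generalize z 2 = t at *
    have hq0 : 0 < q := by linarith
    have htq : t ≤ q := by linarith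
    rcases eq_or_lt_of_le h1 with rfl | ht
    · have hx : 0 ≤ x := by
        by_contra hcon
        nlinarith
      have hy : 0 ≤ y := by
        by_contra hcon
        nlinarith
      have hxy : x + y ≤ 1 := by
        by_contra hcon
        nlinarith
      omega
    · rcases eq_or_lt_of_le htq with rfl | htq
      · have e1 : a ≤ x := le_of_mul_le_mul_left h2 hq0
        have e2 : b ≤ y := le_of_mul_le_mul_left h3 hq0
        have e3 := le_of_mul_le_mul_left h4 hq0
        omega
      · have := h t x y ht (by linarith) h2 h3
        linarith

/-- The tetrahedron conv{(0,0,0),(1,0,0),(0,1,0),(a,b,q)} (q ≥ 1) is empty if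
and only if (i) a ≡ 1 (mod q) and gcd(b,q)=1, or (ii) b ≡ 1 (mod q) and
gcd(a,q)=1, or (iii) a+b ≡ 0 (mod q) and gcd(a,q)=1. -/
theorem empty_tetrahedron_criterion (a b q : ℤ) (hq : 1 ≤ q) :
    (∀ z : Fin 3 → ℤ,
      toR z ∈ convexHull ℝ
        (toR '' ({![0,0,0], ![1,0,0], ![0,1,0], ![a,b,q]} : Set (Fin 3 → ℤ))) →
      z ∈ ({![0,0,0], ![1,0,0], ![0,1,0], ![a,b,q]} : Set (Fin 3 → ℤ)))
    ↔ ((a ≡ 1 [ZMOD q] ∧ Int.gcd b q = 1) ∨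
       (b ≡ 1 [ZMOD q] ∧ Int.gcd a q = 1) ∨
       (a + b ≡ 0 [ZMOD q] ∧ Int.gcd a q = 1)) := by
  rw [empty_iff a b q hq]
  exact ⟨fun h => h.cond hq, emptyInt_of_cond⟩
end

section
/- Every lattice tetrahedron in ℤ³ whose only lattice points are its four vertices (an empty tetrahedron) of normalized volume q is unimodularly equivalent to T(p,q) = conv{(0,0,0), (1,0,0), (0,0,1), (p,q,1)} for some p ∈ {1,…,q} with gcd(p,q) = 1. -/
/-- Integer-weight version of emptiness. -/
def EmpT (v : Fin 4 → Fin 3 → ℤ) : Prop :=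
  ∀ (z : Fin 3 → ℤ) (n : Fin 4 → ℤ), (∀ i, 0 ≤ n i) → 0 < ∑ i, n i →
    (∀ j, (∑ i, n i) * z j = ∑ i, n i * v i j) → z ∈ Set.range v

def GoodT (q : ℤ) (v : Fin 4 → Fin 3 → ℤ) : Prop :=
  EmpT v ∧ |Matrix.det (Matrix.of fun i j : Fin 3 => v i.succ j - v 0 j)| = q

def ConcT (q : ℤ) (v : Fin 4 → Fin 3 → ℤ) : Prop :=
  ∃ p : ℤ, 1 ≤ p ∧ p ≤ q ∧ Int.gcd p q = 1 ∧
      ∃ (A : Matrix (Fin 3) (Fin 3) ℤ) (b : Fin 3 → ℤ), IsUnit A.det ∧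
        (fun x => A.mulVec x + b) '' Set.range v
          = ({![0,0,0], ![1,0,0], ![0,0,1], ![p,q,1]} : Set (Fin 3 → ℤ))

/-- Reduction along a unimodular affine map. -/
theorem stepT (q : ℤ) (v w : Fin 4 → Fin 3 → ℤ) (A : Matrix (Fin 3) (Fin 3) ℤ) (b : Fin 3 → ℤ)
    (hA : IsUnit A.det) (hw : ∀ i, A.mulVec (v i) + b = w i)
    (h : GoodT q w → ConcT q w) : GoodT q v → ConcT q v := by
  intro hv
  obtain ⟨he, hd⟩ := hv
  have hinv : A⁻¹ * A = 1 := Matrix.nonsing_inv_mul A hA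
  have hinv2 : A * A⁻¹ = 1 := Matrix.mul_nonsing_inv A hA
  have hg : GoodT q w := by
    constructor
    · intro z n hn hs hz
      have key := he (A⁻¹.mulVec (z - b)) n hn hs ?_
      · obtain ⟨i, hi⟩ := key
        refine ⟨i, ?_⟩
        rw [← hw i, hi, Matrix.mulVec_mulVec, hinv2, Matrix.one_mulVec]
        simp
      · have h1 : (∑ i, n i) • (z - b) = A.mulVec (∑ i, n i • v i) := by
          have : ∀ i, A.mulVec (v i) = w i - b := fun i => by rw [← hw i]; simp
          rw [Matrix.mulVec_sum]
          simp only [Matrix.mulVec_smul, this]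
          ext j
          simp only [Pi.smul_apply, Pi.sub_apply, smul_eq_mul, Finset.sum_apply, mul_sub,
            Finset.sum_sub_distrib, hz j, Finset.sum_mul]
        intro j
        have h2 : (∑ i, n i) • A⁻¹.mulVec (z - b) = ∑ i, n i • v i := by
          rw [← Matrix.mulVec_smul, h1, Matrix.mulVec_mulVec, hinv, Matrix.one_mulVec]
        have h3 := congrFun h2 j
        simpa [Finset.sum_apply] using h3
    · have : (Matrix.of fun i j : Fin 3 => w i.succ j - w 0 j)
          = (Matrix.of fun i j : Fin 3 => v i.succ j - v 0 j) * A.transpose := by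
        ext i j
        simp only [← hw, Matrix.of_apply, Matrix.mul_apply, Matrix.transpose_apply,
          Pi.add_apply, Matrix.mulVec, dotProduct, Fin.sum_univ_three]
        ring
      rw [this, Matrix.det_mul, Matrix.det_transpose, abs_mul, hd,
        Int.isUnit_iff_abs_eq.mp hA, mul_one]
  obtain ⟨p, h1, h2, h3, B, c, hB, hS⟩ := h hg
  refine ⟨p, h1, h2, h3, B * A, B.mulVec b + c, ?_, ?_⟩
  · rw [Matrix.det_mul]; exact hB.mul hA
  · rw [← hS, ← Set.range_comp, ← Set.range_comp]
    congr 1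
    ext i j
    simp only [Function.comp, ← hw i, Matrix.mulVec_add, Matrix.mulVec_mulVec, add_assoc]

set_option maxHeartbeats 1000000 in
/-- Ordered version of the number-theoretic core. -/
theorem coreOrd (q a b c : ℤ) (hc : 1 ≤ c) (hcb : c ≤ b) (hba : b ≤ a) (hs : a + b + c = q + 1)
    (haq : a < q)
    (hnd : ∀ k, 1 ≤ k → k < q → 0 < (k * a) % q)
    (hf : ∀ k, 1 ≤ k → k < q → (k * a) / q + (k * b) / q + (k * c) / q = k - 1) : c = 1 := by
  by_contra hc1
  have hc2 : 2 ≤ c := by omega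
  have hq : 0 < q := by omega
  have hq3 : 5 ≤ q := by omega
  obtain ⟨d, hd⟩ : ∃ d, d = q - a := ⟨_, rfl⟩
  -- floors for d
  have hfd : ∀ k, 1 ≤ k → k < q → (k * d) / q = (k * b) / q + (k * c) / q := by
    intro k h1 h2
    have e1 := hf k h1 h2
    have e2 := hnd k h1 h2
    have e3 := Int.emod_lt_of_pos (k * a) hq
    have e4 := Int.mul_ediv_add_emod (k * a) q
    have : (k * d) / q = k - 1 - (k * a) / q := by
      rw [Int.ediv_eq_iff_of_pos hq]
      subst hd
      constructor <;> nlinarith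
    omega
  have h2d : 2 * d ≤ q := by
    by_contra hcon
    have ha : 2 * a < q := by omega
    have := hf 2 (by omega) (by omega)
    rw [Int.ediv_eq_zero_of_lt (by omega) (by omega), Int.ediv_eq_zero_of_lt (by omega) (by omega),
      Int.ediv_eq_zero_of_lt (by omega) (by omega)] at this
    omega
  have hd3 : 3 ≤ d := by omega
  have hd0 : 0 < d := by omega
  obtain ⟨m, hm⟩ : ∃ m, m = q / d := ⟨_, rfl⟩
  have hm1 : m * d ≤ q := by rw [hm]; exact Int.ediv_mul_le q hd0.ne'
  have hm2 : q < (m + 1) * d := by rw [hm]; exact Int.lt_ediv_add_one_mul_self q hd0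
  have hm3 : 2 ≤ m := by rw [hm, Int.le_ediv_iff_mul_le hd0]; exact h2d
  have hm4 : 3 * m ≤ q := by nlinarith
  -- (m+1) b ≥ q
  have hKb : q ≤ (m + 1) * b := by
    by_contra hcon
    have h0 := hfd (m + 1) (by omega) (by omega)
    have h1 : (1 : ℤ) ≤ (m + 1) * d / q := by
      rw [Int.le_ediv_iff_mul_le hq]; omega
    rw [Int.ediv_eq_zero_of_lt (a := (m + 1) * b) (by nlinarith) (by omega),
      Int.ediv_eq_zero_of_lt (a := (m + 1) * c) (by nlinarith) (by nlinarith)] at h0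
    omega
  -- first jump of c, written as l + 1
  obtain ⟨l, hl⟩ : ∃ l, l = (q - 1) / c := ⟨_, rfl⟩
  have hl1 : l * c ≤ q - 1 := by rw [hl]; exact Int.ediv_mul_le _ (by omega)
  have hl2 : q - 1 < (l + 1) * c := by
    rw [hl]; exact Int.lt_ediv_add_one_mul_self _ (by omega)
  have hl3 : 2 * l ≤ q - 1 := by
    have : 0 ≤ l := by rw [hl]; exact Int.ediv_nonneg (by omega) (by omega)
    nlinarith
  have hlm : m ≤ l := by
    rw [hl, Int.le_ediv_iff_mul_le (by omega)]
    nlinarith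
  have g1 := hfd (l + 1) (by omega) (by omega)
  have g0 := hfd l (by omega) (by omega)
  have gk := hfd (l + m) (by omega) (by omega)
  have c0 : l * c / q = 0 := Int.ediv_eq_zero_of_lt (by nlinarith) (by omega)
  have c1 : 1 ≤ (l + 1) * c / q := by rw [Int.le_ediv_iff_mul_le hq]; omega
  have ck : 1 ≤ (l + m) * c / q := by rw [Int.le_ediv_iff_mul_le hq]; nlinarith
  have b1 : l * b / q ≤ (l + 1) * b / q := Int.ediv_le_ediv hq (by nlinarith)
  have bk : (l + 1 - m) * b / q + 1 ≤ (l + m) * b / q := by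
    rw [Int.le_ediv_iff_mul_le hq]
    have := Int.ediv_mul_le ((l + 1 - m) * b) hq.ne'
    nlinarith
  have gk' := hfd (l + 1 - m) (by omega) (by omega)
  have c0' : (l + 1 - m) * c / q = 0 := Int.ediv_eq_zero_of_lt (by nlinarith) (by nlinarith)
  have n1 : l * d / q + 1 ≤ (l + 1) * d / q := by omega
  obtain ⟨n, hn⟩ : ∃ n, n = l * d / q + 1 := ⟨_, rfl⟩
  have n2 : l * d < n * q := by rw [hn]; exact Int.lt_ediv_add_one_mul_self _ hq
  have n3 : n * q ≤ (l + 1) * d := by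
    rw [← Int.le_ediv_iff_mul_le hq]; omega
  have u1 : (l + m) * d / q < n + 1 := by
    rw [Int.ediv_lt_iff_lt_mul hq]
    have e1 : (l + m) * d = l * d + m * d := by ring
    have e2 : (n + 1) * q = n * q + q := by ring
    linarith
  have u2 : n - 1 ≤ (l + 1 - m) * d / q := by
    rw [Int.le_ediv_iff_mul_le hq]
    have e1 : (l + 1 - m) * d = (l + 1) * d - m * d := by ring
    have e2 : (n - 1) * q = n * q - q := by ring
    linarith
  omega

theorem coreSym (q a b c : ℤ) (ha : 1 ≤ a) (hb : 1 ≤ b) (hc : 1 ≤ c)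
    (hs : a + b + c = q + 1) (haq : a < q) (hbq : b < q) (hcq : c < q)
    (hnda : ∀ k, 1 ≤ k → k < q → 0 < (k * a) % q)
    (hndb : ∀ k, 1 ≤ k → k < q → 0 < (k * b) % q)
    (hndc : ∀ k, 1 ≤ k → k < q → 0 < (k * c) % q)
    (hf : ∀ k, 1 ≤ k → k < q → (k * a) / q + (k * b) / q + (k * c) / q = k - 1) :
    a = 1 ∨ b = 1 ∨ c = 1 := by
  have P : ∀ x y z : ℤ, 1 ≤ z → x < q → x + y + z = q + 1 →
      (∀ k, 1 ≤ k → k < q → 0 < (k * x) % q) →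
      (∀ k, 1 ≤ k → k < q → (k * x) / q + (k * y) / q + (k * z) / q = k - 1) →
      z ≤ y → y ≤ x → z = 1 := fun x y z h1 h2 h3 h4 h5 h6 h7 =>
    coreOrd q x y z h1 h6 h7 h3 h2 h4 h5
  rcases le_total a b with h1 | h1 <;> rcases le_total b c with h2 | h2 <;>
    rcases le_total a c with h3 | h3
  · exact Or.inl (P c b a ha hcq (by omega) hndc (fun k u v => by have := hf k u v; omega) h1 h2)
  · exact Or.inl (P c b a ha hcq (by omega) hndc (fun k u v => by have := hf k u v; omega) h1 h2)
  · exact Or.inl (P b c a ha hbq (by omega) hndb (fun k u v => by have := hf k u v; omega) h3 h2)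
  · exact Or.inr (Or.inr (P b a c hc hbq (by omega) hndb
      (fun k u v => by have := hf k u v; omega) h3 h1))
  · exact Or.inr (Or.inl (P c a b hb hcq (by omega) hndc
      (fun k u v => by have := hf k u v; omega) h1 h3))
  · exact Or.inr (Or.inl (P a c b hb haq (by omega) hnda
      (fun k u v => by have := hf k u v; omega) h2 h3))
  · exact Or.inr (Or.inr (P a b c hc haq (by omega) hnda
      (fun k u v => by have := hf k u v; omega) h2 h1))
  · exact Or.inr (Or.inr (P a b c hc haq (by omega) hnda
      (fun k u v => by have := hf k u v; omega) h2 h1))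

theorem gcdAux (q a : ℤ) (hq : 1 ≤ q)
    (hnd : ∀ k, 1 ≤ k → k < q → 0 < (k * a) % q) : Int.gcd a q = 1 := by
  by_contra hne
  have hg0 : Int.gcd a q ≠ 0 := by
    intro h; rw [Int.gcd_eq_zero_iff] at h; omega
  have hg : (2 : ℤ) ≤ Int.gcd a q := by omega
  obtain ⟨k, hk⟩ := Int.gcd_dvd_right (a := a) (b := q)
  obtain ⟨t, ht⟩ := Int.gcd_dvd_left (a := a) (b := q)
  generalize (Int.gcd a q : ℤ) = g at *
  have hk1 : 1 ≤ k := by by_contra h; nlinarith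
  have := hnd k hk1 (by nlinarith)
  have h0 : (k * a) % q = 0 := by
    apply Int.emod_eq_zero_of_dvd
    exact ⟨t, by rw [ht, hk]; ring⟩
  omega

/-- Number-theoretic core in the form needed. -/
theorem coreNT (q α β : ℤ) (hq : 1 ≤ q) (ha : 1 ≤ α) (haq : α ≤ q) (hb : 1 ≤ β) (hbq : β ≤ q)
    (H : ∀ k x y : ℤ, 1 ≤ k → k < q → k * α ≤ x * q → k * β ≤ y * q →
      q < x * q + y * q + k - k * α - k * β) :
    (α = 1 ∨ β = 1 ∨ α + β = q) ∧ Int.gcd α q = 1 ∧ Int.gcd β q = 1 := by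
  have hq0 : 0 < q := by omega
  have F : ∀ k, 1 ≤ k → k < q → 0 < (k * α) % q ∧ 0 < (k * β) % q ∧
      k < (k * α) % q + (k * β) % q ∧ (k * α) % q + (k * β) % q < q + k := by
    intro k h1 h2
    have a1 := Int.emod_nonneg (k * α) hq0.ne'
    have b1 := Int.emod_nonneg (k * β) hq0.ne'
    have a2 := Int.mul_ediv_add_emod (k * α) q
    have b2 := Int.mul_ediv_add_emod (k * β) q
    have a3 := Int.emod_lt_of_pos (k * α) hq0
    have b3 := Int.emod_lt_of_pos (k * β) hq0
    generalize (k * α) % q = r at *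
    generalize (k * β) % q = s at *
    generalize (k * α) / q = A at *
    generalize (k * β) / q = B at *
    have e1 := H (q - k) (α - A) (β - B) (by omega) (by omega) (by nlinarith) (by nlinarith)
    have e2 : k < r + s := by nlinarith
    have e3 := H k (A + 1) (B + 1) h1 h2 (by nlinarith) (by nlinarith)
    have e4 : r + s < q + k := by nlinarith
    have hr : 0 < r := by
      by_contra hr
      have hr : r = 0 := by omega
      have := H k A (B + 1) h1 h2 (by nlinarith) (by nlinarith)
      nlinarith
    have hs : 0 < s := by
      by_contra hr
      have hr : s = 0 := by omega
      have := H k (A + 1) B h1 h2 (by nlinarith) (by nlinarith)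
      nlinarith
    exact ⟨hr, hs, e2, e4⟩
  refine ⟨?_, gcdAux q α hq fun k u v => (F k u v).1, gcdAux q β hq fun k u v => (F k u v).2.1⟩
  rcases eq_or_lt_of_le hq with h | hq2
  · left; omega
  have F1 := F 1 le_rfl hq2
  simp only [one_mul] at F1
  have haq' : α < q := by
    rcases eq_or_lt_of_le haq with h | h
    · rw [h] at F1; simp at F1
    · exact h
  have hbq' : β < q := by
    rcases eq_or_lt_of_le hbq with h | h
    · rw [h] at F1; simp at F1
    · exact h
  rw [Int.emod_eq_of_lt (by omega) haq', Int.emod_eq_of_lt (by omega) hbq'] at F1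
  have G : ∀ k, 1 ≤ k → k < q → (k * (q + 1 - α - β)) / q = k - 1 - (k * α) / q - (k * β) / q ∧
      0 < (k * (q + 1 - α - β)) % q := by
    intro k h1 h2
    have f := F k h1 h2
    have a2 := Int.mul_ediv_add_emod (k * α) q
    have b2 := Int.mul_ediv_add_emod (k * β) q
    have e : (k * (q + 1 - α - β)) / q = k - 1 - (k * α) / q - (k * β) / q := by
      rw [Int.ediv_eq_iff_of_pos hq0]
      constructor <;> nlinarith
    refine ⟨e, ?_⟩
    have c2 := Int.mul_ediv_add_emod (k * (q + 1 - α - β)) q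
    rw [e] at c2
    nlinarith
  rcases coreSym q α β (q + 1 - α - β) ha hb (by omega) (by ring) haq' hbq' (by omega)
    (fun k u v => (F k u v).1) (fun k u v => (F k u v).2.1) (fun k u v => (G k u v).2)
    (fun k u v => by rw [(G k u v).1]; ring) with h | h | h
  · exact Or.inl h
  · exact Or.inr (Or.inl h)
  · exact Or.inr (Or.inr (by omega))

theorem finalT (q α β : ℤ) (hq : 1 ≤ q) (ha : 1 ≤ α) (haq : α ≤ q) (hb : 1 ≤ β) (hbq : β ≤ q)
    (hG : GoodT q ![![0,0,0], ![1,0,0], ![0,1,0], ![α,β,q]]) :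
    ConcT q ![![0,0,0], ![1,0,0], ![0,1,0], ![α,β,q]] := by
  have H : ∀ k x y : ℤ, 1 ≤ k → k < q → k * α ≤ x * q → k * β ≤ y * q →
      q < x * q + y * q + k - k * α - k * β := by
    intro k x y h1 h2 h3 h4
    by_contra hcon
    have := hG.1 ![x, y, k]
      ![q - k - (x * q - k * α) - (y * q - k * β), x * q - k * α, y * q - k * β, k] ?_ ?_ ?_
    · obtain ⟨i, hi⟩ := this
      have h := congrFun hi 2
      fin_cases i <;> simp at h <;> omega
    · intro i
      fin_cases i <;> simp <;> omega
    · simp [Fin.sum_univ_four]; omega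
    · intro j
      fin_cases j <;> simp [Fin.sum_univ_four] <;> ring
  obtain ⟨h, ga, gb⟩ := coreNT q α β hq ha haq hb hbq H
  rcases h with h | h | h
  · subst h
    refine ⟨β, hb, hbq, gb, !![0,1,0;0,0,1;1,0,0], ![0,0,0], ?_, ?_⟩
    · simp [Matrix.det_fin_three]
    · simp only [Matrix.range_cons, Matrix.range_empty, Set.union_empty, Set.singleton_union,
        Set.image_insert_eq, Set.image_singleton]
      simp [Matrix.mulVec, dotProduct, Fin.sum_univ_three, Matrix.vecHead, Matrix.vecTail]
      ext x; simp; tauto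
  · subst h
    refine ⟨α, ha, haq, ga, !![1,0,0;0,0,1;0,1,0], ![0,0,0], ?_, ?_⟩
    · simp [Matrix.det_fin_three]
    · simp only [Matrix.range_cons, Matrix.range_empty, Set.union_empty, Set.singleton_union,
        Set.image_insert_eq, Set.image_singleton]
      simp [Matrix.mulVec, dotProduct, Fin.sum_univ_three, Matrix.vecHead, Matrix.vecTail]
  · have h' : β = q - α := by omega
    subst h'
    refine ⟨α, ha, haq, ga, !![1,0,0;0,0,1;-1,-1,1], ![0,0,1], ?_, ?_⟩
    · simp [Matrix.det_fin_three]
    · simp only [Matrix.range_cons, Matrix.range_empty, Set.union_empty, Set.singleton_union,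
        Set.image_insert_eq, Set.image_singleton]
      simp [Matrix.mulVec, dotProduct, Fin.sum_univ_three, Matrix.vecHead, Matrix.vecTail]
      ext x; simp; tauto

theorem n5T (q x α β : ℤ) (hq : 1 ≤ q) :
    GoodT q ![![0,0,0], ![1,0,0], ![x,1,0], ![α,β,q]] →
    ConcT q ![![0,0,0], ![1,0,0], ![x,1,0], ![α,β,q]] := by
  obtain ⟨s, hs1, hs2⟩ : ∃ s, 1 ≤ α - x * β - s * q ∧ α - x * β - s * q ≤ q := by
    refine ⟨(α - x * β - 1) / q, ?_⟩
    have h1 := Int.mul_ediv_add_emod (α - x * β - 1) q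
    have h2 := Int.emod_nonneg (α - x * β - 1) (by omega : q ≠ 0)
    have h3 := Int.emod_lt_of_pos (α - x * β - 1) (by omega : 0 < q)
    rw [mul_comm] at h1
    constructor <;> linarith
  obtain ⟨t, ht1, ht2⟩ : ∃ t, 1 ≤ β - t * q ∧ β - t * q ≤ q := by
    refine ⟨(β - 1) / q, ?_⟩
    have h1 := Int.mul_ediv_add_emod (β - 1) q
    have h2 := Int.emod_nonneg (β - 1) (by omega : q ≠ 0)
    have h3 := Int.emod_lt_of_pos (β - 1) (by omega : 0 < q)
    rw [mul_comm] at h1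
    constructor <;> linarith
  refine stepT q _ _ !![1,-x,-s;0,1,-t;0,0,1] ![0,0,0] ?_ ?_
    (finalT q (α - x * β - s * q) (β - t * q) hq hs1 hs2 ht1 ht2)
  · simp [Matrix.det_fin_three]
  · intro i
    ext j
    fin_cases i <;> fin_cases j <;> simp [Matrix.mulVec, dotProduct, Fin.sum_univ_three] <;> ring

theorem n4T (q g x d α β γ : ℤ) (hq : 1 ≤ q) (hg : 0 ≤ g) (hd : 0 ≤ d) (hγ : 0 ≤ γ)
    (hG : GoodT q ![![0,0,0], ![g,0,0], ![x,d,0], ![α,β,γ]]) :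
    ConcT q ![![0,0,0], ![g,0,0], ![x,d,0], ![α,β,γ]] := by
  have hdet := hG.2
  simp [Matrix.det_fin_three, abs_mul, abs_of_nonneg hg, abs_of_nonneg hd,
    abs_of_nonneg hγ] at hdet
  have hg0 : g ≠ 0 := by rintro rfl; simp at hdet; omega
  have hd0 : d ≠ 0 := by rintro rfl; simp at hdet; omega
  have hγ0 : γ ≠ 0 := by rintro rfl; simp at hdet; omega
  have hg1 : g = 1 := by
    have := hG.1 ![1,0,0] ![g-1,1,0,0] ?_ ?_ ?_
    · obtain ⟨i, hi⟩ := this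
      have h0 := congrFun hi 0
      have h1 := congrFun hi 1
      have h2 := congrFun hi 2
      fin_cases i <;> simp at h0 h1 h2 <;> omega
    · intro i
      fin_cases i <;> simp <;> omega
    · simp [Fin.sum_univ_four]; omega
    · intro j
      fin_cases j <;> simp [Fin.sum_univ_four]
  subst hg1
  have hd1 : d = 1 := by
    have h1 := Int.mul_ediv_add_emod (-x) d
    have h2 := Int.emod_nonneg (-x) hd0
    have h3 := Int.emod_lt_of_pos (-x) (by omega : 0 < d)
    generalize (-x) % d = r at *
    generalize (-x) / d = t at *
    have := hG.1 ![-t,1,0] ![d-1-r,r,1,0] ?_ ?_ ?_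
    · obtain ⟨i, hi⟩ := this
      have h0 := congrFun hi 0
      have h1 := congrFun hi 1
      have h2 := congrFun hi 2
      fin_cases i <;> simp at h0 h1 h2 <;> omega
    · intro i
      fin_cases i <;> simp <;> omega
    · simp [Fin.sum_univ_four]; omega
    · intro j
      fin_cases j <;> simp [Fin.sum_univ_four]
      linarith
  subst hd1
  have hγq : γ = q := by simpa using hdet
  subst hγq
  exact n5T _ _ _ _ hq hG

theorem n3T (q g x d α β γ : ℤ) (hq : 1 ≤ q) (hg : 0 ≤ g) (hd : 0 ≤ d) :
    GoodT q ![![0,0,0], ![g,0,0], ![x,d,0], ![α,β,γ]] →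
    ConcT q ![![0,0,0], ![g,0,0], ![x,d,0], ![α,β,γ]] := by
  rcases le_total 0 γ with h | h
  · exact n4T q g x d α β γ hq hg hd h
  · refine stepT q _ _ !![1,0,0;0,1,0;0,0,-1] ![0,0,0] ?_ ?_
      (n4T q g x d α β (-γ) hq hg hd (by omega))
    · simp [Matrix.det_fin_three]
    · intro i
      ext j
      fin_cases i <;> fin_cases j <;> simp [Matrix.mulVec, dotProduct, Fin.sum_univ_three]

theorem bezT (a b : ℤ) : ∃ r s t u g : ℤ, r * u - s * t = 1 ∧ 0 ≤ g ∧ r * a + s * b = g ∧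
    t * a + u * b = 0 := by
  by_cases h : Int.gcd a b = 0
  · rw [Int.gcd_eq_zero_iff] at h
    exact ⟨1, 0, 0, 1, 0, by simp [h.1, h.2]⟩
  · obtain ⟨u, hu⟩ := Int.gcd_dvd_left (a := a) (b := b)
    obtain ⟨t, ht⟩ := Int.gcd_dvd_right (a := a) (b := b)
    have hb := Int.gcd_eq_gcd_ab a b
    have hg : (0 : ℤ) < Int.gcd a b := by omega
    refine ⟨Int.gcdA a b, Int.gcdB a b, -t, u, Int.gcd a b, ?_, hg.le, by rw [hb]; ring, ?_⟩
    · generalize Int.gcdA a b = r at *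
      generalize Int.gcdB a b = s at *
      generalize (Int.gcd a b : ℤ) = g at *
      have : g * (r * u - s * -t) = g * 1 := by
        rw [hu, ht] at hb
        linarith
      exact mul_left_cancel₀ hg.ne' this
    · generalize (Int.gcd a b : ℤ) = g at *
      rw [hu, ht]; ring

theorem n2T (q g x y z α β γ : ℤ) (hq : 1 ≤ q) (hg : 0 ≤ g) :
    GoodT q ![![0,0,0], ![g,0,0], ![x,y,z], ![α,β,γ]] →
    ConcT q ![![0,0,0], ![g,0,0], ![x,y,z], ![α,β,γ]] := by
  obtain ⟨r, s, t, u, d, h1, h2, h3, h4⟩ := bezT y z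
  refine stepT q _ _ !![1,0,0;0,r,s;0,t,u] ![0,0,0] ?_ ?_
    (n3T q g x d α (r * β + s * γ) (t * β + u * γ) hq hg h2)
  · simp [Matrix.det_fin_three, h1]
  · intro i
    ext j
    fin_cases i <;> fin_cases j <;> simp [Matrix.mulVec, dotProduct, Fin.sum_univ_three] <;> linarith

theorem n1T (q a b x y z α β γ : ℤ) (hq : 1 ≤ q) :
    GoodT q ![![0,0,0], ![a,b,0], ![x,y,z], ![α,β,γ]] →
    ConcT q ![![0,0,0], ![a,b,0], ![x,y,z], ![α,β,γ]] := by
  obtain ⟨r, s, t, u, d, h1, h2, h3, h4⟩ := bezT a b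
  refine stepT q _ _ !![r,s,0;t,u,0;0,0,1] ![0,0,0] ?_ ?_
    (n2T q d (r * x + s * y) (t * x + u * y) z (r * α + s * β) (t * α + u * β) γ hq h2)
  · simp [Matrix.det_fin_three, h1]
  · intro i
    ext j
    fin_cases i <;> fin_cases j <;> simp [Matrix.mulVec, dotProduct, Fin.sum_univ_three] <;> linarith

theorem n0T (q : ℤ) (v : Fin 4 → Fin 3 → ℤ) (hq : 1 ≤ q) : GoodT q v → ConcT q v := by
  obtain ⟨r, s, t, u, d, h1, h2, h3, h4⟩ := bezT (v 1 1 - v 0 1) (v 1 2 - v 0 2)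
  refine stepT q _ _ !![1,0,0;0,r,s;0,t,u]
    ![-v 0 0, -(r * v 0 1 + s * v 0 2), -(t * v 0 1 + u * v 0 2)] ?_ ?_
    (n1T q (v 1 0 - v 0 0) d
      (v 2 0 - v 0 0) (r * (v 2 1 - v 0 1) + s * (v 2 2 - v 0 2))
        (t * (v 2 1 - v 0 1) + u * (v 2 2 - v 0 2))
      (v 3 0 - v 0 0) (r * (v 3 1 - v 0 1) + s * (v 3 2 - v 0 2))
        (t * (v 3 1 - v 0 1) + u * (v 3 2 - v 0 2)) hq)
  · simp [Matrix.det_fin_three, h1]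
  · intro i
    ext j
    fin_cases i <;> fin_cases j <;> simp [Matrix.mulVec, dotProduct, Fin.sum_univ_three] <;>
      linarith

/-- White's classification: every empty lattice tetrahedron of normalized
volume q is unimodularly equivalent to T(p,q) = conv{(0,0,0),(1,0,0),(0,0,1),(p,q,1)}
for some 1 ≤ p ≤ q with gcd(p,q) = 1. -/
theorem empty_tetrahedron_classification (v : Fin 4 → Fin 3 → ℤ) (q : ℤ) (hq : 1 ≤ q)
    (hvol : |Matrix.det (Matrix.of fun i j : Fin 3 => v i.succ j - v 0 j)| = q)
    (hempty : ∀ z : Fin 3 → ℤ,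
      toR z ∈ convexHull ℝ (toR '' Set.range v) → z ∈ Set.range v) :
    ∃ p : ℤ, 1 ≤ p ∧ p ≤ q ∧ Int.gcd p q = 1 ∧
      ∃ (A : Matrix (Fin 3) (Fin 3) ℤ) (b : Fin 3 → ℤ), IsUnit A.det ∧
        (fun x => A.mulVec x + b) '' Set.range v
          = ({![0,0,0], ![1,0,0], ![0,0,1], ![p,q,1]} : Set (Fin 3 → ℤ)) := by
  refine n0T q v hq ⟨?_, hvol⟩
  intro z n hn hs hz
  apply hempty
  have hs' : (0 : ℝ) < ∑ i, (n i : ℝ) := by exact_mod_cast hs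
  have hmem := (convex_convexHull ℝ (toR '' Set.range v)).sum_mem (t := Finset.univ)
    (w := fun i => (n i : ℝ) / ∑ i, (n i : ℝ)) (z := fun i => toR (v i))
    (fun i _ => div_nonneg (by exact_mod_cast hn i) hs'.le)
    (by rw [← Finset.sum_div]; exact div_self hs'.ne')
    (fun i _ => subset_convexHull ℝ _ ⟨v i, ⟨i, rfl⟩, rfl⟩)
  convert hmem using 1
  ext j
  have h : (∑ i, (n i : ℝ)) * (z j : ℝ) = ∑ i, (n i : ℝ) * (v i j : ℝ) := by exact_mod_cast hz j
  simp only [Finset.sum_apply, Pi.smul_apply, smul_eq_mul, toR, div_mul_eq_mul_div]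
  rw [← Finset.sum_div, ← h]
  field_simp
end

section
/- Every lattice 3-polytope P with exactly 5 lattice points whose 5 lattice points have an affine dependence with 2 positive and 2 negative coefficients, or 2 positive and 1 negative and one zero coefficient, or 3 positive and 2 negative coefficients, has lattice width one. -/
/-- Evaluation of an integer linear functional on a lattice point. -/
def dotZ (f p : Fin 3 → ℤ) : ℤ := ∑ i, f i * p i


set_option maxHeartbeats 1000000 in
lemma white_core (q a b c : ℤ) (hc : 1 ≤ c) (hcb : c ≤ b) (hba : b ≤ a)
    (hsum : a + b + c = q + 1)
    (hda : ∀ k, 0 < k → k < q → ¬ q ∣ k * a)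
    (hs : ∀ k, 0 < k → k < q → k * a / q + k * b / q + k * c / q = k - 1) : c = 1 := by
  by_contra hne
  have hc2 : 2 ≤ c := by omega
  have hq : 0 < q := by omega
  have h2 := hs 2 (by norm_num) (by omega)
  have hle : ∀ {x y : ℤ}, x ≤ y → x / q ≤ y / q := fun h => Int.ediv_le_ediv hq h
  have ha2 : q ≤ 2 * a := by
    by_contra hlt
    have e1 : 2 * a / q = 0 := Int.ediv_eq_zero_of_lt (by omega) (by omega)
    have e2 : 2 * b / q = 0 := Int.ediv_eq_zero_of_lt (by omega) (by omega)
    have e3 : 2 * c / q = 0 := Int.ediv_eq_zero_of_lt (by omega) (by omega)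
    omega
  have ha3 : q < 2 * a := by
    rcases ha2.lt_or_eq with h | h
    · exact h
    · exact absurd ⟨1, by omega⟩ (hda 2 (by norm_num) (by omega))
  obtain ⟨e, he⟩ : ∃ e, e = q - a := ⟨_, rfl⟩
  have he2 : 2 * e < q := by omega
  have heb : b + c = e + 1 := by omega
  -- jumps of e split as jumps of b and jumps of c
  have hE : ∀ k, 0 < k → k < q → k * b / q + k * c / q = k * e / q := by
    intro k hk hkq
    have h1 := hs k hk hkq
    have hnd := hda k hk hkq
    have h3 : k * a / q = k - 1 - k * e / q := by
      have hka : k * a = q * k - k * e := by rw [he]; ring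
      have h4 : ¬ q ∣ k * e := fun ⟨t, ht⟩ => hnd ⟨k - t, by rw [hka, ht]; ring⟩
      have h5 := Int.emod_add_mul_ediv (k * e) q
      have h6 := Int.emod_nonneg (k * e) hq.ne'
      have h7 := Int.emod_lt_of_pos (k * e) hq
      have h8 : k * e % q ≠ 0 := fun h => h4 (Int.dvd_of_emod_eq_zero h)
      have h9 : k * a = (q - k * e % q) + q * (k - 1 - k * e / q) := by
        rw [hka]; linarith
      rw [h9, Int.add_mul_ediv_left _ _ hq.ne', Int.ediv_eq_zero_of_lt (by omega) (by omega)]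
      ring
    omega
  have dlt : ∀ x y : ℤ, x / q < y ↔ x < y * q := fun x y => Int.ediv_lt_iff_lt_mul hq
  have dle : ∀ x y : ℤ, x ≤ y / q ↔ x * q ≤ y := fun x y => Int.le_ediv_iff_mul_le hq
  -- K: first jump of c
  have exceil : ∀ y m : ℤ, 0 < y → ∃ K, m * q ≤ K * y ∧ (K - 1) * y < m * q := by
    intro y m hy
    refine ⟨-(-(m * q) / y), ?_, ?_⟩
    · have := Int.ediv_mul_le (-(m * q)) hy.ne'
      linarith
    · have := Int.lt_ediv_add_one_mul_self (-(m * q)) hy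
      linarith
  obtain ⟨K, hK1, hK2⟩ := exceil c 1 (by omega)
  obtain ⟨t, ht1, ht2⟩ := exceil b 1 (by omega)
  obtain ⟨m, hm⟩ : ∃ m, m = K * b / q := ⟨_, rfl⟩
  obtain ⟨L, hL1, hL2⟩ := exceil b m (by omega)
  have hK0 : 0 < K := by nlinarith
  have hKq : K < q := by nlinarith
  have hm1 : 1 ≤ m := by rw [hm, dle]; nlinarith
  have hKm : K * b < (m + 1) * q := by rw [← dlt]; omega
  have hmK : m * q ≤ K * b := by rw [← dle]; omega
  have hmb : m < b := by rw [hm, dlt]; nlinarith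
  have ht0 : 0 < t := by nlinarith
  have ht0' : 2 < t := by nlinarith
  have htq : t - 1 < q := by nlinarith
  have hte : (t - 1) * e < q := by
    have h := hE (t - 1) (by omega) htq
    have h1 : (t - 1) * b / q < 1 := by rw [dlt]; exact ht2
    have h2 : (t - 1) * c / q < 1 := by rw [dlt]; nlinarith
    have h3 : (t - 1) * e / q < 1 := by omega
    rw [dlt] at h3; linarith
  have hL0 : 0 < L := by nlinarith
  have hLK : L ≤ K := by
    by_contra h
    have : K * b ≤ (L - 1) * b := mul_le_mul_of_nonneg_right (by omega) (by omega)
    linarith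
  have hLK' : L < K := by
    rcases hLK.lt_or_eq with h | h
    · exact h
    · exfalso
      subst h
      -- both b and c jump at L
      have h1 := hE L hL0 hKq
      have hc1 : 1 ≤ L * c / q := by rw [dle]; exact hK1
      have he1 : (m + 1) * q ≤ L * e := by rw [← dle]; omega
      rcases (show L = 1 ∨ 0 < L - 1 by omega) with h0 | h0
      · subst h0; nlinarith
      have h2 := hE (L - 1) h0 (by omega)
      have h3 : (L - 1) * b / q < m := by rw [dlt]; exact hL2
      have h4 : (L - 1) * c / q < 1 := by rw [dlt]; exact hK2
      have h5 : (L - 1) * e / q < m := by omega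
      rw [dlt] at h5
      nlinarith
  have hLe : (L - 1) * e < m * q := by
    rcases (show L = 1 ∨ 0 < L - 1 by omega) with h0 | h0
    · subst h0; nlinarith
    have h2 := hE (L - 1) h0 (by omega)
    have h3 : (L - 1) * b / q < m := by rw [dlt]; exact hL2
    have h4 : (L - 1) * c / q < 1 := by
      rw [dlt]
      have : (L - 1) * c ≤ (K - 1) * c := mul_le_mul_of_nonneg_right (by omega) (by omega)
      linarith
    have h5 : (L - 1) * e / q < m := by omega
    rwa [dlt] at h5
  have hKLt : K < L + t := by
    by_contra h
    have : (L + t) * b ≤ K * b := mul_le_mul_of_nonneg_right (by omega) (by omega)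
    linarith
  have hNe : (m + 2) * q ≤ (L + t) * e := by
    rcases lt_or_ge (L + t) q with h | h
    · have h1 := hE (L + t) (by omega) h
      have h2 : m + 1 ≤ (L + t) * b / q := by rw [dle]; linarith
      have h3 : 1 ≤ (L + t) * c / q := by
        rw [dle]
        have : K * c ≤ (L + t) * c := mul_le_mul_of_nonneg_right (by omega) (by omega)
        linarith
      rw [← dle]; omega
    · have : m + 2 ≤ e := by omega
      have h1 : (m + 2) * q ≤ e * q := mul_le_mul_of_nonneg_right this hq.le
      have h2 : q * e ≤ (L + t) * e := mul_le_mul_of_nonneg_right h (by omega)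
      linarith
  linarith

lemma white (q a b c : ℤ) (hq : 2 ≤ q) (hsum : a + b + c = 1)
    (H : ∀ k x y z, x + y + z = 1 → 0 < k → k < q → k * a ≤ q * x → k * b ≤ q * y →
      k * c ≤ q * z → False) :
    (q ∣ a - 1 ∨ q ∣ b - 1 ∨ q ∣ c - 1) ∧ ¬ q ∣ a ∧ ¬ q ∣ b ∧ ¬ q ∣ c := by
  have hq0 : 0 < q := by omega
  -- for all k: not divisible, and the floors sum to -1
  have key1 : ∀ k, 0 < k → k < q → (-(k * a)) / q + (-(k * b)) / q + (-(k * c)) / q ≤ -2 := by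
    intro k hk hkq
    by_contra hlt
    have h1 := Int.ediv_mul_le (-(k * a)) hq0.ne'
    have h2 := Int.ediv_mul_le (-(k * b)) hq0.ne'
    have h3 := Int.ediv_mul_le (-(k * c)) hq0.ne'
    refine H k (-(-(k * a) / q)) (-(-(k * b) / q)) (1 + -(k * a) / q + -(k * b) / q) (by ring)
      hk hkq (by linarith) (by linarith) ?_
    have : -(-(k * c) / q) ≤ 1 + -(k * a) / q + -(k * b) / q := by omega
    nlinarith
  have key2 : ∀ k, 0 < k → k < q → (k * a) / q + (k * b) / q + (k * c) / q ≤ -1 := by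
    intro k hk hkq
    have h := key1 (q - k) (by omega) (by omega)
    have e : ∀ a, -((q - k) * a) / q = k * a / q - a := by
      intro a
      have : -((q - k) * a) = k * a + q * (-a) := by ring
      rw [this, Int.add_mul_ediv_left _ _ hq0.ne']; ring
    rw [e, e, e] at h
    omega
  have neg : ∀ x, -1 - x / q ≤ (-x) / q ∧ (q ∣ x → (-x) / q = - (x / q)) := by
    intro x
    refine ⟨?_, fun h => Int.neg_ediv_of_dvd h⟩
    rw [Int.le_ediv_iff_mul_le hq0]
    have := Int.lt_ediv_add_one_mul_self x hq0
    nlinarith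
  have key3 : ∀ k, 0 < k → k < q → (¬ q ∣ k * a) ∧ (¬ q ∣ k * b) ∧ (¬ q ∣ k * c) ∧
      (k * a) / q + (k * b) / q + (k * c) / q = -1 := by
    intro k hk hkq
    have h1 := key1 k hk hkq
    have h2 := key2 k hk hkq
    obtain ⟨ha, ha'⟩ := neg (k * a)
    obtain ⟨hb, hb'⟩ := neg (k * b)
    obtain ⟨hc, hc'⟩ := neg (k * c)
    refine ⟨fun h => ?_, fun h => ?_, fun h => ?_, ?_⟩
    · have := ha' h; omega
    · have := hb' h; omega
    · have := hc' h; omega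
    · omega
  obtain ⟨na, nb, nc, n1⟩ := key3 1 (by norm_num) (by omega)
  simp only [one_mul] at na nb nc n1
  refine ⟨?_, na, nb, nc⟩
  have ea := Int.emod_add_mul_ediv a q
  have eb := Int.emod_add_mul_ediv b q
  have ec := Int.emod_add_mul_ediv c q
  have one : ∀ x, ¬ q ∣ x → 1 ≤ x % q := by
    intro x hx
    have h6 := Int.emod_nonneg x hq0.ne'
    have h8 : x % q ≠ 0 := fun h => hx (Int.dvd_of_emod_eq_zero h)
    omega
  have oa := one a na
  have ob := one b nb
  have oc := one c nc
  have hsum' : a % q + b % q + c % q = q + 1 := by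
    have : q * (a / q) + q * (b / q) + q * (c / q) = -q := by
      rw [← mul_add, ← mul_add, n1]; ring
    linarith
  have ddiv : ∀ x k, ¬ q ∣ k * x → ¬ q ∣ k * (x % q) := by
    rintro x k h ⟨t, ht⟩
    refine h ⟨t + k * (x / q), ?_⟩
    have := Int.emod_add_mul_ediv x q
    calc k * x = k * (x % q + q * (x / q)) := by rw [this]
      _ = _ := by rw [mul_add, ht]; ring
  have dv : ∀ x k, k * (x % q) / q = k * x / q - k * (x / q) := by
    intro x k
    have h : k * x = k * (x % q) + q * (k * (x / q)) := by
      have := Int.emod_add_mul_ediv x q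
      calc k * x = k * (x % q + q * (x / q)) := by rw [this]
        _ = _ := by ring
    have h2 : k * x / q = k * (x % q) / q + k * (x / q) := by
      conv_lhs => rw [h]
      rw [Int.add_mul_ediv_left _ _ hq0.ne']
    omega
  have hs' : ∀ k, 0 < k → k < q →
      k * (a % q) / q + k * (b % q) / q + k * (c % q) / q = k - 1 := by
    intro k hk hkq
    obtain ⟨_, _, _, h⟩ := key3 k hk hkq
    rw [dv, dv, dv]
    have : k * (a / q) + k * (b / q) + k * (c / q) = -k := by
      rw [← mul_add, ← mul_add, n1]; ring
    linarith
  have fin : ∀ x, x % q = 1 → q ∣ x - 1 := by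
    intro x hx
    have := Int.emod_add_mul_ediv x q
    exact ⟨x / q, by linarith⟩
  have da := fun k h1 h2 => ddiv a k (key3 k h1 h2).1
  have db := fun k h1 h2 => ddiv b k (key3 k h1 h2).2.1
  have dc := fun k h1 h2 => ddiv c k (key3 k h1 h2).2.2.1
  have fin1 := fin a
  have fin2 := fin b
  have fin3 := fin c
  clear fin dv ddiv one
  generalize a % q = A at *
  generalize b % q = B at *
  generalize c % q = C at *
  rcases le_total A B with h1 | h1 <;> rcases le_total B C with h2 | h2 <;>
    rcases le_total A C with h3 | h3
  · exact .inl (fin1 (white_core q C B A oa h1 h2 (by omega) dc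
      fun k u v => by have := hs' k u v; omega))
  · exact .inl (fin1 (white_core q C B A oa h1 h2 (by omega) dc
      fun k u v => by have := hs' k u v; omega))
  · exact .inl (fin1 (white_core q B C A oa h3 h2 (by omega) db
      fun k u v => by have := hs' k u v; omega))
  · exact .inr (.inr (fin3 (white_core q B A C oc h3 h1 (by omega) db
      fun k u v => by have := hs' k u v; omega)))
  · exact .inr (.inl (fin2 (white_core q C A B ob h1 h3 (by omega) dc
      fun k u v => by have := hs' k u v; omega)))
  · exact .inr (.inl (fin2 (white_core q A C B ob h2 h3 (by omega) da
      fun k u v => by have := hs' k u v; omega)))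
  · exact .inr (.inr (fin3 (white_core q A B C oc h2 h1 (by omega) da
      fun k u v => by have := hs' k u v; omega)))
  · exact .inr (.inr (fin3 (white_core q A B C oc h2 h1 (by omega) da
      fun k u v => by have := hs' k u v; omega)))

lemma bipyr (q r a1 a2 a3 b1 b2 b3 : ℤ) (hq : 1 ≤ q) (hr : 1 ≤ r)
    (ha : a1 + a2 + a3 = 1) (hb : b1 + b2 + b3 = 1)
    (c1 : 0 < r * a1 + q * b1) (c2 : 0 < r * a2 + q * b2) (c3 : 0 < r * a3 + q * b3)
    (Hq : ∀ k x y z, x + y + z = 1 → 0 < k → k < q → k * a1 ≤ q * x → k * a2 ≤ q * y →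
      k * a3 ≤ q * z → False)
    (Hr : ∀ k x y z, x + y + z = 1 → 0 < k → k < r → k * b1 ≤ r * x → k * b2 ≤ r * y →
      k * b3 ≤ r * z → False) :
    (∃ m, (a1 + m * q = 0 ∨ a1 + m * q = 1) ∧ (b1 - m * r = 0 ∨ b1 - m * r = 1)) ∨
    (∃ m, (a2 + m * q = 0 ∨ a2 + m * q = 1) ∧ (b2 - m * r = 0 ∨ b2 - m * r = 1)) ∨
    (∃ m, (a3 + m * q = 0 ∨ a3 + m * q = 1) ∧ (b3 - m * r = 0 ∨ b3 - m * r = 1)) := by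
  have tot : (r * a1 + q * b1) + (r * a2 + q * b2) + (r * a3 + q * b3) = q + r := by
    linear_combination r * ha + q * hb
  have WQ : (q ∣ a1 - 1 ∨ q ∣ a2 - 1 ∨ q ∣ a3 - 1) ∧
      (2 ≤ q → ¬ q ∣ a1 ∧ ¬ q ∣ a2 ∧ ¬ q ∣ a3) := by
    rcases hq.eq_or_lt with h | h
    · subst h; simp
    · have := white q a1 a2 a3 (by omega) ha Hq
      exact ⟨this.1, fun _ => this.2⟩
  have WR : (r ∣ b1 - 1 ∨ r ∣ b2 - 1 ∨ r ∣ b3 - 1) ∧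
      (2 ≤ r → ¬ r ∣ b1 ∧ ¬ r ∣ b2 ∧ ¬ r ∣ b3) := by
    rcases hr.eq_or_lt with h | h
    · subst h; simp
    · have := white r b1 b2 b3 (by omega) hb Hr
      exact ⟨this.1, fun _ => this.2⟩
  have same : ∀ a b : ℤ, q ∣ a - 1 → r ∣ b - 1 → 0 < r * a + q * b → r * a + q * b < q + r →
      ∃ m, (a + m * q = 0 ∨ a + m * q = 1) ∧ (b - m * r = 0 ∨ b - m * r = 1) := by
    rintro a b ⟨n, hn⟩ ⟨n', hn'⟩ h1 h2
    obtain rfl : a = 1 + q * n := by linarith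
    obtain rfl : b = 1 + r * n' := by linarith
    have hlt : n + n' < 0 := by
      have : q * r * (n + n') < 0 := by linarith
      by_contra h
      have : 0 ≤ q * r * (n + n') := by
        have : 0 ≤ n + n' := by omega
        positivity
      linarith
    have hgt : 0 < q + r + q * r * (n + n') := by linarith
    have hone : q = 1 ∨ r = 1 := by
      by_contra h
      have hq2 : 2 ≤ q := by omega
      have hr2 : 2 ≤ r := by omega
      have : q * r * (n + n') ≤ q * r * (-1) := mul_le_mul_of_nonneg_left (by omega) (by positivity)
      nlinarith
    rcases hone with h | h
    · subst h
      have : n + n' = -1 := by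
        by_contra hne
        have : r * (n + n') ≤ r * (-2) := mul_le_mul_of_nonneg_left (by omega) (by positivity)
        linarith
      exact ⟨n', .inl (by linarith), .inr (by ring)⟩
    · subst h
      have : n + n' = -1 := by
        by_contra hne
        have : q * (n + n') ≤ q * (-2) := mul_le_mul_of_nonneg_left (by omega) (by positivity)
        linarith
      exact ⟨-n, .inr (by ring), .inl (by linarith)⟩
  have diff : ∀ a b a' b' : ℤ, 2 ≤ q → 2 ≤ r → q ∣ a - 1 → r ∣ b' - 1 → ¬ r ∣ b → ¬ q ∣ a' →
      0 < r * a + q * b → 0 < r * a' + q * b' →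
      r * a + q * b + (r * a' + q * b') < q + r → False := by
    rintro a b a' b' hq2 hr2 ⟨n, hn⟩ ⟨n', hn'⟩ hb ha h1 h2 h3
    obtain rfl : a = 1 + q * n := by linarith
    obtain rfl : b' = 1 + r * n' := by linarith
    obtain ⟨B, rfl⟩ : ∃ B, b = B - r * n := ⟨b + r * n, by ring⟩
    obtain ⟨A, rfl⟩ : ∃ A, a' = A - q * n' := ⟨a' + q * n', by ring⟩
    have hB0 : B ≠ 0 := by rintro rfl; exact hb ⟨-n, by ring⟩
    have hA0 : A ≠ 0 := by rintro rfl; exact ha ⟨-n', by ring⟩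
    have i1 : 0 < r + q * B := by linarith
    have i2 : 0 < r * A + q := by linarith
    have i3 : q * B + r * A < 0 := by linarith
    rcases le_total q r with h | h
    · have : 1 ≤ A := by
        by_contra hA
        have : r * A ≤ r * (-1) := mul_le_mul_of_nonneg_left (by omega) (by positivity)
        linarith
      have : r * 1 ≤ r * A := mul_le_mul_of_nonneg_left (by omega) (by positivity)
      linarith
    · have : 1 ≤ B := by
        by_contra hB
        have : q * B ≤ q * (-1) := mul_le_mul_of_nonneg_left (by omega) (by positivity)
        linarith
      have : q * 1 ≤ q * B := mul_le_mul_of_nonneg_left (by omega) (by positivity)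
      linarith
  have s1 := fun x y => same a1 b1 x y c1 (by linarith)
  have s2 := fun x y => same a2 b2 x y c2 (by linarith)
  have s3 := fun x y => same a3 b3 x y c3 (by linarith)
  by_cases q1 : q = 1
  · subst q1
    rcases WR.1 with h | h | h
    · exact .inl (s1 (one_dvd _) h)
    · exact .inr (.inl (s2 (one_dvd _) h))
    · exact .inr (.inr (s3 (one_dvd _) h))
  by_cases r1 : r = 1
  · subst r1
    rcases WQ.1 with h | h | h
    · exact .inl (s1 h (one_dvd _))
    · exact .inr (.inl (s2 h (one_dvd _)))
    · exact .inr (.inr (s3 h (one_dvd _)))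
  have q2 : 2 ≤ q := by omega
  have r2 : 2 ≤ r := by omega
  obtain ⟨na1, na2, na3⟩ := WQ.2 q2
  obtain ⟨nb1, nb2, nb3⟩ := WR.2 r2
  rcases WQ.1 with h | h | h <;> rcases WR.1 with h' | h' | h'
  · exact .inl (s1 h h')
  · exact (diff _ _ _ _ q2 r2 h h' nb1 na2 c1 c2 (by linarith)).elim
  · exact (diff _ _ _ _ q2 r2 h h' nb1 na3 c1 c3 (by linarith)).elim
  · exact (diff _ _ _ _ q2 r2 h h' nb2 na1 c2 c1 (by linarith)).elim
  · exact .inr (.inl (s2 h h'))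
  · exact (diff _ _ _ _ q2 r2 h h' nb2 na3 c2 c3 (by linarith)).elim
  · exact (diff _ _ _ _ q2 r2 h h' nb3 na1 c3 c1 (by linarith)).elim
  · exact (diff _ _ _ _ q2 r2 h h' nb3 na2 c3 c2 (by linarith)).elim
  · exact .inr (.inr (s3 h h'))

lemma arith21 (d a m : ℤ) (hd : 1 ≤ d)
    (H : ∀ k X y : ℤ, 0 < k → k < d → k * a ≤ d * y → |d * X - k * m| ≤ d - k - d * y + k * a →
      False) : d ∣ a - 1 := by
  rcases hd.eq_or_lt with h | hd2
  · subst h; exact one_dvd _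
  have hd0 : 0 < d := by omega
  have ha := Int.emod_add_mul_ediv a d
  have hc0 := Int.emod_nonneg a hd0.ne'
  have hcd := Int.emod_lt_of_pos a hd0
  generalize hc : a % d = c at *
  generalize a / d = j at *
  by_cases c1 : c = 1
  · exact ⟨j, by linarith⟩
  exfalso
  by_cases c0 : c = 0
  · refine H 1 (m / d) j (by norm_num) hd2 (by linarith) ?_
    have h1 := Int.emod_add_mul_ediv m d
    have h2 := Int.emod_nonneg m hd0.ne'
    have h3 := Int.emod_lt_of_pos m hd0
    rw [abs_le]; constructor <;> linarith
  have c2 : 2 ≤ c := by omega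
  have hk := Int.emod_add_mul_ediv d c
  have hk0 := Int.emod_nonneg d (show c ≠ 0 by omega)
  have hkc := Int.emod_lt_of_pos d (show 0 < c by omega)
  generalize d % c = r at *
  generalize d / c = k at *
  have kpos : 0 < k := by nlinarith
  have klt : k < d := by nlinarith
  have hX : ∃ X, 2 * |d * X - k * m| ≤ d := by
    have h1 := Int.emod_add_mul_ediv (k * m) d
    have h2 := Int.emod_nonneg (k * m) hd0.ne'
    have h3 := Int.emod_lt_of_pos (k * m) hd0
    by_cases h : 2 * (k * m % d) ≤ d
    · refine ⟨k * m / d, ?_⟩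
      rw [abs_of_nonpos] <;> linarith
    · refine ⟨k * m / d + 1, ?_⟩
      rw [abs_of_nonneg] <;> linarith
  obtain ⟨X, hX⟩ := hX
  have e1 : k * a = k * c + d * (k * j) := by rw [← ha]; ring
  refine H k X (k * j + 1) kpos klt (by rw [e1]; linarith) ?_
  rw [e1]
  have : 1 * (c - 2) ≤ k * (c - 2) := mul_le_mul_of_nonneg_right (by omega) (by omega)
  have : d - 1 ≤ 2 * (k * (c - 1)) := by linarith
  have : |d * X - k * m| ≤ k * (c - 1) := by omega
  linarith

/-- Five lattice points, with essentially unique affine dependence `v`, whose hull has no other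
lattice points. -/
structure Cfg (P : Fin 5 → Fin 3 → ℤ) (v : Fin 5 → ℤ) : Prop where
  emp : ∀ (z : Fin 3 → ℤ) (w : Fin 5 → ℤ), (∀ k, 0 ≤ w k) → 0 < ∑ k, w k →
    (∑ k, w k) • z = ∑ k, w k • P k → ∃ k, z = P k
  dep1 : ∑ k, v k = 0
  dep : ∑ k, v k • P k = 0
  uniq : ∀ u : Fin 5 → ℤ, ∑ k, u k = 0 → ∑ k, u k • P k = 0 → ∀ i j, v i * u j = v j * u i

def Thin (P : Fin 5 → Fin 3 → ℤ) : Prop :=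
  ∃ (φ : (Fin 3 → ℤ) →ₗ[ℤ] ℤ) (c : ℤ), φ ≠ 0 ∧ ∀ k, φ (P k) = c ∨ φ (P k) = c + 1

lemma sum_map (P : Fin 5 → Fin 3 → ℤ) (E : (Fin 3 → ℤ) ≃ₗ[ℤ] (Fin 3 → ℤ)) (t : Fin 3 → ℤ)
    (w : Fin 5 → ℤ) :
    ∑ k, w k • E (P k - t) = E (∑ k, w k • P k - (∑ k, w k) • t) := by
  simp only [map_sub, map_sum, map_smul, smul_sub, Finset.sum_sub_distrib, Finset.sum_smul]

lemma Cfg.map {P : Fin 5 → Fin 3 → ℤ} {v : Fin 5 → ℤ} (h : Cfg P v)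
    (E : (Fin 3 → ℤ) ≃ₗ[ℤ] (Fin 3 → ℤ)) (t : Fin 3 → ℤ) :
    Cfg (fun k => E (P k - t)) v where
  emp z w hw hpos hz := by
    rw [sum_map] at hz
    obtain ⟨k, hk⟩ := h.emp (E.symm z + t) w hw hpos (by
      apply_fun E.symm at hz
      rw [map_smul, E.symm_apply_apply] at hz
      rw [smul_add, hz]; abel)
    exact ⟨k, by rw [← hk]; simp⟩
  dep1 := h.dep1
  dep := by rw [sum_map, h.dep, h.dep1]; simp
  uniq u hu hu' := by
    rw [sum_map, hu] at hu'
    refine h.uniq u hu ?_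
    rw [zero_smul, sub_zero] at hu'
    exact (LinearEquiv.map_eq_zero_iff E).1 hu'

lemma Thin.of_map {P : Fin 5 → Fin 3 → ℤ} (E : (Fin 3 → ℤ) ≃ₗ[ℤ] (Fin 3 → ℤ)) (t : Fin 3 → ℤ)
    (h : Thin (fun k => E (P k - t))) : Thin P := by
  obtain ⟨φ, c, h0, h⟩ := h
  refine ⟨φ.comp E.toLinearMap, c + φ (E t), ?_, fun k => ?_⟩
  · intro h1
    apply h0
    ext1 i
    ext
    have := LinearMap.congr_fun h1 (E.symm (Pi.single i 1))
    simpa using this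
  · have := h k
    simp only [map_sub] at this
    simp only [LinearMap.comp_apply, LinearEquiv.coe_coe]
    omega

lemma Cfg.perm {P : Fin 5 → Fin 3 → ℤ} {v : Fin 5 → ℤ} (h : Cfg P v) (σ : Equiv.Perm (Fin 5)) :
    Cfg (fun k => P (σ k)) (fun k => v (σ k)) where
  emp z w hw hpos hz := by
    obtain ⟨k, hk⟩ := h.emp z (fun k => w (σ.symm k)) (fun k => hw _)
      (by rw [Equiv.sum_comp σ.symm w]; exact hpos) (by
        rw [Equiv.sum_comp σ.symm w, hz, ← Equiv.sum_comp σ (fun k => w (σ.symm k) • P k)]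
        simp)
    exact ⟨σ.symm k, by simpa using hk⟩
  dep1 := by rw [Equiv.sum_comp σ v]; exact h.dep1
  dep := by rw [Equiv.sum_comp σ (fun k => v k • P k)]; exact h.dep
  uniq u hu hu' i j := by
    have := h.uniq (fun k => u (σ.symm k)) (by rw [Equiv.sum_comp σ.symm u]; exact hu) (by
      rw [← hu', ← Equiv.sum_comp σ (fun k => u (σ.symm k) • P k)]
      simp) (σ i) (σ j)
    simpa using this

lemma Thin.of_perm {P : Fin 5 → Fin 3 → ℤ} (σ : Equiv.Perm (Fin 5))
    (h : Thin (fun k => P (σ k))) : Thin P := by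
  obtain ⟨φ, c, h0, h⟩ := h
  exact ⟨φ, c, h0, fun k => by simpa using h (σ.symm k)⟩

lemma Cfg.neg {P : Fin 5 → Fin 3 → ℤ} {v : Fin 5 → ℤ} (h : Cfg P v) :
    Cfg P (fun k => - v k) where
  emp := h.emp
  dep1 := by rw [Finset.sum_neg_distrib, h.dep1, neg_zero]
  dep := by simp only [neg_smul]; rw [Finset.sum_neg_distrib, h.dep, neg_zero]
  uniq u hu hu' i j := by have := h.uniq u hu hu' i j; simp only [neg_mul, this]

lemma thin_of {P : Fin 5 → Fin 3 → ℤ} (f1 f2 f3 c : ℤ) (h0 : ¬ (f1 = 0 ∧ f2 = 0 ∧ f3 = 0))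
    (h : ∀ k, f1 * P k 0 + f2 * P k 1 + f3 * P k 2 = c ∨
      f1 * P k 0 + f2 * P k 1 + f3 * P k 2 = c + 1) : Thin P := by
  refine ⟨f1 • LinearMap.proj 0 + f2 • LinearMap.proj 1 + f3 • LinearMap.proj 2, c, ?_, ?_⟩
  · intro h1
    apply h0
    have e1 := LinearMap.congr_fun h1 (![1, 0, 0] : Fin 3 → ℤ)
    have e2 := LinearMap.congr_fun h1 (![0, 1, 0] : Fin 3 → ℤ)
    have e3 := LinearMap.congr_fun h1 (![0, 0, 1] : Fin 3 → ℤ)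
    simp at e1 e2 e3
    exact ⟨e1, e2, e3⟩
  · intro k
    simpa using h k

lemma bez (a b : ℤ) : ∃ g a' b' x y : ℤ, 0 ≤ g ∧ a = g * a' ∧ b = g * b' ∧ x * a' + y * b' = 1 := by
  by_cases h : Int.gcd a b = 0
  · rw [Int.gcd_eq_zero_iff] at h
    exact ⟨0, 1, 0, 1, 0, le_refl _, by simp [h.1], by simp [h.2], by norm_num⟩
  · obtain ⟨a', ha⟩ := Int.gcd_dvd_left a b
    obtain ⟨b', hb⟩ := Int.gcd_dvd_right a b
    have hg := Int.gcd_eq_gcd_ab a b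
    refine ⟨Int.gcd a b, a', b', Int.gcdA a b, Int.gcdB a b, by positivity, ha, hb, ?_⟩
    have h' : (Int.gcd a b : ℤ) ≠ 0 := by exact_mod_cast h
    apply mul_left_cancel₀ h'
    calc (Int.gcd a b : ℤ) * (Int.gcdA a b * a' + Int.gcdB a b * b')
        = (Int.gcd a b * a') * Int.gcdA a b + (Int.gcd a b * b') * Int.gcdB a b := by ring
      _ = a * Int.gcdA a b + b * Int.gcdB a b := by rw [← ha, ← hb]
      _ = _ := by rw [← hg, mul_one]

lemma kill12 (w : Fin 3 → ℤ) : ∃ (E : (Fin 3 → ℤ) ≃ₗ[ℤ] (Fin 3 → ℤ)) (g : ℤ), 0 ≤ g ∧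
    E w = ![w 0, g, 0] ∧ ∀ c, E ![c, 0, 0] = ![c, 0, 0] := by
  obtain ⟨g, a, b, x, y, hg, ha, hb, h⟩ := bez (w 1) (w 2)
  refine ⟨{ toFun := fun u => ![u 0, x * u 1 + y * u 2, -b * u 1 + a * u 2]
            invFun := fun u => ![u 0, a * u 1 - y * u 2, b * u 1 + x * u 2]
            map_add' := ?_
            map_smul' := ?_
            left_inv := ?_
            right_inv := ?_ }, g, hg, ?_, ?_⟩
  · intro u u'; ext i; fin_cases i <;> simp <;> ring
  · intro u u'; ext i; fin_cases i <;> simp <;> ring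
  · intro u; ext i; fin_cases i <;> simp
    · linear_combination u 1 * h
    · linear_combination u 2 * h
  · intro u; ext i; fin_cases i <;> simp
    · linear_combination u 1 * h
    · linear_combination u 2 * h
  · ext i; fin_cases i <;> simp
    · rw [ha, hb]; linear_combination g * h
    · rw [ha, hb]; ring
  · intro c; ext i; fin_cases i <;> simp

lemma kill01 (w : Fin 3 → ℤ) : ∃ (E : (Fin 3 → ℤ) ≃ₗ[ℤ] (Fin 3 → ℤ)) (g : ℤ), 0 ≤ g ∧
    E w = ![g, 0, w 2] := by
  obtain ⟨g, a, b, x, y, hg, ha, hb, h⟩ := bez (w 0) (w 1)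
  refine ⟨{ toFun := fun u => ![x * u 0 + y * u 1, -b * u 0 + a * u 1, u 2]
            invFun := fun u => ![a * u 0 - y * u 1, b * u 0 + x * u 1, u 2]
            map_add' := ?_
            map_smul' := ?_
            left_inv := ?_
            right_inv := ?_ }, g, hg, ?_⟩
  · intro u u'; ext i; fin_cases i <;> simp <;> ring
  · intro u u'; ext i; fin_cases i <;> simp <;> ring
  · intro u; ext i; fin_cases i <;> simp
    · linear_combination u 0 * h
    · linear_combination u 1 * h
  · intro u; ext i; fin_cases i <;> simp
    · linear_combination u 0 * h
    · linear_combination u 1 * h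
  · ext i; fin_cases i <;> simp
    · rw [ha, hb]; linear_combination g * h
    · rw [ha, hb]; ring

lemma shear (x : ℤ) : ∃ (E : (Fin 3 → ℤ) ≃ₗ[ℤ] (Fin 3 → ℤ)),
    ∀ u, E u = ![u 0 - x * u 1, u 1, u 2] := by
  refine ⟨{ toFun := fun u => ![u 0 - x * u 1, u 1, u 2]
            invFun := fun u => ![u 0 + x * u 1, u 1, u 2]
            map_add' := ?_
            map_smul' := ?_
            left_inv := ?_
            right_inv := ?_ }, fun u => rfl⟩
  · intro u u'; ext i; fin_cases i <;> simp <;> ring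
  · intro u u'; ext i; fin_cases i <;> simp <;> ring
  · intro u; ext i; fin_cases i <;> simp
  · intro u; ext i; fin_cases i <;> simp

lemma flip2 : ∃ (E : (Fin 3 → ℤ) ≃ₗ[ℤ] (Fin 3 → ℤ)),
    ∀ u, E u = ![u 0, u 1, - u 2] := by
  refine ⟨{ toFun := fun u => ![u 0, u 1, - u 2]
            invFun := fun u => ![u 0, u 1, - u 2]
            map_add' := ?_
            map_smul' := ?_
            left_inv := ?_
            right_inv := ?_ }, fun u => rfl⟩
  · intro u u'; ext i; fin_cases i <;> simp; ring
  · intro u u'; ext i; fin_cases i <;> simp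
  · intro u; ext i; fin_cases i <;> simp
  · intro u; ext i; fin_cases i <;> simp

lemma vec3 (u : Fin 3 → ℤ) {a b c : ℤ} (h0 : u 0 = a) (h1 : u 1 = b) (h2 : u 2 = c) :
    u = ![a, b, c] := by
  ext i; fin_cases i <;> simp [h0, h1, h2]

lemma sum5 (P : Fin 5 → Fin 3 → ℤ) (a b c d e : ℤ) :
    ∑ k, (![a, b, c, d, e] : Fin 5 → ℤ) k • P k =
      a • P 0 + b • P 1 + c • P 2 + d • P 3 + e • P 4 := by
  rw [Fin.sum_univ_five]; rfl

lemma sum5' (a b c d e : ℤ) :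
    ∑ k, (![a, b, c, d, e] : Fin 5 → ℤ) k = a + b + c + d + e := by
  rw [Fin.sum_univ_five]; rfl

lemma tri (w1 w2 : Fin 3 → ℤ)
    (hemp : ∀ (z : Fin 3 → ℤ) (n β γ : ℤ), 0 < n → 0 ≤ β → 0 ≤ γ → β + γ ≤ n →
      n • z = β • w1 + γ • w2 → z = 0 ∨ z = w1 ∨ z = w2)
    (hind : ∀ β γ : ℤ, β • w1 + γ • w2 = 0 → β = 0 ∧ γ = 0) :
    ∃ E : (Fin 3 → ℤ) ≃ₗ[ℤ] (Fin 3 → ℤ), E w1 = ![1, 0, 0] ∧ E w2 = ![0, 1, 0] := by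
  -- transport of the hypotheses
  have hemp' : ∀ E : (Fin 3 → ℤ) ≃ₗ[ℤ] (Fin 3 → ℤ), ∀ (z : Fin 3 → ℤ) (n β γ : ℤ), 0 < n →
      0 ≤ β → 0 ≤ γ → β + γ ≤ n → n • z = β • E w1 + γ • E w2 →
      z = 0 ∨ z = E w1 ∨ z = E w2 := by
    intro E z n β γ hn hβ hγ hs hz
    have := hemp (E.symm z) n β γ hn hβ hγ hs (by
      apply E.injective
      rw [map_smul, map_add, map_smul, map_smul, E.apply_symm_apply, hz])
    rcases this with h | h | h
    · left; simpa using h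
    · right; left; rw [← h]; simp
    · right; right; rw [← h]; simp
  have hind' : ∀ E : (Fin 3 → ℤ) ≃ₗ[ℤ] (Fin 3 → ℤ), ∀ β γ : ℤ, β • E w1 + γ • E w2 = 0 →
      β = 0 ∧ γ = 0 := by
    intro E β γ h
    apply hind
    apply E.injective
    rw [map_add, map_smul, map_smul, h, map_zero]
  obtain ⟨E1, g1, _, hE1, _⟩ := kill12 w1
  obtain ⟨E2, g, hg, hE2⟩ := kill01 (E1 w1)
  obtain ⟨E3, h, hh, hE3, hE3'⟩ := kill12 (E2 (E1 w2))
  have e1 : (E1.trans (E2.trans E3)) w1 = ![g, 0, 0] := by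
    have : E2 (E1 w1) = ![g, 0, 0] := by rw [hE2, hE1]; simp
    simp only [LinearEquiv.trans_apply, this, hE3']
  generalize hx : E2 (E1 w2) 0 = x at hE3
  have e2 : (E1.trans (E2.trans E3)) w2 = ![x, h, 0] := hE3
  generalize E1.trans (E2.trans E3) = F at e1 e2
  have hE := hemp' F
  have hI := hind' F
  rw [e1, e2] at hE hI
  have g0 : g ≠ 0 := by
    rintro rfl
    have := hI 1 0 (by ext i; fin_cases i <;> simp)
    omega
  have h0 : h ≠ 0 := by
    rintro rfl
    have := hI x (-g) (by ext i; fin_cases i <;> simp; ring)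
    omega
  have g1 : g = 1 := by
    rcases hE ![1, 0, 0] g 1 0 (by omega) (by omega) le_rfl (by omega)
      (by ext i; fin_cases i <;> simp) with h | h | h
    · have := congrFun h 0; simp at this
    · have := congrFun h 0; simp at this; omega
    · have := congrFun h 1; simp at this; omega
  have h1 : h = 1 := by
    have k1 := Int.emod_add_mul_ediv (-x) h
    have k2 := Int.emod_nonneg (-x) h0
    have k3 := Int.emod_lt_of_pos (-x) (show 0 < h by omega)
    rcases hE ![-(-x / h), 1, 0] h ((-x) % h) 1 (by omega) k2 (by omega) (by omega)
      (by
        ext i; fin_cases i <;> simp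
        rw [g1]; linarith) with h | h | h
    · have := congrFun h 1; simp at this
    · have := congrFun h 1; simp at this
    · have := congrFun h 1; simp at this; omega
  obtain ⟨S, hS⟩ := shear x
  refine ⟨F.trans S, ?_, ?_⟩
  · rw [LinearEquiv.trans_apply, e1, hS, g1]; simp
  · rw [LinearEquiv.trans_apply, e2, hS, h1]; simp

lemma normalise {P : Fin 5 → Fin 3 → ℤ} {v : Fin 5 → ℤ} (h : Cfg P v)
    (h3 : v 4 ≠ 0 ∨ 0 < v 0 * v 3 ∨ 0 < v 1 * v 3) (h4 : v 3 ≠ 0) :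
    ∃ P', Cfg P' v ∧ P' 0 = ![0, 0, 0] ∧ P' 1 = ![1, 0, 0] ∧ P' 2 = ![0, 1, 0] ∧ 0 ≤ P' 4 2 ∧
      (Thin P' → Thin P) := by
  obtain ⟨E, hE1, hE2⟩ := tri (P 1 - P 0) (P 2 - P 0) (by
      intro z n β γ hn hβ hγ hs hz
      have hz' : n • (z + P 0) = (n - β - γ) • P 0 + β • P 1 + γ • P 2 := by
        rw [smul_add, hz]; module
      obtain ⟨k, hk⟩ := h.emp (z + P 0) ![n - β - γ, β, γ, 0, 0] (by
          intro k; fin_cases k <;> simp <;> omega) (by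
          rw [sum5']; omega) (by
          rw [sum5, sum5']
          have e : n - β - γ + β + γ + 0 + 0 = n := by ring
          rw [e, hz']; module)
      rw [hk] at hz'
      have hzk : z = P k - P 0 := by rw [← hk]; abel
      fin_cases k
      · left; simpa using hzk
      · right; left; simpa using hzk
      · right; right; simpa using hzk
      · exfalso
        have := h.uniq ![n - β - γ, β, γ, -n, 0] (by rw [sum5']; ring) (by
          rw [sum5]
          have hz'' : n • P 3 = _ := hz'
          rw [neg_smul, hz'']; module)
        have k1 := this 4 3
        have k2 := this 0 3
        have k3 := this 1 3
        simp at k1 k2 k3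
        rcases h3 with h3 | h3 | h3
        · omega
        · have : 0 < v 0 * v 3 * n := by positivity
          have : v 0 * v 3 * n = -(v 3 ^ 2 * (n - β - γ)) := by linear_combination - v 3 * k2
          have : 0 ≤ v 3 ^ 2 * (n - β - γ) := mul_nonneg (sq_nonneg _) (by omega)
          omega
        · have : 0 < v 1 * v 3 * n := by positivity
          have : v 1 * v 3 * n = -(v 3 ^ 2 * β) := by linear_combination - v 3 * k3
          have : 0 ≤ v 3 ^ 2 * β := mul_nonneg (sq_nonneg _) (by omega)
          omega
      · exfalso
        have := h.uniq ![n - β - γ, β, γ, 0, -n] (by rw [sum5']; ring) (by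
          rw [sum5]
          have hz'' : n • P 4 = _ := hz'
          rw [neg_smul, hz'']; module) 3 4
        simp at this
        omega) (by
      intro β γ hz
      have := h.uniq ![-β - γ, β, γ, 0, 0] (by rw [sum5']; ring) (by
          rw [sum5, ← hz]; module) 3
      have k1 := this 1
      have k2 := this 2
      simp [h4] at k1 k2
      exact ⟨k1, k2⟩)
  have key : ∀ F : (Fin 3 → ℤ) ≃ₗ[ℤ] (Fin 3 → ℤ), F (P 1 - P 0) = ![1, 0, 0] →
      F (P 2 - P 0) = ![0, 1, 0] → 0 ≤ F (P 4 - P 0) 2 → ∃ P', Cfg P' v ∧ P' 0 = ![0, 0, 0] ∧ P' 1 = ![1, 0, 0] ∧ P' 2 = ![0, 1, 0] ∧ 0 ≤ P' 4 2 ∧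
      (Thin P' → Thin P) := by
    intro F h1 h2 h3
    refine ⟨_, h.map F (P 0), ?_, h1, h2, h3, Thin.of_map F (P 0)⟩
    rw [sub_self, map_zero]
    ext i; fin_cases i <;> simp
  rcases le_total 0 (E (P 4 - P 0) 2) with hp | hp
  · exact key E hE1 hE2 hp
  · obtain ⟨S, hS⟩ := flip2
    refine key (E.trans S) ?_ ?_ ?_
    · rw [LinearEquiv.trans_apply, hE1, hS]; simp
    · rw [LinearEquiv.trans_apply, hE2, hS]; simp
    · rw [LinearEquiv.trans_apply, hS]
      show 0 ≤ - _
      omega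

lemma Cfg.pt {P : Fin 5 → Fin 3 → ℤ} {v : Fin 5 → ℤ} (h : Cfg P v)
    (p0 : P 0 = ![0, 0, 0]) (p1 : P 1 = ![1, 0, 0]) (p2 : P 2 = ![0, 1, 0])
    (x y z n w1 w2 w3 w4 : ℤ) (hn : 0 < n) (h1 : 0 ≤ w1) (h2 : 0 ≤ w2) (h3 : 0 ≤ w3) (h4 : 0 ≤ w4)
    (hs : w1 + w2 + w3 + w4 ≤ n)
    (ex : n * x = w1 + w3 * P 3 0 + w4 * P 4 0)
    (ey : n * y = w2 + w3 * P 3 1 + w4 * P 4 1)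
    (ez : n * z = w3 * P 3 2 + w4 * P 4 2) : ∃ k, ![x, y, z] = P k := by
  refine h.emp ![x, y, z] ![n - w1 - w2 - w3 - w4, w1, w2, w3, w4] ?_ ?_ ?_
  · intro k; fin_cases k <;> simp <;> omega
  · rw [sum5']; omega
  · have : ∑ k, (![n - w1 - w2 - w3 - w4, w1, w2, w3, w4] : Fin 5 → ℤ) k = n := by
      rw [sum5']; ring
    rw [this, sum5]
    ext i; fin_cases i <;> simp [p0, p1, p2]
    · exact ex
    · exact ey
    · exact ez

lemma Cfg.deps {P : Fin 5 → Fin 3 → ℤ} {v : Fin 5 → ℤ} (h : Cfg P v)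
    (p0 : P 0 = ![0, 0, 0]) (p1 : P 1 = ![1, 0, 0]) (p2 : P 2 = ![0, 1, 0]) :
    v 1 + v 3 * P 3 0 + v 4 * P 4 0 = 0 ∧ v 2 + v 3 * P 3 1 + v 4 * P 4 1 = 0 ∧
    v 3 * P 3 2 + v 4 * P 4 2 = 0 := by
  have hd := h.dep
  rw [Fin.sum_univ_five, p0, p1, p2] at hd
  have e0 := congrFun hd 0
  have e1 := congrFun hd 1
  have e2 := congrFun hd 2
  simp at e0 e1 e2
  exact ⟨e0, e1, e2⟩

lemma thin_flat {P : Fin 5 → Fin 3 → ℤ}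
    (p0 : P 0 = ![0, 0, 0]) (p1 : P 1 = ![1, 0, 0]) (p2 : P 2 = ![0, 1, 0])
    (h3 : P 3 2 = 0) (h4 : P 4 2 = 0 ∨ P 4 2 = 1) : Thin P := by
  refine thin_of 0 0 1 0 (by norm_num) ?_
  intro k
  fin_cases k
  · simp [p0]
  · simp [p1]
  · simp [p2]
  · simp [h3]
  · simpa using h4

lemma case22 {P : Fin 5 → Fin 3 → ℤ} {v : Fin 5 → ℤ} (h : Cfg P v)
    (s0 : 0 < v 0) (s1 : v 1 < 0) (s2 : v 2 < 0) (s3 : 0 < v 3) (s4 : v 4 = 0) : Thin P := by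
  obtain ⟨P, h, p0, p1, p2, hz4, hT⟩ := normalise h (.inr (.inl (mul_pos s0 s3))) s3.ne'
  apply hT
  obtain ⟨ex, ey, ez⟩ := h.deps p0 p1 p2
  rw [s4] at ex ey ez
  have z3 : P 3 2 = 0 := by
    have : v 3 * P 3 2 = 0 := by linarith
    exact (mul_eq_zero.1 this).resolve_left s3.ne'
  by_cases hz : P 4 2 = 0
  · exact thin_flat p0 p1 p2 z3 (.inl hz)
  have x3 : 0 < P 3 0 := pos_of_mul_pos_right (show 0 < v 3 * P 3 0 by linarith) s3.le
  have y3 : 0 < P 3 1 := pos_of_mul_pos_right (show 0 < v 3 * P 3 1 by linarith) s3.le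
  have h11 : ∃ k, ![1, 1, 0] = P k := by
    rcases le_total (P 3 0) (P 3 1) with hle | hle
    · exact h.pt p0 p1 p2 1 1 0 (P 3 1) (P 3 1 - P 3 0) 0 1 0 y3 (by omega) le_rfl (by omega)
        le_rfl (by omega) (by ring) (by ring) (by rw [z3]; ring)
    · exact h.pt p0 p1 p2 1 1 0 (P 3 0) 0 (P 3 0 - P 3 1) 1 0 x3 le_rfl (by omega) (by omega)
        le_rfl (by omega) (by ring) (by ring) (by rw [z3]; ring)
  have p3 : P 3 = ![1, 1, 0] := by
    obtain ⟨k, hk⟩ := h11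
    fin_cases k
    · have := congrFun hk 0; simp [p0] at this
    · have := congrFun hk 1; simp [p1] at this
    · have := congrFun hk 0; simp [p2] at this
    · exact hk.symm
    · have := congrFun hk 2; simp at this; omega
  have hq : P 4 2 = 1 := by
    by_contra hne
    have hq2 : 2 ≤ P 4 2 := by omega
    generalize hq : P 4 2 = q at *
    generalize ha : P 4 0 = a at *
    generalize hb : P 4 1 = b at *
    have a1 := Int.emod_add_mul_ediv (-a) q
    have a2 := Int.emod_nonneg (-a) (show q ≠ 0 by omega)
    have a3 := Int.emod_lt_of_pos (-a) (show 0 < q by omega)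
    have b1 := Int.emod_add_mul_ediv (-b) q
    have b2 := Int.emod_nonneg (-b) (show q ≠ 0 by omega)
    have b3 := Int.emod_lt_of_pos (-b) (show 0 < q by omega)
    have : ∃ k, ![-(-a / q), -(-b / q), 1] = P k := by
      rcases le_total (-a % q) (-b % q) with hle | hle
      · refine h.pt p0 p1 p2 _ _ 1 q 0 (-b % q - -a % q) (-a % q) 1 (by omega) le_rfl (by omega)
          (by omega) (by omega) (by omega) ?_ ?_ ?_
        · simp [p3, ha]; linarith
        · simp [p3, hb]; linarith
        · simp [p3, hq]
      · refine h.pt p0 p1 p2 _ _ 1 q (-a % q - -b % q) 0 (-b % q) 1 (by omega) (by omega) le_rfl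
          (by omega) (by omega) (by omega) ?_ ?_ ?_
        · simp [p3, ha]; linarith
        · simp [p3, hb]; linarith
        · simp [p3, hq]
    obtain ⟨k, hk⟩ := this
    have := congrFun hk 2
    fin_cases k
    · simp [p0] at this
    · simp [p1] at this
    · simp [p2] at this
    · simp [p3] at this
    · simp at this; omega
  exact thin_flat p0 p1 p2 z3 (.inr hq)

lemma case21 {P : Fin 5 → Fin 3 → ℤ} {v : Fin 5 → ℤ} (h : Cfg P v)
    (s0 : v 0 < 0) (s1 : 0 < v 1) (s2 : v 2 = 0) (s3 : 0 < v 3) (s4 : v 4 = 0) : Thin P := by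
  obtain ⟨P, h, p0, p1, p2, hz4, hT⟩ := normalise h (.inr (.inr (mul_pos s1 s3))) s3.ne'
  apply hT
  obtain ⟨ex, ey, ez⟩ := h.deps p0 p1 p2
  rw [s4] at ex ey ez
  have z3 : P 3 2 = 0 := by
    have : v 3 * P 3 2 = 0 := by linarith
    exact (mul_eq_zero.1 this).resolve_left s3.ne'
  have y3 : P 3 1 = 0 := by
    have : v 3 * P 3 1 = 0 := by linarith
    exact (mul_eq_zero.1 this).resolve_left s3.ne'
  by_cases hz : P 4 2 = 0
  · exact thin_flat p0 p1 p2 z3 (.inl hz)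
  have x3 : 0 < - P 3 0 := pos_of_mul_pos_right (show 0 < v 3 * (- P 3 0) by linarith) s3.le
  have p3 : P 3 = ![-1, 0, 0] := by
    obtain ⟨k, hk⟩ := h.pt p0 p1 p2 (-1) 0 0 (- P 3 0) 0 0 1 0 x3 le_rfl le_rfl (by omega) le_rfl
      (by omega) (by ring) (by rw [y3]; ring) (by rw [z3]; ring)
    fin_cases k
    · have := congrFun hk 0; simp [p0] at this
    · have := congrFun hk 0; simp [p1] at this
    · have := congrFun hk 0; simp [p2] at this
    · exact hk.symm
    · have := congrFun hk 2; simp at this; omega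
  have hd : P 4 2 ∣ P 4 1 - 1 := by
    refine arith21 (P 4 2) (P 4 1) (P 4 0) (by omega) ?_
    intro k X y hk hkd hy hX
    obtain ⟨j, hj⟩ : ∃ j, ![X, y, k] = P j := by
      rcases le_total 0 (P 4 2 * X - k * P 4 0) with hs | hs
      · rw [abs_of_nonneg hs] at hX
        refine h.pt p0 p1 p2 X y k (P 4 2) (P 4 2 * X - k * P 4 0) (P 4 2 * y - k * P 4 1) 0 k
          (by omega) hs (by omega) le_rfl hk.le (by linarith) (by ring) (by ring) (by ring)
      · rw [abs_of_nonpos hs] at hX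
        refine h.pt p0 p1 p2 X y k (P 4 2) 0 (P 4 2 * y - k * P 4 1) (-(P 4 2 * X - k * P 4 0)) k
          (by omega) le_rfl (by omega) (by omega) hk.le (by linarith) ?_ ?_ ?_
        · simp [p3]
        · simp [p3]
        · simp [p3]; ring
    have := congrFun hj 2
    fin_cases j
    · simp [p0] at this; omega
    · simp [p1] at this; omega
    · simp [p2] at this; omega
    · simp [p3] at this; omega
    · simp at this; omega
  obtain ⟨j, hj⟩ := hd
  refine thin_of 0 1 (-j) 0 (by norm_num) ?_
  intro k
  fin_cases k
  · simp [p0]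
  · simp [p1]
  · simp [p2]
  · simp [p3]
  · right; simp; linarith

lemma case32 {P : Fin 5 → Fin 3 → ℤ} {v : Fin 5 → ℤ} (h : Cfg P v)
    (s0 : 0 < v 0) (s1 : 0 < v 1) (s2 : 0 < v 2) (s3 : v 3 < 0) (s4 : v 4 < 0) : Thin P := by
  obtain ⟨P, h, p0, p1, p2, hz4, hT⟩ := normalise h (.inl s4.ne) s3.ne
  apply hT
  obtain ⟨ex, ey, ez⟩ := h.deps p0 p1 p2
  have hs := h.dep1
  rw [Fin.sum_univ_five] at hs
  by_cases hz : P 4 2 = 0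
  · have z3 : P 3 2 = 0 := by
      have : v 3 * P 3 2 = 0 := by rw [hz] at ez; linarith
      exact (mul_eq_zero.1 this).resolve_left s3.ne
    exact thin_flat p0 p1 p2 z3 (.inl hz)
  have hq : 0 < P 4 2 := by omega
  obtain ⟨r, hr⟩ : ∃ r, r = - P 3 2 := ⟨_, rfl⟩
  have hr0 : 0 < r := by
    have : 0 < (- v 4) * P 4 2 := mul_pos (by omega) hq
    exact pos_of_mul_pos_right (show 0 < (- v 3) * r by rw [hr]; linarith) (by omega)
  have hst : v 3 * r = v 4 * P 4 2 := by rw [hr]; linarith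
  have noZ : ∀ x y k, (∃ j, ![x, y, k] = P j) → k = 0 ∨ k = P 4 2 ∨ k = -r := by
    rintro x y k ⟨j, hj⟩
    have := congrFun hj 2
    fin_cases j
    · simp [p0] at this; omega
    · simp [p1] at this; omega
    · simp [p2] at this; omega
    · simp at this; omega
    · simp at this; omega
  have cross : ∀ a b c : ℤ, 0 < c → c + v 3 * b + v 4 * a = 0 → 0 < r * a + P 4 2 * b := by
    intro a b c hc he
    have : (- v 3) * (r * a + P 4 2 * b) = P 4 2 * c := by
      linear_combination - P 4 2 * he - a * hst
    exact pos_of_mul_pos_right (show 0 < (- v 3) * (r * a + P 4 2 * b) by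
      rw [this]; positivity) (by omega)
  have key := bipyr (P 4 2) r (1 - P 4 0 - P 4 1) (P 4 0) (P 4 1) (1 - P 3 0 - P 3 1) (P 3 0)
    (P 3 1) (by omega) (by omega) (by ring) (by ring) (cross _ _ (v 0) s0 (by linarith))
    (cross _ _ (v 1) s1 ex) (cross _ _ (v 2) s2 ey) (by
      intro k x y z hs hk hkq h1 h2 h3
      have := noZ y z k (h.pt p0 p1 p2 y z k (P 4 2) (P 4 2 * y - k * P 4 0)
        (P 4 2 * z - k * P 4 1) 0 k hq (by omega) (by omega) le_rfl hk.le (by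
          obtain rfl : x = 1 - y - z := by omega
          linarith) (by ring) (by ring) (by ring))
      omega) (by
      intro k x y z hs hk hkq h1 h2 h3
      have := noZ y z (-k) (h.pt p0 p1 p2 y z (-k) r (r * y - k * P 3 0)
        (r * z - k * P 3 1) k 0 hr0 (by omega) (by omega) hk.le le_rfl (by
          obtain rfl : x = 1 - y - z := by omega
          linarith) (by ring) (by ring) (by rw [hr]; ring))
      omega)
  have hr' : P 3 2 = -r := by omega
  rcases key with ⟨m, ha, hb⟩ | ⟨m, ha, hb⟩ | ⟨m, ha, hb⟩
  · refine thin_of (-1) (-1) m (-1) (by norm_num) ?_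
    intro k
    fin_cases k
    · simp [p0]
    · simp [p1]
    · simp [p2]
    · simp [hr']; rcases hb with hb | hb
      · left; linarith
      · right; linarith
    · simp; rcases ha with ha | ha
      · left; linarith
      · right; linarith
  · refine thin_of 1 0 m 0 (by norm_num) ?_
    intro k
    fin_cases k
    · simp [p0]
    · simp [p1]
    · simp [p2]
    · simp [hr']; rcases hb with hb | hb
      · left; linarith
      · right; linarith
    · simp; rcases ha with ha | ha
      · left; linarith
      · right; linarith
  · refine thin_of 0 1 m 0 (by norm_num) ?_
    intro k
    fin_cases k
    · simp [p0]
    · simp [p1]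
    · simp [p2]
    · simp [hr']; rcases hb with hb | hb
      · left; linarith
      · right; linarith
    · simp; rcases ha with ha | ha
      · left; linarith
      · right; linarith

lemma exists_perm (i j k l m : Fin 5) (h : Function.Injective ![i, j, k, l, m]) :
    ∃ σ : Equiv.Perm (Fin 5), σ 0 = i ∧ σ 1 = j ∧ σ 2 = k ∧ σ 3 = l ∧ σ 4 = m :=
  ⟨Equiv.ofBijective _ (Finite.injective_iff_bijective.1 h), rfl, rfl, rfl, rfl, rfl⟩

lemma inj5 {i j k l m : Fin 5} (h1 : i ≠ j) (h2 : i ≠ k) (h3 : i ≠ l) (h4 : i ≠ m) (h5 : j ≠ k)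
    (h6 : j ≠ l) (h7 : j ≠ m) (h8 : k ≠ l) (h9 : k ≠ m) (h10 : l ≠ m) :
    Function.Injective ![i, j, k, l, m] := by
  intro a b hab
  fin_cases a <;> fin_cases b <;> simp_all [eq_comm]

lemma exists_out (s : Finset (Fin 5)) (h : s.card < 5) : ∃ m, m ∉ s := by
  by_contra hcon
  push Not at hcon
  have : s = Finset.univ := Finset.eq_univ_iff_forall.2 hcon
  rw [this] at h
  simp at h

lemma thin_of_sig {P : Fin 5 → Fin 3 → ℤ} {v : Fin 5 → ℤ} (h : Cfg P v)
    (hsig :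
      ((Finset.univ.filter fun k => 0 < v k).card = 2 ∧
        (Finset.univ.filter fun k => v k < 0).card = 2) ∨
      ((Finset.univ.filter fun k => 0 < v k).card = 2 ∧
        (Finset.univ.filter fun k => v k < 0).card = 1) ∨
      ((Finset.univ.filter fun k => 0 < v k).card = 3 ∧
        (Finset.univ.filter fun k => v k < 0).card = 2)) : Thin P := by
  rcases hsig with ⟨hp, hn⟩ | ⟨hp, hn⟩ | ⟨hp, hn⟩
  · obtain ⟨i, j, hij, hp⟩ := Finset.card_eq_two.1 hp
    obtain ⟨k, l, hkl, hn⟩ := Finset.card_eq_two.1 hn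
    have fp : ∀ x, 0 < v x ↔ x = i ∨ x = j := fun x => by
      have := Finset.ext_iff.1 hp x; simpa using this
    have fn : ∀ x, v x < 0 ↔ x = k ∨ x = l := fun x => by
      have := Finset.ext_iff.1 hn x; simpa using this
    obtain ⟨m, hm⟩ := exists_out {i, j, k, l} (lt_of_le_of_lt Finset.card_le_four (by norm_num))
    simp only [Finset.mem_insert, Finset.mem_singleton, not_or] at hm
    obtain ⟨hm1, hm2, hm3, hm4⟩ := hm
    have vi := (fp i).2 (.inl rfl)
    have vj := (fp j).2 (.inr rfl)
    have vk := (fn k).2 (.inl rfl)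
    have vl := (fn l).2 (.inr rfl)
    have vm : v m = 0 := by
      have h1 := fp m
      have h2 := fn m
      simp only [hm1, hm2, hm3, hm4, or_self, iff_false] at h1 h2
      omega
    have ne : ∀ {x y}, v x ≠ v y → x ≠ y := fun hh e => hh (by rw [e])
    obtain ⟨σ, e0, e1, e2, e3, e4⟩ := exists_perm i k l j m
      (inj5 (ne (by omega)) (ne (by omega)) hij (Ne.symm hm1) hkl (ne (by omega)) (ne (by omega))
        (ne (by omega)) (ne (by omega)) (Ne.symm hm2))
    exact Thin.of_perm σ (case22 (h.perm σ) (by simpa [e0] using vi) (by simpa [e1] using vk)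
      (by simpa [e2] using vl) (by simpa [e3] using vj) (by simpa [e4] using vm))
  · obtain ⟨i, j, hij, hp⟩ := Finset.card_eq_two.1 hp
    obtain ⟨k, hn⟩ := Finset.card_eq_one.1 hn
    have fp : ∀ x, 0 < v x ↔ x = i ∨ x = j := fun x => by
      have := Finset.ext_iff.1 hp x; simpa using this
    have fn : ∀ x, v x < 0 ↔ x = k := fun x => by
      have := Finset.ext_iff.1 hn x; simpa using this
    obtain ⟨m, hm⟩ := exists_out {i, j, k} (lt_of_le_of_lt Finset.card_le_three (by norm_num))
    obtain ⟨n, hn⟩ := exists_out {m, i, j, k} (lt_of_le_of_lt Finset.card_le_four (by norm_num))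
    simp only [Finset.mem_insert, Finset.mem_singleton, not_or] at hm hn
    obtain ⟨hm1, hm2, hm3⟩ := hm
    obtain ⟨hn0, hn1, hn2, hn3⟩ := hn
    have vi := (fp i).2 (.inl rfl)
    have vj := (fp j).2 (.inr rfl)
    have vk := (fn k).2 rfl
    have vm : v m = 0 := by
      have h1 := fp m
      have h2 := fn m
      simp only [hm1, hm2, hm3, or_self, iff_false] at h1 h2
      omega
    have vn : v n = 0 := by
      have h1 := fp n
      have h2 := fn n
      simp only [hn1, hn2, hn3, or_self, iff_false] at h1 h2
      omega
    have ne : ∀ {x y}, v x ≠ v y → x ≠ y := fun hh e => hh (by rw [e])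
    obtain ⟨σ, e0, e1, e2, e3, e4⟩ := exists_perm k i m j n
      (inj5 (ne (by omega)) (ne (by omega)) (ne (by omega)) (ne (by omega)) (ne (by omega)) hij
        (ne (by omega)) (ne (by omega)) (Ne.symm hn0) (ne (by omega)))
    exact Thin.of_perm σ (case21 (h.perm σ) (by simpa [e0] using vk) (by simpa [e1] using vi)
      (by simpa [e2] using vm) (by simpa [e3] using vj) (by simpa [e4] using vn))
  · obtain ⟨i, j, k, hij, hik, hjk, hp⟩ := Finset.card_eq_three.1 hp
    obtain ⟨l, m, hlm, hn⟩ := Finset.card_eq_two.1 hn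
    have fp : ∀ x, 0 < v x ↔ x = i ∨ x = j ∨ x = k := fun x => by
      have := Finset.ext_iff.1 hp x; simpa using this
    have fn : ∀ x, v x < 0 ↔ x = l ∨ x = m := fun x => by
      have := Finset.ext_iff.1 hn x; simpa using this
    have vi := (fp i).2 (.inl rfl)
    have vj := (fp j).2 (.inr (.inl rfl))
    have vk := (fp k).2 (.inr (.inr rfl))
    have vl := (fn l).2 (.inl rfl)
    have vm := (fn m).2 (.inr rfl)
    have ne : ∀ {x y}, v x ≠ v y → x ≠ y := fun hh e => hh (by rw [e])
    obtain ⟨σ, e0, e1, e2, e3, e4⟩ := exists_perm i j k l m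
      (inj5 hij hik (ne (by omega)) (ne (by omega)) hjk (ne (by omega)) (ne (by omega))
        (ne (by omega)) (ne (by omega)) hlm)
    exact Thin.of_perm σ (case32 (h.perm σ) (by simpa [e0] using vi) (by simpa [e1] using vj)
      (by simpa [e2] using vk) (by simpa [e3] using vl) (by simpa [e4] using vm))

lemma uniq_of_span (p : Fin 5 → Fin 3 → ℤ)
    (hdim : affineSpan ℝ (Set.range fun k => toR (p k)) = ⊤)
    (v : Fin 5 → ℤ) (hv : v ≠ 0)
    (hdep : (∑ k, v k • p k) = 0) (hdep1 : (∑ k, v k) = 0)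
    (u : Fin 5 → ℤ) (hu1 : ∑ k, u k = 0) (hu : ∑ k, u k • p k = 0) (i j : Fin 5) :
    v i * u j = v j * u i := by
  let Φ : (Fin 5 → ℝ) →ₗ[ℝ] (Fin 3 → ℝ) × ℝ :=
    (Fintype.linearCombination ℝ (fun k => ((toR (p k), 1) : (Fin 3 → ℝ) × ℝ)))
  have hΦ : ∀ w, Φ w = (∑ k, w k • toR (p k), ∑ k, w k) := by
    intro w
    ext1 <;> simp [Φ, Fintype.linearCombination_apply, Prod.fst_sum, Prod.snd_sum]
  have h1 : ∀ x : Fin 3 → ℝ, (x, (1 : ℝ)) ∈ LinearMap.range Φ := by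
    intro x
    have hx : x ∈ affineSpan ℝ (Set.range fun k => toR (p k)) := by rw [hdim]; trivial
    obtain ⟨w, hw, hxw⟩ := eq_affineCombination_of_mem_affineSpan_of_fintype hx
    refine ⟨w, ?_⟩
    rw [hΦ, hw, hxw, Finset.affineCombination_eq_linear_combination _ _ _ hw]
  have hsurj : LinearMap.range Φ = ⊤ := by
    rw [eq_top_iff]
    rintro ⟨y, t⟩ -
    have : ((y, t) : (Fin 3 → ℝ) × ℝ) = (y, 1) - (1 - t) • (0, 1) := by
      ext <;> simp
    rw [this]
    exact Submodule.sub_mem _ (h1 y) (Submodule.smul_mem _ _ (h1 0))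
  have hrank := LinearMap.finrank_range_add_finrank_ker Φ
  rw [hsurj, finrank_top] at hrank
  simp at hrank
  have hker : Module.finrank ℝ (LinearMap.ker Φ) = 1 := by omega
  have mem : ∀ w : Fin 5 → ℤ, ∑ k, w k = 0 → ∑ k, w k • p k = 0 →
      (fun k => (w k : ℝ)) ∈ LinearMap.ker Φ := by
    intro w h1 h2
    rw [LinearMap.mem_ker, hΦ]
    ext i
    · have := congrFun h2 i
      simp only [Finset.sum_apply, Pi.smul_apply, smul_eq_mul, Pi.zero_apply] at this
      simp only [Finset.sum_apply, Pi.smul_apply, smul_eq_mul, Prod.fst_zero, Pi.zero_apply, toR]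
      exact_mod_cast this
    · simp only [Prod.snd_zero]
      exact_mod_cast h1
  have hv0 : (⟨_, mem v hdep1 hdep⟩ : LinearMap.ker Φ) ≠ 0 := by
    intro h
    apply hv
    ext k
    have := congrFun (congrArg Subtype.val h) k
    simpa using this
  obtain ⟨c, hc⟩ := (finrank_eq_one_iff_of_nonzero' _ hv0).1 hker ⟨_, mem u hu1 hu⟩
  have hc' : ∀ k, c * (v k : ℝ) = u k := fun k => by
    have := congrFun (congrArg Subtype.val hc) k
    simpa using this
  have : (v i : ℝ) * u j = v j * u i := by rw [← hc', ← hc']; ring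
  exact_mod_cast this

lemma emp_of_size (p : Fin 5 → Fin 3 → ℤ)
    (hsize : ∀ z : Fin 3 → ℤ,
      toR z ∈ convexHull ℝ (toR '' Set.range p) → z ∈ Set.range p)
    (z : Fin 3 → ℤ) (w : Fin 5 → ℤ) (hw : ∀ k, 0 ≤ w k) (hpos : 0 < ∑ k, w k)
    (hz : (∑ k, w k) • z = ∑ k, w k • p k) : ∃ k, z = p k := by
  have hn : (0 : ℝ) < ∑ k, (w k : ℝ) := by exact_mod_cast hpos
  have hmem : toR z ∈ convexHull ℝ (toR '' Set.range p) := by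
    have key : toR z = ∑ k, ((w k : ℝ) / ∑ k, (w k : ℝ)) • toR (p k) := by
      ext i
      have := congrFun hz i
      simp only [Finset.sum_apply, Pi.smul_apply, smul_eq_mul] at this
      simp only [Finset.sum_apply, Pi.smul_apply, smul_eq_mul, toR]
      have h2 : (∑ k, (w k : ℝ)) * (z i : ℝ) = ∑ k, (w k : ℝ) * (p k i : ℝ) := by
        exact_mod_cast this
      simp only [div_mul_eq_mul_div]
      rw [← Finset.sum_div, ← h2]
      field_simp
    rw [key]
    refine (convex_convexHull ℝ _).sum_mem ?_ ?_ ?_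
    · intro k _
      have : (0 : ℝ) ≤ w k := by exact_mod_cast hw k
      positivity
    · rw [← Finset.sum_div]; exact div_self hn.ne'
    · intro k _
      exact subset_convexHull ℝ _ ⟨p k, ⟨k, rfl⟩, rfl⟩
  obtain ⟨k, hk⟩ := hsize z hmem
  exact ⟨k, hk.symm⟩

/-- Every lattice 3-polytope of size 5 with signature (2,2), (2,1) or (3,2)
has lattice width one. -/
theorem size_five_signature_two_star_width_one (p : Fin 5 → Fin 3 → ℤ)
    (hinj : Function.Injective p)
    (hdim : affineSpan ℝ (Set.range fun k => toR (p k)) = ⊤)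
    (hsize : ∀ z : Fin 3 → ℤ,
      toR z ∈ convexHull ℝ (toR '' Set.range p) → z ∈ Set.range p)
    (v : Fin 5 → ℤ) (hv : v ≠ 0)
    (hdep : (∑ k, v k • p k) = 0) (hdep1 : (∑ k, v k) = 0)
    (hsig :
      (((Finset.univ.filter fun k => 0 < v k).card,
        (Finset.univ.filter fun k => v k < 0).card) = (2, 2)) ∨
      (((Finset.univ.filter fun k => 0 < v k).card,
        (Finset.univ.filter fun k => v k < 0).card) = (2, 1)) ∨
      (((Finset.univ.filter fun k => 0 < v k).card,
        (Finset.univ.filter fun k => v k < 0).card) = (1, 2)) ∨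
      (((Finset.univ.filter fun k => 0 < v k).card,
        (Finset.univ.filter fun k => v k < 0).card) = (3, 2)) ∨
      (((Finset.univ.filter fun k => 0 < v k).card,
        (Finset.univ.filter fun k => v k < 0).card) = (2, 3))) :
    ∃ (f : Fin 3 → ℤ) (c : ℤ), f ≠ 0 ∧
      ∀ k, dotZ f (p k) = c ∨ dotZ f (p k) = c + 1 := by
  have hcfg : Cfg p v := ⟨emp_of_size p hsize, hdep1, hdep, fun u h1 h2 i j =>
    uniq_of_span p hdim v hv hdep hdep1 u h1 h2 i j⟩
  have hT : Thin p := by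
    simp only [Prod.mk.injEq] at hsig
    rcases hsig with hs | hs | hs | hs | hs
    · exact thin_of_sig hcfg (.inl hs)
    · exact thin_of_sig hcfg (.inr (.inl hs))
    · exact thin_of_sig hcfg.neg (.inr (.inl (by simpa using hs.symm)))
    · exact thin_of_sig hcfg (.inr (.inr hs))
    · exact thin_of_sig hcfg.neg (.inr (.inr (by simpa using hs.symm)))
  obtain ⟨φ, c, h0, h⟩ := hT
  have hφ : ∀ u, dotZ (fun i => φ (Pi.single i 1)) u = φ u := by
    intro u
    rw [LinearMap.pi_apply_eq_sum_univ φ u]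
    simp only [dotZ, smul_eq_mul]
    refine Finset.sum_congr rfl fun i _ => ?_
    rw [mul_comm]
    congr 2
    ext j
    simp [Pi.single_apply, eq_comm]
  refine ⟨fun i => φ (Pi.single i 1), c, ?_, fun k => by rw [hφ]; exact h k⟩
  intro hf
  apply h0
  ext1 i
  ext
  simpa using congrFun hf i
end

section
/- Every lattice 3-polytope of size 5 whose lattice points have signature (3,1) has volume vector of the form (−3q, q, q, q, 0) with q ∈ {1, 3}, i.e., all four nondegenerate subtetrahedra of the five points have the same normalized volume q ∈ {1,3}. -/
/-- The signed normalized volume of the (d+1) points `p ∘ σ` of `ℤ^d`. -/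
def volDet {d n : ℕ} (p : Fin n → Fin d → ℤ) (σ : Fin (d + 1) → Fin n) : ℤ :=
  Matrix.det (Matrix.of fun i j => (Fin.cons 1 (fun i' => p (σ j) i') : Fin (d + 1) → ℤ) i)

/-- Explicit 3 by 3 determinant. -/
def det3 (A B E : Fin 3 → ℤ) : ℤ :=
  A 0 * (B 1 * E 2 - B 2 * E 1) - A 1 * (B 0 * E 2 - B 2 * E 0) + A 2 * (B 0 * E 1 - B 1 * E 0)

/-- The hull of `0, A, B, C, E` has no further lattice points. -/
def HullH (A B C E : Fin 3 → ℤ) : Prop :=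
  ∀ (z : Fin 3 → ℤ) (N i j k l : ℤ), 0 < N → 0 ≤ i → 0 ≤ j → 0 ≤ k → 0 ≤ l → i + j + k + l ≤ N →
    (∀ r, N * z r = i * A r + j * B r + k * C r + l * E r) →
    z = A ∨ z = B ∨ z = C ∨ z = 0 ∨ z = E

theorem indep_of_det (A B E : Fin 3 → ℤ) (hD : det3 A B E ≠ 0) (s t : ℤ)
    (h : ∀ r, s * A r + t * B r = 0) : s = 0 ∧ t = 0 := by
  have h0 := h 0
  have h1 := h 1
  have h2 := h 2
  constructor
  · have : s * det3 A B E = 0 := by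
      unfold det3
      linear_combination (B 1 * E 2 - B 2 * E 1) * h0 - (B 0 * E 2 - B 2 * E 0) * h1
        + (B 0 * E 1 - B 1 * E 0) * h2
    exact (mul_eq_zero.mp this).resolve_right hD
  · have : t * det3 A B E = 0 := by
      unfold det3
      linear_combination (A 2 * E 1 - A 1 * E 2) * h0 - (A 2 * E 0 - A 0 * E 2) * h1
        + (A 1 * E 0 - A 0 * E 1) * h2
    exact (mul_eq_zero.mp this).resolve_right hD

theorem empty_tri (A B : Fin 3 → ℤ)
    (hind : ∀ s t : ℤ, (∀ r, s * A r + t * B r = 0) → s = 0 ∧ t = 0)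
    (hE : ∀ (z : Fin 3 → ℤ) (N i j : ℤ), 0 < N → 0 ≤ i → 0 ≤ j → i + j ≤ N →
      (∀ r, N * z r = i * A r + j * B r) → z = A ∨ z = B ∨ z = 0)
    (z : Fin 3 → ℤ) (N s t : ℤ) (hN : 0 < N) (hz : ∀ r, N * z r = s * A r + t * B r) :
    N ∣ s ∧ N ∣ t := by
  have hs := Int.emod_add_mul_ediv s N
  have ht := Int.emod_add_mul_ediv t N
  have hs0 := Int.emod_nonneg s hN.ne'
  have ht0 := Int.emod_nonneg t hN.ne'
  have hs1 := Int.emod_lt_of_pos s hN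
  have ht1 := Int.emod_lt_of_pos t hN
  rw [Int.dvd_iff_emod_eq_zero, Int.dvd_iff_emod_eq_zero]
  generalize s % N = s0 at *
  generalize t % N = t0 at *
  generalize s / N = s' at *
  generalize t / N = t' at *
  have hz' : ∀ r, N * (z r - s' * A r - t' * B r) = s0 * A r + t0 * B r := by
    intro r
    linear_combination hz r - A r * hs - B r * ht
  by_cases hle : s0 + t0 ≤ N
  · rcases hE (fun r => z r - s' * A r - t' * B r) N s0 t0 hN hs0 ht0 hle hz' with h | h | h
    · have := hind (N - s0) (-t0) (fun r => by
        have := congrFun h r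
        linear_combination hz' r - N * this)
      omega
    · have := hind (- s0) (N - t0) (fun r => by
        have := congrFun h r
        linear_combination hz' r - N * this)
      omega
    · have := hind (- s0) (- t0) (fun r => by
        have := congrFun h r
        simp only [Pi.zero_apply] at this
        linear_combination hz' r - N * this)
      omega
  · rcases hE (fun r => A r + B r - (z r - s' * A r - t' * B r)) N (N - s0) (N - t0) hN (by omega)
      (by omega) (by omega) (fun r => by linear_combination - hz' r) with h | h | h
    · have := hind (s0) (t0 - N) (fun r => by
        have := congrFun h r
        linear_combination -hz' r - N * this)
      omega
    · have := hind (s0 - N) t0 (fun r => by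
        have := congrFun h r
        linear_combination -hz' r - N * this)
      omega
    · have := hind (s0 - N) (t0 - N) (fun r => by
        have := congrFun h r
        simp only [Pi.zero_apply] at this
        linear_combination -hz' r - N * this)
      omega

theorem plane_lattice (A B C E : Fin 3 → ℤ) (H : HullH A B C E) (hD : det3 A B E ≠ 0)
    (α β γ : ℤ) (hα : 0 < α) (hβ : 0 < β) (hγ : 0 < γ)
    (hdep : ∀ r, α * A r + β * B r + γ * C r = 0)
    (z : Fin 3 → ℤ) (N s t : ℤ) (hN : 0 < N) (hz : ∀ r, N * z r = s * A r + t * B r) :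
    N ∣ s ∧ N ∣ t := by
  refine empty_tri A B (indep_of_det A B E hD) ?_ z N s t hN hz
  intro z N i j hN hi hj hij hz
  rcases H z N i j 0 0 hN hi hj le_rfl le_rfl (by omega) (fun r => by rw [hz r]; ring)
    with h | h | h | h | h
  · exact Or.inl h
  · exact Or.inr (Or.inl h)
  · exfalso
    subst h
    have := (indep_of_det A B E hD (i * γ + N * α) (j * γ + N * β) (fun r => by
      linear_combination N * hdep r - γ * hz r)).1
    have h1 := mul_nonneg hi hγ.le
    have h2 := mul_pos hN hα
    omega
  · exact Or.inr (Or.inr h)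
  · exfalso
    subst h
    have : N * det3 A B z = 0 := by
      unfold det3
      linear_combination (A 1 * B 2 - A 2 * B 1) * hz 0 - (A 0 * B 2 - A 2 * B 0) * hz 1
        + (A 0 * B 1 - A 1 * B 0) * hz 2
    rcases mul_eq_zero.mp this with h | h
    · omega
    · exact hD h

theorem HullH.rot {A B C E : Fin 3 → ℤ} (H : HullH A B C E) : HullH B C A E := by
  intro z N i j k l hN hi hj hk hl hs hz
  have := H z N k i j l hN hk hi hj hl (by omega) (fun r => by rw [hz r]; ring)
  tauto

theorem HullH.swap {A B C E : Fin 3 → ℤ} (H : HullH A B C E) : HullH B A C E := by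
  intro z N i j k l hN hi hj hk hl hs hz
  have := H z N j i k l hN hj hi hk hl (by omega) (fun r => by rw [hz r]; ring)
  tauto

theorem weights_eq (A B C E : Fin 3 → ℤ) (H : HullH A B C E) (hD : det3 A B E ≠ 0)
    (α β γ : ℤ) (hα : 0 < α) (hβ : 0 < β) (hγ : 0 < γ)
    (hdep : ∀ r, α * A r + β * B r + γ * C r = 0) :
    ∀ r, A r + B r + C r = 0 := by
  have h1 : γ * det3 B C E = α * det3 A B E := by
    unfold det3
    linear_combination (B 2 * E 1 - B 1 * E 2) * hdep 0 - (B 2 * E 0 - B 0 * E 2) * hdep 1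
      + (B 1 * E 0 - B 0 * E 1) * hdep 2
  have hD1 : det3 B C E ≠ 0 := by
    intro h
    rw [h, mul_zero] at h1
    exact (mul_ne_zero hα.ne' hD) h1.symm
  have a1 := plane_lattice A B C E H hD α β γ hα hβ hγ hdep C γ (-α) (-β) hγ
    (fun r => by linear_combination hdep r)
  have a2 := plane_lattice B C A E H.rot hD1 β γ α hβ hγ hα (fun r => by linear_combination hdep r)
    A α (-β) (-γ) hα (fun r => by linear_combination hdep r)
  have h2 : α * det3 C A E = β * det3 B C E := by
    unfold det3
    linear_combination (C 2 * E 1 - C 1 * E 2) * hdep 0 - (C 2 * E 0 - C 0 * E 2) * hdep 1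
      + (C 1 * E 0 - C 0 * E 1) * hdep 2
  have hD2 : det3 C A E ≠ 0 := by
    intro h
    rw [h, mul_zero] at h2
    exact (mul_ne_zero hβ.ne' hD1) h2.symm
  have a3 := plane_lattice C A B E H.rot.rot hD2 γ α β hγ hα hβ
    (fun r => by linear_combination hdep r)
    B β (-γ) (-α) hβ (fun r => by linear_combination hdep r)
  simp only [dvd_neg] at a1 a2 a3
  have e1 : α = γ := Int.dvd_antisymm hα.le hγ.le a2.2 a1.1
  have e2 : β = γ := Int.dvd_antisymm hβ.le hγ.le a3.1 a1.2
  intro r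
  have := hdep r
  subst e1 e2
  have h : β * (A r + B r + C r) = 0 := by linear_combination this
  exact (mul_eq_zero.mp h).resolve_left hβ.ne'

theorem bezout3 (a b c : ℤ) : ∃ g x y z : ℤ, a * x + b * y + c * z = g ∧ 0 ≤ g ∧ g ∣ a ∧ g ∣ b ∧ g ∣ c := by
  refine ⟨Int.gcd (Int.gcd a b) c, Int.gcdA a b * Int.gcdA (Int.gcd a b) c,
    Int.gcdB a b * Int.gcdA (Int.gcd a b) c, Int.gcdB (Int.gcd a b) c, ?_,
    Int.natCast_nonneg _, ?_, ?_, ?_⟩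
  · have h1 := Int.gcd_eq_gcd_ab a b
    have h2 := Int.gcd_eq_gcd_ab (Int.gcd a b) c
    linear_combination -h2 - Int.gcdA (Int.gcd a b) c * h1
  · exact (Int.gcd_dvd_left _ _).trans (Int.gcd_dvd_left _ _)
  · exact (Int.gcd_dvd_left _ _).trans (Int.gcd_dvd_right _ _)
  · exact Int.gcd_dvd_right _ _

/-- Completion of `A, B` to a lattice basis. -/
theorem exists_basis (A B E : Fin 3 → ℤ) (hD : 0 < det3 A B E)
    (hpl : ∀ (z : Fin 3 → ℤ) (N s t : ℤ), 0 < N → (∀ r, N * z r = s * A r + t * B r) →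
      N ∣ s ∧ N ∣ t) :
    ∃ w : Fin 3 → ℤ, det3 A B w = 1 ∧ ∃ x y : ℤ,
      ∀ r, E r = x * A r + y * B r + det3 A B E * w r := by
  obtain ⟨g, w0, w1, w2, hw, gn, g0, g1, g2⟩ := bezout3 (A 1 * B 2 - A 2 * B 1)
    (A 2 * B 0 - A 0 * B 2) (A 0 * B 1 - A 1 * B 0)
  have hwg : det3 A B ![w0, w1, w2] = g := by
    simp only [det3, Matrix.cons_val]
    linear_combination hw
  generalize ![w0, w1, w2] = w at hwg
  have hdvd : ∀ z, g ∣ det3 A B z := by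
    intro z
    have : det3 A B z = (A 1 * B 2 - A 2 * B 1) * z 0 + (A 2 * B 0 - A 0 * B 2) * z 1 +
      (A 0 * B 1 - A 1 * B 0) * z 2 := by unfold det3; ring
    rw [this]
    exact dvd_add (dvd_add (g0.mul_right _) (g1.mul_right _)) (g2.mul_right _)
  have hrep : ∀ z : Fin 3 → ℤ, ∃ s t k : ℤ, det3 A B z = g * k ∧
      ∀ r, z r = s * A r + t * B r + k * w r := by
    intro z
    obtain ⟨k, hk⟩ := hdvd z
    let z' : Fin 3 → ℤ := fun r => z r - k * w r
    have hz0 : det3 A B z' = 0 := by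
      have : det3 A B z' = det3 A B z - k * det3 A B w := by simp only [det3, z']; ring
      rw [this, hk, hwg]; ring
    have hcr : ∀ r, det3 A B E * z' r = det3 z' B E * A r + det3 A z' E * B r := by
      have : ∀ r, det3 A B E * z' r = det3 z' B E * A r + det3 A z' E * B r + det3 A B z' * E r := by
        intro r
        generalize z' = y
        fin_cases r <;> simp only [det3, Fin.zero_eta, Fin.mk_one, Fin.reduceFinMk] <;> ring
      intro r
      rw [this r, hz0]; ring
    obtain ⟨⟨s, hs⟩, ⟨t, ht⟩⟩ := hpl z' _ _ _ hD hcr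
    refine ⟨s, t, k, hk, fun r => ?_⟩
    have h := hcr r
    rw [hs, ht] at h
    have h2 : det3 A B E * (z' r - s * A r - t * B r) = 0 := by linear_combination h
    have h3 := (mul_eq_zero.mp h2).resolve_left hD.ne'
    simp only [z'] at h3
    linear_combination h3
  have hg : g = 1 := by
    have hgp : g ∣ 1 := by
      choose s t k _ hst using fun i : Fin 3 => hrep (fun r => if i = r then 1 else 0)
      have hmul : (Matrix.of fun i : Fin 3 => ![s i, t i, k i]) * (Matrix.of ![A, B, w]) = 1 := by
        ext i r
        rw [Matrix.mul_apply, Fin.sum_univ_three, Matrix.one_apply]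
        simpa using (hst i r).symm
      have hdet := congrArg Matrix.det hmul
      rw [Matrix.det_mul, Matrix.det_one] at hdet
      have : (Matrix.of ![A, B, w]).det = g := by
        rw [← hwg, Matrix.det_fin_three]
        simp [det3]
        ring
      rw [this] at hdet
      exact ⟨_, by rw [mul_comm]; exact hdet.symm⟩
    rcases Int.isUnit_iff.mp (isUnit_of_dvd_one hgp) with h | h
    · exact h
    · omega
  obtain ⟨s, t, k, hk, hr⟩ := hrep E
  refine ⟨w, by rw [hwg, hg], s, t, ?_⟩
  rw [hk, hg, one_mul]
  exact hr

theorem arith_core (q x y : ℤ) (hq : 0 < q)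
    (h : ∀ k m n : ℤ, 0 < k → k < q → q * m - k * x + (q * n - k * y) ≤ q - k →
      (q * n - k * y) - 2 * (q * m - k * x) ≤ q - k →
      (q * m - k * x) - 2 * (q * n - k * y) ≤ q - k → False) : q = 1 ∨ q = 3 := by
  by_contra hne
  have hs := Int.emod_add_mul_ediv (-x) q
  have ht := Int.emod_add_mul_ediv (-y) q
  have hs0 := Int.emod_nonneg (-x) hq.ne'
  have ht0 := Int.emod_nonneg (-y) hq.ne'
  have hs1 := Int.emod_lt_of_pos (-x) hq
  have ht1 := Int.emod_lt_of_pos (-y) hq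
  generalize (-x) % q = s at *
  generalize (-y) % q = t at *
  generalize (-x) / q = x' at *
  generalize (-y) / q = y' at *
  have e0 := h 1 (-x') (-y') (by omega) (by omega)
  have e1 := h 1 (-x' - 1) (-y') (by omega) (by omega)
  have e2 := h 1 (-x') (-y' - 1) (by omega) (by omega)
  have e3 := h 1 (-x' - 1) (-y' - 1) (by omega) (by omega)
  have X : x = - s - q * x' := by linarith
  have Y : y = - t - q * y' := by linarith
  subst X Y
  have f1 : ∀ a b : ℤ, q * (-a) - 1 * (-b - q * a) = b := by intros; ring
  have f2 : ∀ a b : ℤ, q * (-a - 1) - 1 * (-b - q * a) = b - q := by intros; ring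
  simp only [f1, f2] at e0 e1 e2 e3
  have key : (3 * s = q ∧ 3 * t = 2 * q) ∨ (3 * s = 2 * q ∧ 3 * t = q) := by
    clear h hs ht
    simp only [imp_false, not_le] at e0 e1 e2 e3
    grind
  rcases key with ⟨k1, k2⟩ | ⟨k1, k2⟩
  · have g1 : q * (-3 * x' - 1) - 3 * (-s - q * x') = 0 := by linear_combination k1
    have g2 : q * (-3 * y' - 2) - 3 * (-t - q * y') = 0 := by linear_combination k2
    have := h 3 (-3 * x' - 1) (-3 * y' - 2) (by omega) (by omega)
    rw [g1, g2] at this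
    exact this (by omega) (by omega) (by omega)
  · have g1 : q * (-3 * x' - 2) - 3 * (-s - q * x') = 0 := by linear_combination k1
    have g2 : q * (-3 * y' - 1) - 3 * (-t - q * y') = 0 := by linear_combination k2
    have := h 3 (-3 * x' - 2) (-3 * y' - 1) (by omega) (by omega)
    rw [g1, g2] at this
    exact this (by omega) (by omega) (by omega)

theorem core_pos (A B C E : Fin 3 → ℤ) (H : HullH A B C E) (hD : 0 < det3 A B E)
    (hC : ∀ r, A r + B r + C r = 0) : det3 A B E = 1 ∨ det3 A B E = 3 := by
  obtain ⟨w, hw, x, y, hE⟩ := exists_basis A B E hD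
    (plane_lattice A B C E H hD.ne' 1 1 1 one_pos one_pos one_pos
      (fun r => by linear_combination hC r))
  generalize hq : det3 A B E = q at *
  refine arith_core q x y hD ?_
  intro k m n hk hkq h1 h2 h3
  have hmem : ∃ c : ℤ, 0 ≤ c ∧ 0 ≤ q * m - k * x + c ∧ 0 ≤ q * n - k * y + c ∧
      q * m - k * x + c + (q * n - k * y + c) + c + k ≤ q := by
    generalize q * m - k * x = s at *
    generalize q * n - k * y = t at *
    refine ⟨max 0 (max (-s) (-t)), ?_⟩
    omega
  obtain ⟨c, c0, c1, c2, c3⟩ := hmem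
  have hz : det3 A B (fun r => m * A r + n * B r + k * w r) = k := by
    have : det3 A B (fun r => m * A r + n * B r + k * w r) = k * det3 A B w := by
      simp only [det3]; ring
    rw [this, hw, mul_one]
  have := H (fun r => m * A r + n * B r + k * w r) q _ _ c k hD c1 c2 c0 hk.le c3 (fun r => by
    linear_combination -k * hE r - c * hC r)
  rcases this with h | h | h | h | h <;> rw [h] at hz
  · have : det3 A B A = 0 := by simp only [det3]; ring
    omega
  · have : det3 A B B = 0 := by simp only [det3]; ring
    omega
  · have : det3 A B C = 0 := by
      simp only [det3]
      linear_combination (A 1 * B 2 - A 2 * B 1) * hC 0 - (A 0 * B 2 - A 2 * B 0) * hC 1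
        + (A 0 * B 1 - A 1 * B 0) * hC 2
    omega
  · have : det3 A B 0 = 0 := by simp [det3]
    omega
  · omega

theorem core (A B C E : Fin 3 → ℤ) (H : HullH A B C E) (hD : det3 A B E ≠ 0)
    (hC : ∀ r, A r + B r + C r = 0) : |det3 A B E| = 1 ∨ |det3 A B E| = 3 := by
  rcases lt_or_gt_of_ne hD with h | h
  · have hs : det3 B A E = - det3 A B E := by simp only [det3]; ring
    have := core_pos B A C E H.swap (by omega) (fun r => by linear_combination hC r)
    rw [abs_of_neg h]
    omega
  · rw [abs_of_pos h]
    exact core_pos A B C E H h hC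

theorem volDet_perm (p : Fin 5 → Fin 3 → ℤ) (σ : Equiv.Perm (Fin 5)) (k : Fin 5) :
    |volDet p (Fin.succAbove (σ k))| = |volDet (p ∘ σ) (Fin.succAbove k)| := by
  have hex : ∀ j : Fin 4, ∃ i : Fin 4, (σ k).succAbove i = σ (k.succAbove j) := fun j =>
    Fin.exists_succAbove_eq (fun h => Fin.succAbove_ne k j (σ.injective h))
  choose τ hτ using hex
  have hinj : Function.Injective τ := by
    intro a b hab
    have : σ (k.succAbove a) = σ (k.succAbove b) := by rw [← hτ, ← hτ, hab]
    exact Fin.succAbove_right_injective (σ.injective this)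
  let e : Equiv.Perm (Fin 4) := Equiv.ofBijective τ (Finite.injective_iff_bijective.mp hinj)
  have : volDet (p ∘ σ) (Fin.succAbove k) = Equiv.Perm.sign e * volDet p (Fin.succAbove (σ k)) := by
    unfold volDet
    have hh := Matrix.det_permute' e
      (Matrix.of fun i j => (Fin.cons 1 (fun i' => p ((σ k).succAbove j) i') : Fin (3 + 1) → ℤ) i)
    rw [Int.cast_id] at hh
    rw [← hh]
    congr 1
    ext i j
    simp only [Matrix.of_apply, Matrix.submatrix_apply, Function.comp, id]
    rw [← hτ]
    rfl
  rw [this, abs_mul]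
  rcases Int.units_eq_one_or (Equiv.Perm.sign e) with h | h <;> rw [h] <;> simp

theorem det_ne_zero (p : Fin 5 → Fin 3 → ℤ)
    (hdim : affineSpan ℝ (Set.range fun k => toR (p k)) = ⊤)
    (v0 v1 v2 : ℤ) (h2 : 0 < v2)
    (hdep : ∀ r, v0 * (p 0 r - p 3 r) + v1 * (p 1 r - p 3 r) + v2 * (p 2 r - p 3 r) = 0) :
    det3 (p 0 - p 3) (p 1 - p 3) (p 4 - p 3) ≠ 0 := by
  intro h0
  have hM : (Matrix.of ![p 0 - p 3, p 1 - p 3, p 4 - p 3]).det = 0 := by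
    rw [← h0, Matrix.det_fin_three]
    simp [det3]
    ring
  obtain ⟨n, hn, hmul⟩ := Matrix.exists_mulVec_eq_zero_iff.mpr hM
  have e0 := congrFun hmul 0
  have e1 := congrFun hmul 1
  have e4 := congrFun hmul 2
  simp [Matrix.mulVec, dotProduct, Fin.sum_univ_three] at e0 e1 e4
  have e2 : (p 2 0 - p 3 0) * n 0 + (p 2 1 - p 3 1) * n 1 + (p 2 2 - p 3 2) * n 2 = 0 := by
    have : v2 * ((p 2 0 - p 3 0) * n 0 + (p 2 1 - p 3 1) * n 1 + (p 2 2 - p 3 2) * n 2) = 0 := by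
      linear_combination n 0 * hdep 0 + n 1 * hdep 1 + n 2 * hdep 2 - v0 * e0 - v1 * e1
    exact (mul_eq_zero.mp this).resolve_left h2.ne'
  have hall : ∀ k, p k 0 * n 0 + p k 1 * n 1 + p k 2 * n 2 =
      p 3 0 * n 0 + p 3 1 * n 1 + p 3 2 * n 2 := by
    intro k
    fin_cases k <;> simp only [Fin.zero_eta, Fin.mk_one, Fin.reduceFinMk] <;> linarith
  let L : (Fin 3 → ℝ) →ₗ[ℝ] ℝ := Fintype.linearCombination ℝ (fun i => (n i : ℝ))
  have hL : ∀ x : Fin 3 → ℝ, L x = x 0 * n 0 + x 1 * n 1 + x 2 * n 2 := by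
    intro x
    simp [L, Fintype.linearCombination_apply, Fin.sum_univ_three]
  have hdir : vectorSpan ℝ (Set.range fun k => toR (p k)) = ⊤ := by
    rw [← direction_affineSpan, hdim, AffineSubspace.direction_top]
  have hle : vectorSpan ℝ (Set.range fun k => toR (p k)) ≤ LinearMap.ker L := by
    rw [vectorSpan_def, Submodule.span_le]
    rintro _ ⟨_, ⟨i, rfl⟩, _, ⟨j, rfl⟩, rfl⟩
    have hij := (hall i).trans (hall j).symm
    have hij' : (p i 0 : ℝ) * n 0 + p i 1 * n 1 + p i 2 * n 2 =
      p j 0 * n 0 + p j 1 * n 1 + p j 2 * n 2 := by exact_mod_cast hij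
    simp only [SetLike.mem_coe, LinearMap.mem_ker, hL, vsub_eq_sub, Pi.sub_apply, toR]
    linarith
  rw [hdir] at hle
  apply hn
  ext i
  have := hle (Submodule.mem_top (x := Pi.single i (1 : ℝ)))
  rw [LinearMap.mem_ker, hL] at this
  fin_cases i <;> simpa using this

theorem hull_of_size (p : Fin 5 → Fin 3 → ℤ)
    (hsize : ∀ z : Fin 3 → ℤ,
      toR z ∈ convexHull ℝ (toR '' Set.range p) → z ∈ Set.range p) :
    HullH (p 0 - p 3) (p 1 - p 3) (p 2 - p 3) (p 4 - p 3) := by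
  intro z N i j k l hN hi hj hk hl hs hz
  have hmem : z + p 3 ∈ Set.range p := by
    apply hsize
    have hNR : (0 : ℝ) < N := by exact_mod_cast hN
    let c : Fin 5 → ℝ := ![i / N, j / N, k / N, (N - i - j - k - l : ℤ) / N, l / N]
    have hc0 : ∀ a ∈ Finset.univ, 0 ≤ c a := by
      intro a _
      have h3 : 0 ≤ N - i - j - k - l := by omega
      have hi' : (0 : ℝ) ≤ i := by exact_mod_cast hi
      have hj' : (0 : ℝ) ≤ j := by exact_mod_cast hj
      have hk' : (0 : ℝ) ≤ k := by exact_mod_cast hk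
      have hl' : (0 : ℝ) ≤ l := by exact_mod_cast hl
      have h3' : (0 : ℝ) ≤ (N - i - j - k - l : ℤ) := by exact_mod_cast h3
      fin_cases a
      · exact div_nonneg hi' hNR.le
      · exact div_nonneg hj' hNR.le
      · exact div_nonneg hk' hNR.le
      · exact div_nonneg h3' hNR.le
      · exact div_nonneg hl' hNR.le
    have hc1 : ∑ a, c a = 1 := by
      simp only [Fin.sum_univ_five, c, Matrix.cons_val]
      push_cast
      field_simp
      ring
    have hmemc := (convex_convexHull ℝ (toR '' Set.range p)).sum_mem hc0 hc1
      (z := fun a => toR (p a))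
      (fun a _ => subset_convexHull ℝ _ ⟨p a, ⟨a, rfl⟩, rfl⟩)
    convert hmemc using 1
    ext r
    have hzr : (N : ℝ) * z r = i * (p 0 r - p 3 r) + j * (p 1 r - p 3 r) + k * (p 2 r - p 3 r)
        + l * (p 4 r - p 3 r) := by exact_mod_cast hz r
    simp only [Fin.sum_univ_five, c, Matrix.cons_val, toR, Pi.add_apply, Pi.smul_apply, smul_eq_mul]
    push_cast
    field_simp
    linear_combination hzr
  obtain ⟨a, ha⟩ := hmem
  have hza : z = p a - p 3 := by rw [ha]; simp
  fin_cases a <;> simp at hza <;> tauto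

theorem ordered_case (p : Fin 5 → Fin 3 → ℤ)
    (hdim : affineSpan ℝ (Set.range fun k => toR (p k)) = ⊤)
    (hsize : ∀ z : Fin 3 → ℤ,
      toR z ∈ convexHull ℝ (toR '' Set.range p) → z ∈ Set.range p)
    (v : Fin 5 → ℤ)
    (hdep : (∑ k, v k • p k) = 0) (hdep1 : (∑ k, v k) = 0)
    (h0 : 0 < v 0) (h1 : 0 < v 1) (h2 : 0 < v 2) (h4 : v 4 = 0) :
    ∃ q : ℤ, (q = 1 ∨ q = 3) ∧
      (Finset.univ.val.map fun k : Fin 5 => |volDet p (Fin.succAbove k)|)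
        = ({3 * q, q, q, q, 0} : Multiset ℤ) := by
  have hd : ∀ r, v 0 * (p 0 - p 3) r + v 1 * (p 1 - p 3) r + v 2 * (p 2 - p 3) r = 0 := by
    intro r
    have h := congrFun hdep r
    simp [Fin.sum_univ_five, h4] at h hdep1
    simp only [Pi.sub_apply]
    linear_combination h - p 3 r * hdep1
  have hD := det_ne_zero p hdim (v 0) (v 1) (v 2) h2 (by simpa using hd)
  have H := hull_of_size p hsize
  have hC := weights_eq _ _ _ _ H hD _ _ _ h0 h1 h2 hd
  have hq := core _ _ _ _ H hD hC
  refine ⟨_, hq, ?_⟩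
  have hP : p 2 = fun r => 3 * p 3 r - p 0 r - p 1 r := by
    ext r
    have := hC r
    simp only [Pi.sub_apply] at this
    linarith
  have s00 : (0 : Fin 5).succAbove = ![1, 2, 3, 4] := by decide
  have s11 : (1 : Fin 5).succAbove = ![0, 2, 3, 4] := by decide
  have s22 : (2 : Fin 5).succAbove = ![0, 1, 3, 4] := by decide
  have s33 : (3 : Fin 5).succAbove = ![0, 1, 2, 4] := by decide
  have s44 : (4 : Fin 5).succAbove = ![0, 1, 2, 3] := by decide
  have expand : ∀ a b c d : Fin 5, volDet p ![a, b, c, d] =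
      det3 (p b - p a) (p c - p a) (p d - p a) := by
    intro a b c d
    unfold volDet
    have hm : (Matrix.of fun i j => (Fin.cons 1 (fun i' => p (![a, b, c, d] j) i') :
        Fin (3 + 1) → ℤ) i) = !![1, 1, 1, 1; p a 0, p b 0, p c 0, p d 0;
          p a 1, p b 1, p c 1, p d 1; p a 2, p b 2, p c 2, p d 2] := by
      ext i j
      fin_cases i <;> fin_cases j <;> rfl
    rw [hm, Matrix.det_succ_row_zero]
    simp only [Fin.sum_univ_four, Matrix.det_fin_three]
    simp [det3, Fin.succAbove]
    ring
  have f0 : volDet p (Fin.succAbove 0) = det3 (p 0 - p 3) (p 1 - p 3) (p 4 - p 3) := by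
    rw [s00, expand, hP]; simp only [det3, Pi.sub_apply]; ring
  have f1 : volDet p (Fin.succAbove 1) = - det3 (p 0 - p 3) (p 1 - p 3) (p 4 - p 3) := by
    rw [s11, expand, hP]; simp only [det3, Pi.sub_apply]; ring
  have f2 : volDet p (Fin.succAbove 2) = det3 (p 0 - p 3) (p 1 - p 3) (p 4 - p 3) := by
    rw [s22, expand]; simp only [det3, Pi.sub_apply]; ring
  have f3 : volDet p (Fin.succAbove 3) = 3 * det3 (p 0 - p 3) (p 1 - p 3) (p 4 - p 3) := by
    rw [s33, expand, hP]; simp only [det3, Pi.sub_apply]; ring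
  have f4 : volDet p (Fin.succAbove 4) = 0 := by
    rw [s44, expand, hP]; simp only [det3, Pi.sub_apply]; ring
  have hu : (Finset.univ : Finset (Fin 5)).val = {3, 0, 1, 2, 4} := by decide
  rw [hu]
  simp only [Multiset.insert_eq_cons, Multiset.map_cons, Multiset.map_singleton, f0, f1, f2, f3, f4,
    abs_neg, abs_mul, abs_zero]
  rfl

theorem exists_perm_s15 (v : Fin 5 → ℤ)
    (hp : (Finset.univ.filter fun k => 0 < v k).card = 3)
    (hn : (Finset.univ.filter fun k => v k < 0).card = 1) :
    ∃ σ : Equiv.Perm (Fin 5), 0 < v (σ 0) ∧ 0 < v (σ 1) ∧ 0 < v (σ 2) ∧ v (σ 4) = 0 := by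
  obtain ⟨a, b, c, hab, hac, hbc, hs⟩ := Finset.card_eq_three.mp hp
  obtain ⟨d, hd⟩ := Finset.card_eq_one.mp hn
  have hm : ∀ x, 0 < v x ↔ x = a ∨ x = b ∨ x = c := by
    intro x
    have := Finset.ext_iff.mp hs x
    simpa using this
  have hm2 : ∀ x, v x < 0 ↔ x = d := by
    intro x
    have := Finset.ext_iff.mp hd x
    simpa using this
  have ha := (hm a).2 (by tauto)
  have hb := (hm b).2 (by tauto)
  have hc := (hm c).2 (by tauto)
  have hdd := (hm2 d).2 rfl
  have hex : ∃ e : Fin 5, e ∉ ({a, b, c, d} : Finset (Fin 5)) := by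
    by_contra hcon
    push Not at hcon
    have h1 := Finset.card_le_card (fun x _ => hcon x : (Finset.univ : Finset (Fin 5)) ⊆ _)
    have h2 := Finset.card_le_four (a := a) (b := b) (c := c) (d := d)
    simp at h1
    omega
  obtain ⟨e, he⟩ := hex
  simp at he
  have hinj : Function.Injective ![a, b, c, d, e] := by
    have had : a ≠ d := by rintro rfl; omega
    have hbd : b ≠ d := by rintro rfl; omega
    have hcd : c ≠ d := by rintro rfl; omega
    obtain ⟨n1, n2, n3, n4⟩ := he
    intro i j hij
    fin_cases i <;> fin_cases j <;> simp at hij ⊢ <;> first | exact absurd hij (by assumption) | exact absurd hij.symm (by assumption)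
  refine ⟨Equiv.ofBijective _ (Finite.injective_iff_bijective.mp hinj), ha, hb, hc, ?_⟩
  change v e = 0
  have h1 := (hm e).not.2 (by tauto)
  have h2 := (hm2 e).not.2 (by tauto)
  omega

theorem pos_case (p : Fin 5 → Fin 3 → ℤ)
    (hdim : affineSpan ℝ (Set.range fun k => toR (p k)) = ⊤)
    (hsize : ∀ z : Fin 3 → ℤ,
      toR z ∈ convexHull ℝ (toR '' Set.range p) → z ∈ Set.range p)
    (v : Fin 5 → ℤ)
    (hdep : (∑ k, v k • p k) = 0) (hdep1 : (∑ k, v k) = 0)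
    (hp : (Finset.univ.filter fun k => 0 < v k).card = 3)
    (hn : (Finset.univ.filter fun k => v k < 0).card = 1) :
    ∃ q : ℤ, (q = 1 ∨ q = 3) ∧
      (Finset.univ.val.map fun k : Fin 5 => |volDet p (Fin.succAbove k)|)
        = ({3 * q, q, q, q, 0} : Multiset ℤ) := by
  obtain ⟨σ, h0, h1, h2, h4⟩ := exists_perm_s15 v hp hn
  have hr : Set.range (p ∘ σ) = Set.range p := σ.surjective.range_comp p
  have hr2 : (Set.range fun k => toR ((p ∘ σ) k)) = Set.range fun k => toR (p k) :=
    σ.surjective.range_comp (fun k => toR (p k))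
  obtain ⟨q, hq, hm⟩ := ordered_case (p ∘ σ) (by rw [hr2]; exact hdim) (by rw [hr]; exact hsize)
    (v ∘ σ) (by rw [← hdep]; exact Equiv.sum_comp σ (fun k => v k • p k))
    (by rw [← hdep1]; exact Equiv.sum_comp σ v) h0 h1 h2 h4
  refine ⟨q, hq, ?_⟩
  rw [← hm]
  simp only [← volDet_perm]
  have : (Finset.univ : Finset (Fin 5)).val.map σ = Finset.univ.val := by
    have := congrArg Finset.val (Finset.map_univ_equiv σ)
    simpa using this
  conv_lhs => rw [← this]
  rw [Multiset.map_map]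
  rfl

/-- Every lattice 3-polytope of size 5 whose lattice points have signature (3,1)
has volume vector (−3q,q,q,q,0) (up to order and signs) with q ∈ {1,3}. -/
theorem size_five_signature_31_volume_vector (p : Fin 5 → Fin 3 → ℤ)
    (hinj : Function.Injective p)
    (hdim : affineSpan ℝ (Set.range fun k => toR (p k)) = ⊤)
    (hsize : ∀ z : Fin 3 → ℤ,
      toR z ∈ convexHull ℝ (toR '' Set.range p) → z ∈ Set.range p)
    (v : Fin 5 → ℤ) (hv : v ≠ 0)
    (hdep : (∑ k, v k • p k) = 0) (hdep1 : (∑ k, v k) = 0)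
    (hsig :
      (((Finset.univ.filter fun k => 0 < v k).card,
        (Finset.univ.filter fun k => v k < 0).card) = (3, 1)) ∨
      (((Finset.univ.filter fun k => 0 < v k).card,
        (Finset.univ.filter fun k => v k < 0).card) = (1, 3))) :
    ∃ q : ℤ, (q = 1 ∨ q = 3) ∧
      (Finset.univ.val.map fun k : Fin 5 => |volDet p (Fin.succAbove k)|)
        = ({3 * q, q, q, q, 0} : Multiset ℤ) := by
  rcases hsig with h | h
  · simp only [Prod.mk.injEq] at h
    exact pos_case p hdim hsize v hdep hdep1 h.1 h.2
  · simp only [Prod.mk.injEq] at h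
    refine pos_case p hdim hsize (-v) ?_ ?_ ?_ ?_
    · simpa using hdep
    · simpa using hdep1
    · simpa using h.2
    · simpa using h.1
end

section
/- Up to unimodular equivalence, the lattice 3-polytopes of size 5 and lattice width one with exactly 4 lattice points on one lattice plane are exactly: conv{(0,0,0),(1,0,0),(0,1,0),(1,1,0),(0,0,1)} and conv{(0,0,0),(1,0,0),(0,1,0),(−1,−1,0),(0,0,1)} and conv{(0,0,0),(1,0,0),(−1,0,0),(0,1,0),(0,0,1)}; moreover no two of these three are unimodularly equivalent. -/
/-- Unimodular equivalence of lattice point configurations in ℤ³. -/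
def UEquiv (S T : Set (Fin 3 → ℤ)) : Prop :=
  ∃ (A : Matrix (Fin 3) (Fin 3) ℤ) (b : Fin 3 → ℤ), IsUnit A.det ∧
    (fun x => A.mulVec x + b) '' S = T

/-- `p` lists the lattice points of a lattice 3-polytope of size 5 and width one
having exactly 4 lattice points on one lattice plane. -/
def GoodFive (p : Fin 5 → Fin 3 → ℤ) : Prop :=
  Function.Injective p ∧
  affineSpan ℝ (Set.range fun k => toR (p k)) = ⊤ ∧
  (∀ z : Fin 3 → ℤ,
    toR z ∈ convexHull ℝ (toR '' Set.range p) → z ∈ Set.range p) ∧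
  ∃ f : Fin 3 → ℤ, f ≠ 0 ∧ ∃ c : ℤ,
    (Finset.univ.filter fun k => dotZ f (p k) = c).card = 4 ∧
    ∀ k, dotZ f (p k) = c ∨ dotZ f (p k) = c + 1

/-- The determinant of three integer vectors. -/
def dt (u v w : Fin 3 → ℤ) : ℤ :=
  u 0 * (v 1 * w 2 - v 2 * w 1) - u 1 * (v 0 * w 2 - v 2 * w 0) + u 2 * (v 0 * w 1 - v 1 * w 0)

lemma dotZ_eq (f p : Fin 3 → ℤ) : dotZ f p = f 0 * p 0 + f 1 * p 1 + f 2 * p 2 := by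
  simp [dotZ, Fin.sum_univ_three]

lemma cramer (u v w x : Fin 3 → ℤ) (i : Fin 3) :
    dt u v w * x i = dt x v w * u i + dt u x w * v i + dt u v x * w i := by
  fin_cases i <;> simp [dt] <;> ring

lemma dvd_unit (u v w : Fin 3 → ℤ) (hD : dt u v w ≠ 0)
    (h : ∀ x, dt u v w ∣ dt x v w ∧ dt u v w ∣ dt u x w ∧ dt u v w ∣ dt u v x) :
    IsUnit (dt u v w) := by
  have h1 := h ![1, 0, 0]
  have h2 := h ![0, 1, 0]
  have h3 := h ![0, 0, 1]
  obtain ⟨⟨a1, ha1⟩, ⟨b1, hb1⟩, ⟨c1, hc1⟩⟩ := h1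
  obtain ⟨⟨a2, ha2⟩, ⟨b2, hb2⟩, ⟨c2, hc2⟩⟩ := h2
  obtain ⟨⟨a3, ha3⟩, ⟨b3, hb3⟩, ⟨c3, hc3⟩⟩ := h3
  have key : dt u v w ^ 2 = dt
      ![dt ![1, 0, 0] v w, dt ![0, 1, 0] v w, dt ![0, 0, 1] v w]
      ![dt u ![1, 0, 0] w, dt u ![0, 1, 0] w, dt u ![0, 0, 1] w]
      ![dt u v ![1, 0, 0], dt u v ![0, 1, 0], dt u v ![0, 0, 1]] := by
    simp [dt]; ring
  rw [ha1, ha2, ha3, hb1, hb2, hb3, hc1, hc2, hc3] at key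
  generalize dt u v w = D at *
  have k2 : D ^ 2 * 1 = D ^ 2 * (D * dt ![a1, a2, a3] ![b1, b2, b3] ![c1, c2, c3]) := by
    rw [mul_one]; refine key.trans ?_; simp [dt]; ring
  have := mul_left_cancel₀ (pow_ne_zero 2 hD) k2
  exact IsUnit.of_mul_eq_one _ this.symm

lemma exists_pt (u v w f : Fin 3 → ℤ) (fu : dotZ f u = -1) (fv : dotZ f v = -1)
    (fw : dotZ f w = -1) (hD : dt u v w ≠ 0) (hU : ¬ IsUnit (dt u v w)) :
    ∃ (y : Fin 3 → ℤ) (r1 r2 r3 : ℤ), (0 ≤ r1 ∧ r1 < |dt u v w|) ∧ (0 ≤ r2 ∧ r2 < |dt u v w|) ∧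
      (0 ≤ r3 ∧ r3 < |dt u v w|) ∧ r1 + r2 + r3 = |dt u v w| ∧
      ∀ i, |dt u v w| * y i = r1 * u i + r2 * v i + r3 * w i := by
  obtain ⟨x, hx⟩ : ∃ x, ¬ (dt u v w ∣ dt x v w ∧ dt u v w ∣ dt u x w ∧ dt u v w ∣ dt u v x) := by
    by_contra hc
    push Not at hc
    exact hU (dvd_unit u v w hD hc)
  obtain ⟨n, α, β, γ, hn, hn0, hnd, hc⟩ : ∃ n α β γ : ℤ, n = |dt u v w| ∧ 0 < n ∧
      ¬ (n ∣ α ∧ n ∣ β ∧ n ∣ γ) ∧ ∀ i, n * x i = α * u i + β * v i + γ * w i := by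
    rcases lt_or_gt_of_ne hD with h | h
    · refine ⟨-dt u v w, -dt x v w, -dt u x w, -dt u v x, (abs_of_neg h).symm, by omega, ?_, ?_⟩
      · simpa only [neg_dvd, dvd_neg] using hx
      · intro i; linear_combination -cramer u v w x i
    · exact ⟨dt u v w, dt x v w, dt u x w, dt u v x, (abs_of_pos h).symm, h, hx,
        fun i => cramer u v w x i⟩
  rw [← hn]
  have hfx : n * dotZ f x = -(α + β + γ) := by
    rw [dotZ_eq] at *
    linear_combination f 0 * hc 0 + f 1 * hc 1 + f 2 * hc 2 + α * fu + β * fv + γ * fw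
  have e1 := Int.emod_add_mul_ediv α n
  have e2 := Int.emod_add_mul_ediv β n
  have e3 := Int.emod_add_mul_ediv γ n
  have l1 := Int.emod_nonneg α hn0.ne'
  have l2 := Int.emod_nonneg β hn0.ne'
  have l3 := Int.emod_nonneg γ hn0.ne'
  have m1 := Int.emod_lt_of_pos α hn0
  have m2 := Int.emod_lt_of_pos β hn0
  have m3 := Int.emod_lt_of_pos γ hn0
  have hnz : ¬ (α % n = 0 ∧ β % n = 0 ∧ γ % n = 0) := by
    rintro ⟨h1, h2, h3⟩
    exact hnd ⟨Int.dvd_of_emod_eq_zero h1, Int.dvd_of_emod_eq_zero h2, Int.dvd_of_emod_eq_zero h3⟩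
  generalize α % n = r1 at *
  generalize β % n = r2 at *
  generalize γ % n = r3 at *
  generalize α / n = q1 at *
  generalize β / n = q2 at *
  generalize γ / n = q3 at *
  have hk : r1 + r2 + r3 = n * (-(dotZ f x) - q1 - q2 - q3) := by
    linear_combination e1 + e2 + e3 + hfx
  generalize -(dotZ f x) - q1 - q2 - q3 = k at hk
  have k0 : 0 < k := by
    by_contra hh
    have : r1 + r2 + r3 ≤ 0 := by rw [hk]; nlinarith
    omega
  have k3 : k < 3 := by
    by_contra hh
    have : 3 * n ≤ r1 + r2 + r3 := by rw [hk]; nlinarith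
    omega
  have hy : ∀ i, n * (x i - q1 * u i - q2 * v i - q3 * w i) = r1 * u i + r2 * v i + r3 * w i := by
    intro i
    linear_combination hc i - u i * e1 - v i * e2 - w i * e3
  obtain rfl | rfl : k = 1 ∨ k = 2 := by omega
  · exact ⟨fun i => x i - q1 * u i - q2 * v i - q3 * w i, r1, r2, r3, ⟨l1, m1⟩, ⟨l2, m2⟩, ⟨l3, m3⟩,
      by omega, hy⟩
  · refine ⟨fun i => u i + v i + w i - (x i - q1 * u i - q2 * v i - q3 * w i),
      n - r1, n - r2, n - r3, by omega, by omega, by omega, by omega, ?_⟩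
    intro i
    linear_combination - hy i

/-- Closure of the configuration under lattice points in the hull of `a,b,c,d`. -/
def Cl4 (a b c d e : Fin 3 → ℤ) : Prop :=
  ∀ (z : Fin 3 → ℤ) (w1 w2 w3 w4 : ℤ), 0 ≤ w1 → 0 ≤ w2 → 0 ≤ w3 → 0 ≤ w4 →
    0 < w1 + w2 + w3 + w4 →
    (∀ i, (w1 + w2 + w3 + w4) * z i = w1 * a i + w2 * b i + w3 * c i + w4 * d i) →
    z ∈ ({a, b, c, d, e} : Set (Fin 3 → ℤ))

lemma det_unit (a b c d e f : Fin 3 → ℤ) (fu : dotZ f (a - e) = -1) (fv : dotZ f (b - e) = -1)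
    (fw : dotZ f (c - e) = -1) (hD : dt (a - e) (b - e) (c - e) ≠ 0)
    (hcl : Cl4 a b c d e)
    (m1 : dt (d - e) (b - e) (c - e) ≠ 0 →
      |dt (a - e) (b - e) (c - e)| ≤ |dt (d - e) (b - e) (c - e)|)
    (m2 : dt (a - e) (d - e) (c - e) ≠ 0 →
      |dt (a - e) (b - e) (c - e)| ≤ |dt (a - e) (d - e) (c - e)|)
    (m3 : dt (a - e) (b - e) (d - e) ≠ 0 →
      |dt (a - e) (b - e) (c - e)| ≤ |dt (a - e) (b - e) (d - e)|) :
    IsUnit (dt (a - e) (b - e) (c - e)) := by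
  by_contra hU
  obtain ⟨y, r1, r2, r3, ⟨l1, u1⟩, ⟨l2, u2⟩, ⟨l3, u3⟩, hs, hy⟩ :=
    exists_pt _ _ _ f fu fv fw hD hU
  have hpos := abs_pos.mpr hD
  have hz := hcl (y + e) r1 r2 r3 0 l1 l2 l3 le_rfl (by omega) (by
    intro i
    have := hy i
    simp only [Pi.sub_apply, Pi.add_apply] at this ⊢
    rw [← hs] at this
    linear_combination this)
  have key : ∀ z : Fin 3 → ℤ, y + e = z →
      |dt (z - e) (b - e) (c - e)| = r1 ∧ |dt (a - e) (z - e) (c - e)| = r2 ∧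
      |dt (a - e) (b - e) (z - e)| = r3 := by
    rintro z rfl
    rw [add_sub_cancel_right]
    generalize a - e = u at *
    generalize b - e = v at *
    generalize c - e = w at *
    have c1 : |dt u v w| * dt y v w = r1 * dt u v w := by
      have h0 := hy 0; have h1 := hy 1; have h2 := hy 2
      generalize |dt u v w| = n at *
      simp only [dt]
      linear_combination (v 1 * w 2 - v 2 * w 1) * h0 - (v 0 * w 2 - v 2 * w 0) * h1
        + (v 0 * w 1 - v 1 * w 0) * h2
    have c2 : |dt u v w| * dt u y w = r2 * dt u v w := by
      have h0 := hy 0; have h1 := hy 1; have h2 := hy 2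
      generalize |dt u v w| = n at *
      simp only [dt]
      linear_combination -(u 1 * w 2 - u 2 * w 1) * h0 + (u 0 * w 2 - u 2 * w 0) * h1
        - (u 0 * w 1 - u 1 * w 0) * h2
    have c3 : |dt u v w| * dt u v y = r3 * dt u v w := by
      have h0 := hy 0; have h1 := hy 1; have h2 := hy 2
      generalize |dt u v w| = n at *
      simp only [dt]
      linear_combination (u 1 * v 2 - u 2 * v 1) * h0 - (u 0 * v 2 - u 2 * v 0) * h1
        + (u 0 * v 1 - u 1 * v 0) * h2
    have fin : ∀ t r : ℤ, 0 ≤ r → |dt u v w| * t = r * dt u v w → |t| = r := by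
      intro t r hr h
      have := congrArg abs h
      rw [abs_mul, abs_mul, abs_abs, abs_of_nonneg hr, mul_comm] at this
      exact mul_right_cancel₀ hpos.ne' this
    exact ⟨fin _ _ l1 c1, fin _ _ l2 c2, fin _ _ l3 c3⟩
  rcases hz with h | h | h | h | h
  · have := (key _ h).1
    omega
  · have := (key _ h).2.1
    omega
  · have := (key _ h).2.2
    omega
  · obtain ⟨h1, h2, h3⟩ := key _ h
    have q1 : r1 = 0 := by
      by_contra hr
      have := m1 (by rw [← abs_pos]; omega)
      omega
    have q2 : r2 = 0 := by
      by_contra hr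
      have := m2 (by rw [← abs_pos]; omega)
      omega
    have q3 : r3 = 0 := by
      by_contra hr
      have := m3 (by rw [← abs_pos]; omega)
      omega
    omega
  · obtain ⟨h1, h2, h3⟩ := key _ h
    have z1 : dt (e - e) (b - e) (c - e) = 0 := by simp [dt]
    have z2 : dt (a - e) (e - e) (c - e) = 0 := by simp [dt]
    have z3 : dt (a - e) (b - e) (e - e) = 0 := by simp [dt]
    rw [z1, abs_zero] at h1
    rw [z2, abs_zero] at h2
    rw [z3, abs_zero] at h3
    omega

/-- The adjugate-type formula gives the affine map. -/
lemma uequiv_of (a b c d e : Fin 3 → ℤ) (α β γ : ℤ) (hU : IsUnit (dt (a - e) (b - e) (c - e)))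
    (hs : α + β + γ = 1) (hd : ∀ i, d i = α * a i + β * b i + γ * c i)
    (d' : Fin 3 → ℤ) (hd0 : d' 0 = β) (hd1 : d' 1 = γ) (hd2 : d' 2 = 0) :
    UEquiv {a, b, c, d, e} {![0,0,0], ![1,0,0], ![0,1,0], d', ![0,0,1]} := by
  set M : Matrix (Fin 3) (Fin 3) ℤ := !![b 0 - a 0, c 0 - a 0, e 0 - a 0;
    b 1 - a 1, c 1 - a 1, e 1 - a 1; b 2 - a 2, c 2 - a 2, e 2 - a 2] with hM
  have hdet : IsUnit M.det := by
    have : M.det = - dt (a - e) (b - e) (c - e) := by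
      rw [Matrix.det_fin_three]; simp [hM, dt]; ring
    rw [this]; exact hU.neg
  have hinv : M⁻¹ * M = 1 := Matrix.nonsing_inv_mul _ hdet
  have hx : ∀ x y : Fin 3 → ℤ, M.mulVec y = x - a → M⁻¹.mulVec x + -M⁻¹.mulVec a = y := by
    intro x y h
    rw [← sub_eq_add_neg, ← Matrix.mulVec_sub, ← h, Matrix.mulVec_mulVec, hinv, Matrix.one_mulVec]
  refine ⟨M⁻¹, -M⁻¹.mulVec a, ?_, ?_⟩
  · rw [Matrix.isUnit_nonsing_inv_det_iff]; exact hdet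
  · simp only [Set.image_insert_eq, Set.image_singleton]
    rw [hx a ![0,0,0], hx b ![1,0,0], hx c ![0,1,0], hx d d', hx e ![0,0,1]]
    · ext i; fin_cases i <;> simp [hM, Matrix.mulVec, dotProduct, Fin.sum_univ_three]
    · ext i
      have := hd i
      fin_cases i <;> simp [hM, Matrix.mulVec, dotProduct, Fin.sum_univ_three, hd0, hd1, hd2] at * <;>
        linear_combination -this - (a _) * hs
    · ext i; fin_cases i <;> simp [hM, Matrix.mulVec, dotProduct, Fin.sum_univ_three]
    · ext i; fin_cases i <;> simp [hM, Matrix.mulVec, dotProduct, Fin.sum_univ_three]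
    · ext i; fin_cases i <;> simp [hM, Matrix.mulVec, dotProduct, Fin.sum_univ_three]

/-- Equivalent to one of the three configurations. -/
def Concl (S : Set (Fin 3 → ℤ)) : Prop :=
  UEquiv S {![0,0,0], ![1,0,0], ![0,1,0], ![1,1,0], ![0,0,1]} ∨
  UEquiv S {![0,0,0], ![1,0,0], ![0,1,0], ![-1,-1,0], ![0,0,1]} ∨
  UEquiv S {![0,0,0], ![1,0,0], ![-1,0,0], ![0,1,0], ![0,0,1]}

lemma sorted_case (a b c d e : Fin 3 → ℤ) (α β γ : ℤ) (hU : IsUnit (dt (a - e) (b - e) (c - e)))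
    (hs : α + β + γ = 1) (hd : ∀ i, d i = α * a i + β * b i + γ * c i)
    (hcl : Cl4 a b c d e) (hab : β ≤ α) (hbc : γ ≤ β)
    (hda : d ≠ a) : Concl {a, b, c, d, e} := by
  have hD0 : dt (a - e) (b - e) (c - e) ≠ 0 := hU.ne_zero
  -- barycentric coordinates are unique
  have bary : ∀ (z : Fin 3 → ℤ) (x y t : ℤ), x + y + t = 1 →
      (∀ i, z i = x * a i + y * b i + t * c i) →
      dt (z - e) (b - e) (c - e) = x * dt (a - e) (b - e) (c - e) ∧
      dt (a - e) (z - e) (c - e) = y * dt (a - e) (b - e) (c - e) ∧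
      dt (a - e) (b - e) (z - e) = t * dt (a - e) (b - e) (c - e) := by
    intro z x y t h1 h
    obtain rfl : x = 1 - y - t := by omega
    simp only [dt, Pi.sub_apply, h]
    refine ⟨by ring, by ring, by ring⟩
  have cl : ∀ x y t w1 w2 w3 N : ℤ, x + y + t = 1 → 0 ≤ w1 → 0 ≤ w2 → 0 ≤ w3 → 0 < N →
      N = w1 + w2 + w3 + 1 → N * x = w1 + α → N * y = w2 + β → N * t = w3 + γ →
      (x = 1 ∧ y = 0 ∧ t = 0) ∨ (x = 0 ∧ y = 1 ∧ t = 0) ∨ (x = 0 ∧ y = 0 ∧ t = 1) ∨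
      (x = α ∧ y = β ∧ t = γ) := by
    intro x y t w1 w2 w3 N h1 p1 p2 p3 hN hN' e1 e2 e3
    have hz := hcl (fun i => x * a i + y * b i + t * c i) w1 w2 w3 1 p1 p2 p3 zero_le_one
      (by omega) (by
        intro i
        rw [← hN', hd i]
        linear_combination a i * e1 + b i * e2 + c i * e3)
    obtain ⟨b1, b2, b3⟩ := bary _ x y t h1 (fun i => rfl)
    have uniq : ∀ (z : Fin 3 → ℤ) (x' y' t' : ℤ), x' + y' + t' = 1 →
        (∀ i, z i = x' * a i + y' * b i + t' * c i) →
        (fun i => x * a i + y * b i + t * c i) = z → x = x' ∧ y = y' ∧ t = t' := by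
      intro z x' y' t' h' hz' hzz
      obtain ⟨b1', b2', b3'⟩ := bary z x' y' t' h' hz'
      rw [hzz] at b1 b2 b3
      exact ⟨mul_right_cancel₀ hD0 (b1.symm.trans b1'), mul_right_cancel₀ hD0 (b2.symm.trans b2'),
        mul_right_cancel₀ hD0 (b3.symm.trans b3')⟩
    rcases hz with h | h | h | h | h
    · exact Or.inl (uniq a 1 0 0 (by norm_num) (by intro i; ring) h)
    · exact Or.inr (Or.inl (uniq b 0 1 0 (by norm_num) (by intro i; ring) h))
    · exact Or.inr (Or.inr (Or.inl (uniq c 0 0 1 (by norm_num) (by intro i; ring) h)))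
    · exact Or.inr (Or.inr (Or.inr (uniq d α β γ hs hd h)))
    · exfalso
      rw [h] at b1 b2 b3
      have z1 : dt (e - e) (b - e) (c - e) = 0 := by simp [dt]
      have z2 : dt (a - e) (e - e) (c - e) = 0 := by simp [dt]
      have z3 : dt (a - e) (b - e) (e - e) = 0 := by simp [dt]
      have y1 := (mul_eq_zero.mp (b1.symm.trans z1)).resolve_right hD0
      have y2 := (mul_eq_zero.mp (b2.symm.trans z2)).resolve_right hD0
      have y3 := (mul_eq_zero.mp (b3.symm.trans z3)).resolve_right hD0
      omega
  have hγ : γ ≤ -1 := by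
    by_contra hh
    have : α = 1 ∧ β = 0 ∧ γ = 0 := by omega
    apply hda
    ext i
    rw [hd i, this.1, this.2.1, this.2.2]; ring
  rcases lt_trichotomy β 0 with hb | hb | hb
  · rcases eq_or_lt_of_le hbc with h | h
    · have := cl 3 (-1) (-1) (-β - 1) 0 0 (-β) (by omega) (by omega) (by omega) (by omega)
        (by omega) (by omega) (by omega) (by omega) (by omega)
      have h3 : α = 3 ∧ β = -1 ∧ γ = -1 := by omega
      right; left
      exact uequiv_of a b c d e α β γ hU hs hd _ (by simp [h3]) (by simp [h3]) (by simp)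
    · have := cl 2 0 (-1) (-γ - 1 + β) (-β) 0 (-γ) (by omega) (by omega) (by omega) (by omega)
        (by omega) (by omega) (by omega) (by omega) (by omega)
      omega
  · have := cl 2 0 (-1) (α - 2) 0 0 (α - 1) (by omega) (by omega) (by omega) (by omega)
        (by omega) (by omega) (by omega) (by omega) (by omega)
    have h3 : α = 2 ∧ β = 0 ∧ γ = -1 := by omega
    right; right
    have hU' : IsUnit (dt (a - e) (c - e) (b - e)) := by
      have : dt (a - e) (c - e) (b - e) = - dt (a - e) (b - e) (c - e) := by simp [dt]; ring
      rw [this]; exact hU.neg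
    have := uequiv_of a c b d e α γ β hU' (by omega) (by intro i; rw [hd i]; ring) ![-1, 0, 0]
      (by simp [h3]) (by simp [h3]) (by simp)
    convert this using 1
    · ext; simp only [Set.mem_insert_iff, Set.mem_singleton_iff]; tauto
    · ext; simp only [Set.mem_insert_iff, Set.mem_singleton_iff]; tauto
  · have := cl 1 1 (-1) 0 (α - β) (β - 1) α (by omega) (by omega) (by omega) (by omega)
        (by omega) (by omega) (by omega) (by omega) (by omega)
    have h3 : α = 1 ∧ β = 1 ∧ γ = -1 := by omega
    left
    have hU' : IsUnit (dt (c - e) (a - e) (b - e)) := by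
      have : dt (c - e) (a - e) (b - e) = dt (a - e) (b - e) (c - e) := by simp [dt]; ring
      rw [this]; exact hU
    have := uequiv_of c a b d e γ α β hU' (by omega) (by intro i; rw [hd i]; ring) ![1, 1, 0]
      (by simp [h3]) (by simp [h3]) (by simp)
    convert this using 1
    ext; simp only [Set.mem_insert_iff, Set.mem_singleton_iff]; tauto

lemma swap12 {a b c d e : Fin 3 → ℤ} (hcl : Cl4 a b c d e) : Cl4 b a c d e := by
  intro z w1 w2 w3 w4 p1 p2 p3 p4 hp h
  have := hcl z w2 w1 w3 w4 p2 p1 p3 p4 (by omega) (by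
    intro i; linear_combination h i)
  simp only [Set.mem_insert_iff, Set.mem_singleton_iff] at this ⊢; tauto

lemma swap23 {a b c d e : Fin 3 → ℤ} (hcl : Cl4 a b c d e) : Cl4 a c b d e := by
  intro z w1 w2 w3 w4 p1 p2 p3 p4 hp h
  have := hcl z w1 w3 w2 w4 p1 p3 p2 p4 (by omega) (by
    intro i; linear_combination h i)
  simp only [Set.mem_insert_iff, Set.mem_singleton_iff] at this ⊢; tauto

lemma unit12 {u v w : Fin 3 → ℤ} (h : IsUnit (dt u v w)) : IsUnit (dt v u w) := by
  have : dt v u w = - dt u v w := by simp [dt]; ring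
  rw [this]; exact h.neg

lemma unit23 {u v w : Fin 3 → ℤ} (h : IsUnit (dt u v w)) : IsUnit (dt u w v) := by
  have : dt u w v = - dt u v w := by simp [dt]; ring
  rw [this]; exact h.neg

lemma set12 (a b c d e : Fin 3 → ℤ) :
    ({b, a, c, d, e} : Set (Fin 3 → ℤ)) = {a, b, c, d, e} := Set.insert_comm _ _ _

lemma set23 (a b c d e : Fin 3 → ℤ) :
    ({a, c, b, d, e} : Set (Fin 3 → ℤ)) = {a, b, c, d, e} := by
  rw [Set.insert_comm c b]

lemma unsorted (a b c d e : Fin 3 → ℤ) (α β γ : ℤ) (hU : IsUnit (dt (a - e) (b - e) (c - e)))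
    (hs : α + β + γ = 1) (hd : ∀ i, d i = α * a i + β * b i + γ * c i)
    (hcl : Cl4 a b c d e)
    (hda : d ≠ a) (hdb : d ≠ b) (hdc : d ≠ c) : Concl {a, b, c, d, e} := by
  rcases le_total α β with h1 | h1 <;> rcases le_total β γ with h2 | h2 <;>
    rcases le_total α γ with h3 | h3
  · rw [← set12, ← set23, ← set12]
    exact sorted_case c b a d e γ β α (unit12 (unit23 (unit12 hU))) (by omega)
      (by intro i; rw [hd i]; ring) (swap12 (swap23 (swap12 hcl))) h2 h1 hdc
  · rw [← set12, ← set23, ← set12]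
    exact sorted_case c b a d e γ β α (unit12 (unit23 (unit12 hU))) (by omega)
      (by intro i; rw [hd i]; ring) (swap12 (swap23 (swap12 hcl))) h2 h1 hdc
  · rw [← set12, ← set23]
    exact sorted_case b c a d e β γ α (unit23 (unit12 hU)) (by omega)
      (by intro i; rw [hd i]; ring) (swap23 (swap12 hcl)) h2 h3 hdb
  · rw [← set12]
    exact sorted_case b a c d e β α γ (unit12 hU) (by omega)
      (by intro i; rw [hd i]; ring) (swap12 hcl) h1 h3 hdb
  · rw [← set23, ← set12]
    exact sorted_case c a b d e γ α β (unit12 (unit23 hU)) (by omega)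
      (by intro i; rw [hd i]; ring) (swap12 (swap23 hcl)) h3 h1 hdc
  · rw [← set23]
    exact sorted_case a c b d e α γ β (unit23 hU) (by omega)
      (by intro i; rw [hd i]; ring) (swap23 hcl) h3 h2 hda
  · exact sorted_case a b c d e α β γ hU hs hd hcl h1 h2 hda
  · exact sorted_case a b c d e α β γ hU hs hd hcl h1 h2 hda

lemma core_s19 (a b c d e f : Fin 3 → ℤ) (fu : dotZ f (a - e) = -1) (fv : dotZ f (b - e) = -1)
    (fw : dotZ f (c - e) = -1) (fd : dotZ f (d - e) = -1)
    (hU : IsUnit (dt (a - e) (b - e) (c - e)))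
    (hcl : Cl4 a b c d e)
    (hda : d ≠ a) (hdb : d ≠ b) (hdc : d ≠ c) : Concl {a, b, c, d, e} := by
  have hc := cramer (a - e) (b - e) (c - e) (d - e)
  obtain ⟨α, β, γ, h⟩ : ∃ α β γ : ℤ, ∀ i, (d - e) i = α * (a - e) i + β * (b - e) i
      + γ * (c - e) i := by
    rcases Int.isUnit_iff.mp hU with h | h
    · rw [h] at hc
      exact ⟨dt (d - e) (b - e) (c - e), dt (a - e) (d - e) (c - e),
        dt (a - e) (b - e) (d - e), fun i => by linear_combination hc i⟩
    · rw [h] at hc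
      refine ⟨-dt (d - e) (b - e) (c - e), -dt (a - e) (d - e) (c - e),
        -dt (a - e) (b - e) (d - e), fun i => by linear_combination -hc i⟩
  have hs : α + β + γ = 1 := by
    rw [dotZ_eq] at fu fv fw fd
    linear_combination f 0 * h 0 + f 1 * h 1 + f 2 * h 2 - fd + α * fu + β * fv + γ * fw
  refine unsorted a b c d e α β γ hU hs ?_ hcl hda hdb hdc
  intro i
  have := h i
  simp only [Pi.sub_apply] at this
  linear_combination this - e i * hs

lemma range5 (q : Fin 5 → Fin 3 → ℤ) : Set.range q = {q 0, q 1, q 2, q 3, q 4} := by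
  ext x
  simp only [Set.mem_range, Set.mem_insert_iff, Set.mem_singleton_iff, Fin.exists_fin_succ]
  simp [eq_comm]
  
lemma toR_hull (p : Fin 5 → Fin 3 → ℤ)
    (hp : ∀ z : Fin 3 → ℤ, toR z ∈ convexHull ℝ (toR '' Set.range p) → z ∈ Set.range p)
    (z : Fin 3 → ℤ) (k : Fin 4 → Fin 5) (w : Fin 4 → ℤ) (hw : ∀ j, 0 ≤ w j) (hs : 0 < ∑ j, w j)
    (h : ∀ i, (∑ j, w j) * z i = ∑ j, w j * p (k j) i) : z ∈ Set.range p := by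
  apply hp
  have hs' : (0 : ℝ) < ∑ j, (w j : ℝ) := by exact_mod_cast hs
  have hz : toR z = ∑ j, ((w j : ℝ) / ∑ j, (w j : ℝ)) • toR (p (k j)) := by
    ext i
    have hi : (∑ j, (w j : ℝ)) * (z i : ℝ) = ∑ j, (w j : ℝ) * (p (k j) i : ℝ) := by
      exact_mod_cast h i
    simp only [toR, Finset.sum_apply, Pi.smul_apply, smul_eq_mul]
    rw [← mul_right_inj' hs'.ne', hi, Finset.mul_sum]
    refine Finset.sum_congr rfl fun j _ => ?_
    field_simp
  rw [hz]
  refine (convex_convexHull ℝ _).sum_mem ?_ ?_ ?_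
  · intro j _
    have : (0 : ℝ) ≤ w j := by exact_mod_cast hw j
    positivity
  · rw [← Finset.sum_div, div_self hs'.ne']
  · intro j _
    exact subset_convexHull ℝ _ ⟨_, ⟨k j, rfl⟩, rfl⟩

lemma exists_triple (p : Fin 5 → Fin 3 → ℤ)
    (hp : affineSpan ℝ (Set.range fun k => toR (p k)) = ⊤) (e : Fin 5) :
    ∃ k : Fin 3 → Fin 5, dt (p (k 0) - p e) (p (k 1) - p e) (p (k 2) - p e) ≠ 0 := by
  have hv : vectorSpan ℝ (Set.range fun k => toR (p k)) = ⊤ := by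
    rw [← direction_affineSpan, hp, AffineSubspace.direction_top]
  rw [vectorSpan_eq_span_vsub_set_right ℝ (p := toR (p e))
    (show toR (p e) ∈ Set.range fun k => toR (p k) from ⟨e, rfl⟩)] at hv
  set s := (fun x => x -ᵥ toR (p e)) '' (Set.range fun k => toR (p k)) with hsdef
  obtain ⟨g, hg, -, hli⟩ := Submodule.exists_fun_fin_finrank_span_eq ℝ s
  have hfr : Module.finrank ℝ (Submodule.span ℝ s) = 3 := by
    rw [hv, finrank_top]; simp
  revert g
  rw [hfr]
  intro g hg hli
  have hk : ∀ i, ∃ k, toR (p k) - toR (p e) = g i := by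
    intro i
    obtain ⟨_, ⟨k, rfl⟩, hk⟩ := hg i
    exact ⟨k, hk⟩
  choose k hk using hk
  refine ⟨k, fun h0 => ?_⟩
  have hu := (Matrix.linearIndependent_rows_iff_isUnit (A := Matrix.of g)).mp hli
  rw [Matrix.isUnit_iff_isUnit_det, isUnit_iff_ne_zero] at hu
  apply hu
  have hc : ∀ i j, g i j = ((p (k i) - p e) j : ℤ) := by
    intro i j
    rw [← hk i]; simp [toR]
  rw [Matrix.det_fin_three]
  simp only [Matrix.of_apply, hc]
  have : ((dt (p (k 0) - p e) (p (k 1) - p e) (p (k 2) - p e) : ℤ) : ℝ) = 0 := by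
    rw [h0]; simp
  rw [dt] at this
  push_cast at this ⊢
  linear_combination this

lemma classify (p : Fin 5 → Fin 3 → ℤ) (hp : GoodFive p) : Concl (Set.range p) := by
  obtain ⟨hinj, haff, hhull, f, -, c, hcard, hlev⟩ := hp
  -- the apex
  obtain ⟨e, he⟩ : ∃ e, Finset.univ.filter (fun k => ¬ dotZ f (p k) = c) = {e} := by
    rw [← Finset.card_eq_one]
    have := Finset.card_filter_add_card_filter_not (s := (Finset.univ : Finset (Fin 5)))
      (fun k => dotZ f (p k) = c)
    rw [hcard] at this
    simp only [Finset.card_univ, Fintype.card_fin] at this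
    omega
  have hek : ∀ k, ¬ dotZ f (p k) = c ↔ k = e := by
    intro k
    have : k ∈ Finset.univ.filter (fun k => ¬ dotZ f (p k) = c) ↔ k ∈ ({e} : Finset _) := by rw [he]
    simpa using this
  have hee : dotZ f (p e) = c + 1 := (hlev e).resolve_left ((hek e).mpr rfl)
  have hne : ∀ k, k ≠ e → dotZ f (p k - p e) = -1 := by
    intro k hk
    have h1 : dotZ f (p k) = c := by
      by_contra h; exact hk ((hek k).mp h)
    rw [dotZ_eq] at *
    simp only [Pi.sub_apply]
    linear_combination h1 - hee
  let T : (Fin 3 → Fin 5) → ℤ := fun k => dt (p (k 0) - p e) (p (k 1) - p e) (p (k 2) - p e)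
  obtain ⟨k0, hk0⟩ := exists_triple p haff e
  obtain ⟨k, hkm, hmin⟩ := Finset.exists_min_image
    (Finset.univ.filter fun k : Fin 3 → Fin 5 => T k ≠ 0) (fun k => |T k|)
    ⟨k0, by simpa using hk0⟩
  have hT : T k ≠ 0 := by simpa using hkm
  have hmin' : ∀ i j l, T ![i, j, l] ≠ 0 → |T k| ≤ |T ![i, j, l]| := by
    intro i j l h
    exact hmin _ (by simpa using h)
  obtain ⟨i, j, l, hi⟩ : ∃ i j l, k = ![i, j, l] := ⟨k 0, k 1, k 2, by ext x; fin_cases x <;> rfl⟩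
  rw [hi] at hT hmin'
  simp only [T, Matrix.cons_val] at hT hmin'
  have nij : i ≠ j := by rintro rfl; apply hT; simp [dt]; ring
  have nil : i ≠ l := by rintro rfl; apply hT; simp [dt]; ring
  have njl : j ≠ l := by rintro rfl; apply hT; simp [dt]; ring
  have nie : i ≠ e := by rintro rfl; apply hT; simp [dt]
  have nje : j ≠ e := by rintro rfl; apply hT; simp [dt]
  have nle : l ≠ e := by rintro rfl; apply hT; simp [dt]
  obtain ⟨m, nmi, nmj, nml, nme, hall⟩ : ∃ m, m ≠ i ∧ m ≠ j ∧ m ≠ l ∧ m ≠ e ∧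
      ∀ x, x = i ∨ x = j ∨ x = l ∨ x = m ∨ x = e := by
    clear * - nij nil njl nie nje nle
    revert i j l e
    decide
  have hr : Set.range p = {p i, p j, p l, p m, p e} := by
    ext x
    simp only [Set.mem_range, Set.mem_insert_iff, Set.mem_singleton_iff]
    constructor
    · rintro ⟨y, rfl⟩
      rcases hall y with rfl | rfl | rfl | rfl | rfl <;> simp
    · rintro (rfl | rfl | rfl | rfl | rfl) <;> exact ⟨_, rfl⟩
  have hcl : Cl4 (p i) (p j) (p l) (p m) (p e) := by
    intro z w1 w2 w3 w4 p1 p2 p3 p4 hp h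
    rw [← hr]
    refine toR_hull p hhull z ![i, j, l, m] ![w1, w2, w3, w4] ?_ ?_ ?_
    · intro j; fin_cases j <;> simpa
    · simpa [Fin.sum_univ_four] using hp
    · simpa [Fin.sum_univ_four] using h
  rw [hr]
  refine core_s19 _ _ _ _ _ f (hne i nie) (hne j nje) (hne l nle) (hne m nme) ?_ hcl
    (hinj.ne nmi) (hinj.ne nmj) (hinj.ne nml)
  exact det_unit _ _ _ _ _ f (hne i nie) (hne j nje) (hne l nle) hT hcl
    (hmin' m j l) (hmin' i m l) (hmin' i j m)

lemma hull_le (p : Fin 5 → Fin 3 → ℤ) (g : Fin 3 → ℤ) (r : ℤ) (h : ∀ k, dotZ g (p k) ≤ r)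
    (z : Fin 3 → ℤ) (hz : toR z ∈ convexHull ℝ (toR '' Set.range p)) : dotZ g z ≤ r := by
  let L : (Fin 3 → ℝ) →ₗ[ℝ] ℝ := ∑ i, (g i : ℝ) • LinearMap.proj i
  have hL : ∀ x : Fin 3 → ℤ, L (toR x) = (dotZ g x : ℝ) := by
    intro x
    simp [L, toR, dotZ]
  have hsub : convexHull ℝ (toR '' Set.range p) ⊆ {x | L x ≤ (r : ℝ)} := by
    apply convexHull_min
    · rintro _ ⟨_, ⟨k, rfl⟩, rfl⟩
      simp only [Set.mem_ofPred_eq, hL]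
      exact_mod_cast h k
    · exact convex_halfSpace_le L.isLinear _
  have := hsub hz
  simp only [Set.mem_ofPred_eq, hL] at this
  exact_mod_cast this

lemma span_top (p : Fin 5 → Fin 3 → ℤ) (h0 : p 0 = ![0,0,0]) (k : Fin 3 → Fin 5)
    (h : ∀ i, p (k i) = Pi.single i 1) :
    affineSpan ℝ (Set.range fun k => toR (p k)) = ⊤ := by
  rw [AffineSubspace.affineSpan_eq_top_iff_vectorSpan_eq_top_of_nonempty ℝ _ _ (Set.range_nonempty _)]
  rw [eq_top_iff, ← (Pi.basisFun ℝ (Fin 3)).span_eq, Submodule.span_le]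
  rintro _ ⟨i, rfl⟩
  have : (Pi.basisFun ℝ (Fin 3)) i = toR (p (k i)) -ᵥ toR (p 0) := by
    rw [h i, h0]
    ext j
    fin_cases i <;> fin_cases j <;> simp [toR]
  rw [this]
  exact vsub_mem_vectorSpan ℝ ⟨_, rfl⟩ ⟨_, rfl⟩

lemma vec_eq (z : Fin 3 → ℤ) (a b c : ℤ) (h0 : z 0 = a) (h1 : z 1 = b) (h2 : z 2 = c) :
    z = ![a, b, c] := by
  ext i; fin_cases i <;> simpa

lemma good1 : GoodFive ![![0,0,0], ![1,0,0], ![0,1,0], ![1,1,0], ![0,0,1]] := by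
  refine ⟨by decide, span_top _ rfl ![1, 2, 4] (by decide), ?_, ![0,0,1], by decide, 0,
    by decide, by decide⟩
  intro z hz
  have h1 := hull_le _ ![-1,0,0] 0 (by decide) z hz
  have h2 := hull_le _ ![0,-1,0] 0 (by decide) z hz
  have h3 := hull_le _ ![0,0,-1] 0 (by decide) z hz
  have h4 := hull_le _ ![1,0,1] 1 (by decide) z hz
  have h5 := hull_le _ ![0,1,1] 1 (by decide) z hz
  rw [dotZ_eq] at h1 h2 h3 h4 h5
  simp at h1 h2 h3 h4 h5
  have : (z 0 = 0 ∧ z 1 = 0 ∧ z 2 = 0) ∨ (z 0 = 1 ∧ z 1 = 0 ∧ z 2 = 0) ∨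
    (z 0 = 0 ∧ z 1 = 1 ∧ z 2 = 0) ∨ (z 0 = 1 ∧ z 1 = 1 ∧ z 2 = 0) ∨
    (z 0 = 0 ∧ z 1 = 0 ∧ z 2 = 1) := by omega
  rcases this with ⟨a, b, c⟩ | ⟨a, b, c⟩ | ⟨a, b, c⟩ | ⟨a, b, c⟩ | ⟨a, b, c⟩ <;>
    rw [vec_eq z _ _ _ a b c]
  exacts [⟨0, rfl⟩, ⟨1, rfl⟩, ⟨2, rfl⟩, ⟨3, rfl⟩, ⟨4, rfl⟩]

lemma good2 : GoodFive ![![0,0,0], ![1,0,0], ![0,1,0], ![-1,-1,0], ![0,0,1]] := by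
  refine ⟨by decide, span_top _ rfl ![1, 2, 4] (by decide), ?_, ![0,0,1], by decide, 0,
    by decide, by decide⟩
  intro z hz
  have h1 := hull_le _ ![1,1,1] 1 (by decide) z hz
  have h2 := hull_le _ ![1,-2,1] 1 (by decide) z hz
  have h3 := hull_le _ ![0,0,-1] 0 (by decide) z hz
  have h4 := hull_le _ ![-2,1,1] 1 (by decide) z hz
  rw [dotZ_eq] at h1 h2 h3 h4
  simp at h1 h2 h3 h4
  have : (z 0 = 0 ∧ z 1 = 0 ∧ z 2 = 0) ∨ (z 0 = 1 ∧ z 1 = 0 ∧ z 2 = 0) ∨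
    (z 0 = 0 ∧ z 1 = 1 ∧ z 2 = 0) ∨ (z 0 = -1 ∧ z 1 = -1 ∧ z 2 = 0) ∨
    (z 0 = 0 ∧ z 1 = 0 ∧ z 2 = 1) := by omega
  rcases this with ⟨a, b, c⟩ | ⟨a, b, c⟩ | ⟨a, b, c⟩ | ⟨a, b, c⟩ | ⟨a, b, c⟩ <;>
    rw [vec_eq z _ _ _ a b c]
  exacts [⟨0, rfl⟩, ⟨1, rfl⟩, ⟨2, rfl⟩, ⟨3, rfl⟩, ⟨4, rfl⟩]

lemma good3 : GoodFive ![![0,0,0], ![1,0,0], ![-1,0,0], ![0,1,0], ![0,0,1]] := by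
  refine ⟨by decide, span_top _ rfl ![1, 3, 4] (by decide), ?_, ![0,0,1], by decide, 0,
    by decide, by decide⟩
  intro z hz
  have h1 := hull_le _ ![1,1,1] 1 (by decide) z hz
  have h2 := hull_le _ ![0,-1,0] 0 (by decide) z hz
  have h3 := hull_le _ ![0,0,-1] 0 (by decide) z hz
  have h4 := hull_le _ ![-1,1,1] 1 (by decide) z hz
  rw [dotZ_eq] at h1 h2 h3 h4
  simp at h1 h2 h3 h4
  have : (z 0 = 0 ∧ z 1 = 0 ∧ z 2 = 0) ∨ (z 0 = 1 ∧ z 1 = 0 ∧ z 2 = 0) ∨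
    (z 0 = -1 ∧ z 1 = 0 ∧ z 2 = 0) ∨ (z 0 = 0 ∧ z 1 = 1 ∧ z 2 = 0) ∨
    (z 0 = 0 ∧ z 1 = 0 ∧ z 2 = 1) := by omega
  rcases this with ⟨a, b, c⟩ | ⟨a, b, c⟩ | ⟨a, b, c⟩ | ⟨a, b, c⟩ | ⟨a, b, c⟩ <;>
    rw [vec_eq z _ _ _ a b c]
  exacts [⟨0, rfl⟩, ⟨1, rfl⟩, ⟨2, rfl⟩, ⟨3, rfl⟩, ⟨4, rfl⟩]

/-- An equivalence induces an injection of indices preserving integer affine relations. -/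
lemma transfer (p q : Fin 5 → Fin 3 → ℤ) (hp : Function.Injective p)
    (h : UEquiv (Set.range p) (Set.range q)) :
    ∃ σ : Fin 5 → Fin 5, Function.Injective σ ∧ ∀ w0 w1 w2 w3 : ℤ, w0 + w1 + w2 + w3 = 0 →
      w0 • p 0 + w1 • p 1 + w2 • p 2 + w3 • p 3 = 0 →
      w0 • q (σ 0) + w1 • q (σ 1) + w2 • q (σ 2) + w3 • q (σ 3) = 0 := by
  obtain ⟨A, b, hA, himg⟩ := h
  have hs : ∀ k, ∃ l, q l = A.mulVec (p k) + b := by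
    intro k
    have : A.mulVec (p k) + b ∈ Set.range q := by
      rw [← himg]; exact ⟨p k, ⟨k, rfl⟩, rfl⟩
    exact this
  choose σ hσ using hs
  refine ⟨σ, ?_, ?_⟩
  · intro k l hkl
    have h1 := hσ k
    rw [hkl, hσ l] at h1
    have h2 := add_right_cancel h1
    have := Matrix.mulVec_injective_of_isUnit ((Matrix.isUnit_iff_isUnit_det A).mpr hA) h2
    exact (hp this).symm
  · intro w0 w1 w2 w3 hw hr
    have h1 := congrArg A.mulVec hr
    simp only [Matrix.mulVec_add, Matrix.mulVec_smul, Matrix.mulVec_zero] at h1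
    simp only [hσ]
    have : w0 • (A.mulVec (p 0) + b) + w1 • (A.mulVec (p 1) + b) + w2 • (A.mulVec (p 2) + b)
      + w3 • (A.mulVec (p 3) + b) = (w0 • A.mulVec (p 0) + w1 • A.mulVec (p 1)
      + w2 • A.mulVec (p 2) + w3 • A.mulVec (p 3)) + (w0 + w1 + w2 + w3) • b := by module
    rw [this, h1, hw]; simp

/-- Up to unimodular equivalence, the lattice 3-polytopes of size 5 and width
one with exactly 4 lattice points on one lattice plane are exactly the three
listed configurations, and no two of them are equivalent. -/
theorem width_one_four_on_a_plane_classification :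
    letI q1 : Fin 5 → Fin 3 → ℤ := ![![0,0,0], ![1,0,0], ![0,1,0], ![1,1,0], ![0,0,1]]
    letI q2 : Fin 5 → Fin 3 → ℤ := ![![0,0,0], ![1,0,0], ![0,1,0], ![-1,-1,0], ![0,0,1]]
    letI q3 : Fin 5 → Fin 3 → ℤ := ![![0,0,0], ![1,0,0], ![-1,0,0], ![0,1,0], ![0,0,1]]
    (∀ p : Fin 5 → Fin 3 → ℤ, GoodFive p →
      UEquiv (Set.range p) (Set.range q1) ∨
      UEquiv (Set.range p) (Set.range q2) ∨
      UEquiv (Set.range p) (Set.range q3)) ∧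
    GoodFive q1 ∧ GoodFive q2 ∧ GoodFive q3 ∧
    ¬ UEquiv (Set.range q1) (Set.range q2) ∧
    ¬ UEquiv (Set.range q1) (Set.range q3) ∧
    ¬ UEquiv (Set.range q2) (Set.range q3) := by
  
  refine ⟨?_, good1, good2, good3, ?_, ?_, ?_⟩
  · intro p hp
    have := classify p hp
    unfold Concl at this
    rw [range5 ![![0,0,0], ![1,0,0], ![0,1,0], ![1,1,0], ![0,0,1]],
      range5 ![![0,0,0], ![1,0,0], ![0,1,0], ![-1,-1,0], ![0,0,1]],
      range5 ![![0,0,0], ![1,0,0], ![-1,0,0], ![0,1,0], ![0,0,1]]]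
    exact this
  · intro h
    obtain ⟨σ, hσ, hr⟩ := transfer _ _ (by decide) h
    have h1 := hr 1 (-1) (-1) 1 (by decide) (by decide)
    have n1 := hσ.ne (show (0 : Fin 5) ≠ 1 by decide)
    have n2 := hσ.ne (show (0 : Fin 5) ≠ 2 by decide)
    clear * - h1 n1 n2
    generalize σ 0 = a at *
    generalize σ 1 = b at *
    generalize σ 2 = c at *
    generalize σ 3 = d at *
    revert a b c d
    set_option maxRecDepth 100000 in decide
  · intro h
    obtain ⟨σ, hσ, hr⟩ := transfer _ _ (by decide) h
    have h1 := hr 1 (-1) (-1) 1 (by decide) (by decide)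
    have n1 := hσ.ne (show (0 : Fin 5) ≠ 1 by decide)
    have n2 := hσ.ne (show (0 : Fin 5) ≠ 2 by decide)
    have n3 := hσ.ne (show (0 : Fin 5) ≠ 3 by decide)
    have n4 := hσ.ne (show (1 : Fin 5) ≠ 2 by decide)
    clear * - h1 n1 n2 n3 n4
    generalize σ 0 = a at *
    generalize σ 1 = b at *
    generalize σ 2 = c at *
    generalize σ 3 = d at *
    revert a b c d
    set_option maxRecDepth 100000 in decide
  · intro h
    obtain ⟨σ, hσ, hr⟩ := transfer _ _ (by decide) h
    have h1 := hr (-3) 1 1 1 (by decide) (by decide)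
    have n1 := hσ.ne (show (0 : Fin 5) ≠ 1 by decide)
    have n2 := hσ.ne (show (0 : Fin 5) ≠ 2 by decide)
    have n3 := hσ.ne (show (0 : Fin 5) ≠ 3 by decide)
    have n4 := hσ.ne (show (1 : Fin 5) ≠ 2 by decide)
    have n5 := hσ.ne (show (1 : Fin 5) ≠ 3 by decide)
    have n6 := hσ.ne (show (2 : Fin 5) ≠ 3 by decide)
    clear * - h1 n1 n2 n3 n4 n5 n6
    generalize σ 0 = a at *
    generalize σ 1 = b at *
    generalize σ 2 = c at *
    generalize σ 3 = d at *
    revert a b c d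
    set_option maxRecDepth 100000 in decide
end
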